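/- arXiv:1501.04507 — 2 statements merged into one kernel-verified Lean document; each statement's English description precedes it below -/
import Mathlib

section
/- Let f be a support point of S⁰(𝔹ₙ) and let (f_t)_{t≥0} be a normalized Loewner chain with f₀ = f such that {e^{−t} f_t : t ≥ 0} is a normal family on 𝔹ₙ. Then e^{−t}·f_t is a support point of S⁰(𝔹ₙ) for every t ≥ 0. -/
open Metric Filter Set MeasureTheory

noncomputable section

/-- ℂⁿ with the Euclidean (Hermitian) norm. -/
abbrev En (n : ℕ) : Type := EuclideanSpace ℂ (Fin n)

/-- The open Euclidean unit ball 𝔹ₙ ⊂ ℂⁿ. -/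
def Ball (n : ℕ) : Set (En n) := Metric.ball 0 1

/-- A map is univalent on 𝔹ₙ if it is holomorphic and injective there. -/
def UnivalentOn (n : ℕ) (f : En n → En n) : Prop :=
  DifferentiableOn ℂ f (Ball n) ∧ Set.InjOn f (Ball n)

/-- The class S(𝔹ₙ): univalent maps with f(0) = 0 and Df(0) = I. -/
def ClassS (n : ℕ) (f : En n → En n) : Prop :=
  UnivalentOn n f ∧ f 0 = 0 ∧ fderiv ℂ f 0 = ContinuousLinearMap.id ℂ (En n)

/-- A Loewner chain on 𝔹ₙ: a family (f_t)_{t ≥ 0} of univalent maps with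
increasing images, locally absolutely continuous in t, uniformly on compacta. -/
def IsLoewnerChain (n : ℕ) (f : ℝ → En n → En n) : Prop :=
  (∀ t, 0 ≤ t → UnivalentOn n (f t)) ∧
  (∀ s t, 0 ≤ s → s ≤ t → f s '' Ball n ⊆ f t '' Ball n) ∧
  (∀ K : Set (En n), K ⊆ Ball n → IsCompact K → ∀ T : ℝ, 0 < T →
    ∃ c : ℝ → ℝ, (∀ τ, 0 ≤ c τ) ∧ IntegrableOn c (Set.Icc 0 T) ∧
      ∀ z ∈ K, ∀ s t : ℝ, 0 ≤ s → s ≤ t → t ≤ T →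
        ‖f s z - f t z‖ ≤ ∫ τ in Set.Icc s t, c τ)

/-- A normalized Loewner chain: f_t(0) = 0 and Df_t(0) = eᵗ·I for all t ≥ 0. -/
def IsNormalizedLoewnerChain (n : ℕ) (f : ℝ → En n → En n) : Prop :=
  IsLoewnerChain n f ∧ ∀ t, 0 ≤ t → f t 0 = 0 ∧
    fderiv ℂ (f t) 0 = (Real.exp t : ℂ) • ContinuousLinearMap.id ℂ (En n)

/-- The family {e^{−t} f_t : t ≥ 0} is a normal family, i.e. locally uniformly
bounded on 𝔹ₙ. -/
def IsNormalFamilyChain (n : ℕ) (f : ℝ → En n → En n) : Prop :=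
  ∀ K : Set (En n), K ⊆ Ball n → IsCompact K →
    ∃ M : ℝ, ∀ t, 0 ≤ t → ∀ z ∈ K, Real.exp (-t) * ‖f t z‖ ≤ M

/-- S⁰(𝔹ₙ): maps of S(𝔹ₙ) with parametric representation, i.e. the initial
element of a normalized Loewner chain (f_t) such that {e^{−t} f_t} is a normal
family. -/
def MemS0 (n : ℕ) (f : En n → En n) : Prop :=
  ClassS n f ∧ ∃ F : ℝ → En n → En n,
    IsNormalizedLoewnerChain n F ∧ IsNormalFamilyChain n F ∧ F 0 = f

/-- The evolution family φ_{s,t} = f_t⁻¹ ∘ f_s of a Loewner chain. -/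
def evolution (n : ℕ) (F : ℝ → En n → En n) (s t : ℝ) : En n → En n :=
  fun z => Function.invFunOn (F t) (Ball n) (F s z)

/-- A ℂ-linear functional on maps 𝔹ₙ → ℂⁿ, continuous with respect to locally
uniform convergence on 𝔹ₙ of holomorphic maps. -/
def IsContinuousLinearFunctional (n : ℕ) (L : (En n → En n) → ℂ) : Prop :=
  (∀ f g : En n → En n, L (f + g) = L f + L g) ∧
  (∀ (c : ℂ) (f : En n → En n), L (c • f) = c * L f) ∧
  (∀ (f : ℕ → En n → En n) (g : En n → En n),
    (∀ k, DifferentiableOn ℂ (f k) (Ball n)) → DifferentiableOn ℂ g (Ball n) →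
    TendstoLocallyUniformlyOn f g atTop (Ball n) →
    Tendsto (fun k => L (f k)) atTop (nhds (L g)))

/-- f is a support point of A ⊆ Hol(𝔹ₙ,ℂⁿ): f ∈ A and there is a continuous
ℂ-linear functional L whose real part is nonconstant on A and is maximized
over A at f. -/
def IsSupportPoint (n : ℕ) (A : Set (En n → En n)) (f : En n → En n) : Prop :=
  f ∈ A ∧ ∃ L : (En n → En n) → ℂ, IsContinuousLinearFunctional n L ∧
    (∃ g₁ ∈ A, ∃ g₂ ∈ A, (L g₁).re ≠ (L g₂).re) ∧
    (∀ g ∈ A, (L g).re ≤ (L f).re)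

section
open Metric Filter Set MeasureTheory
open scoped Topology ContDiff

/-- Directional derivatives of a holomorphic map are holomorphic. -/
theorem holo_differentiableAt_fderiv_apply {E F : Type} [NormedAddCommGroup E] [NormedSpace ℂ E]
    [FiniteDimensional ℂ E] [NormedAddCommGroup F] [NormedSpace ℂ F] [FiniteDimensional ℂ F]
    {U : Set E} (hU : IsOpen U) {f : E → F} (hf : DifferentiableOn ℂ f U) (v : E)
    {x₀ : E} (hx₀ : x₀ ∈ U) : DifferentiableAt ℂ (fun x => fderiv ℂ f x v) x₀ := by
  have : CompleteSpace F := FiniteDimensional.complete ℂ F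
  have : ProperSpace E := FiniteDimensional.proper ℂ E
  have : ProperSpace F := FiniteDimensional.proper ℂ F
  have : ProperSpace (E →L[ℂ] F) := FiniteDimensional.proper ℂ _
  obtain ⟨ε, hε, hεU⟩ := Metric.nhds_basis_closedBall.mem_iff.1 (hU.mem_nhds hx₀)
  obtain ⟨M, hM⟩ := (isCompact_closedBall x₀ ε).exists_bound_of_continuousOn
    (hf.continuousOn.mono hεU)
  have hbd : ∀ y ∈ ball x₀ (ε/2), ‖fderiv ℂ f y‖ ≤ (2*M)/(ε/2) := by
    intro y hy
    have hsub : ball y (ε/2) ⊆ closedBall x₀ ε := by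
      intro z hz
      rw [mem_ball] at hy hz
      rw [mem_closedBall]
      linarith [dist_triangle z y x₀]
    refine Complex.norm_fderiv_le_div_of_mapsTo_ball (hf.mono (hsub.trans hεU)) ?_ (by positivity)
    intro z hz
    rw [mem_closedBall, dist_eq_norm]
    have h1 := hM z (hsub hz)
    have h2 := hM y (hsub (mem_ball_self (by positivity)))
    linarith [norm_sub_le (f z) (f y)]
  obtain ⟨R, hR, hRv⟩ : ∃ R : ℝ, 0 < R ∧ R * ‖v‖ < ε/4 := by
    refine ⟨ε/4/(‖v‖+1), by positivity, ?_⟩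
    rw [div_mul_eq_mul_div, div_lt_iff₀ (by positivity)]
    nlinarith [norm_nonneg v]
  have hmem : ∀ x ∈ ball x₀ (ε/4), ∀ ζ ∈ closedBall (0:ℂ) R, x + ζ • v ∈ ball x₀ (ε/2) := by
    intro x hx ζ hζ
    rw [mem_ball, dist_eq_norm] at hx ⊢
    rw [mem_closedBall, dist_zero_right] at hζ
    have : ‖ζ • v‖ ≤ R * ‖v‖ := by rw [norm_smul]; gcongr
    calc ‖x + ζ • v - x₀‖ = ‖(x - x₀) + ζ • v‖ := by congr 1; abel
      _ ≤ _ := norm_add_le _ _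
      _ < ε/2 := by linarith
  have hballU : ball x₀ (ε/2) ⊆ U := fun y hy => hεU (by
    rw [mem_ball] at hy; rw [mem_closedBall]; linarith)
  have hdU : ∀ y ∈ ball x₀ (ε/2), DifferentiableAt ℂ f y := fun y hy =>
    (hf y (hballU hy)).differentiableAt (hU.mem_nhds (hballU hy))
  -- Cauchy formula
  have hcauchy : ∀ x ∈ ball x₀ (ε/4), fderiv ℂ f x v =
      (2 * Real.pi * Complex.I : ℂ)⁻¹ • ∮ ζ in C(0, R), (1 / (ζ - 0) ^ 2) • f (x + ζ • v) := by
    intro x hx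
    have hd : DifferentiableOn ℂ (fun ζ : ℂ => f (x + ζ • v)) (closedBall 0 R) := by
      intro ζ hζ
      have h1 := hdU _ (hmem x hx ζ hζ)
      have : DifferentiableAt ℂ (fun ζ : ℂ => x + ζ • v) ζ := by fun_prop
      exact (DifferentiableAt.comp (f := fun ζ : ℂ => x + ζ • v) ζ h1 this).differentiableWithinAt
    have hder : deriv (fun ζ : ℂ => f (x + ζ • v)) 0 = fderiv ℂ f x v := by
      have h1 := (hdU _ (hmem x hx 0 (by simp [hR.le]))).hasFDerivAt
      have h2 : HasDerivAt (fun ζ : ℂ => x + ζ • v) v 0 := by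
        simpa using ((hasDerivAt_id (0:ℂ)).smul_const v).const_add x
      have := h1.comp_hasDerivAt (0:ℂ) h2
      simpa [Function.comp_def] using this.deriv
    rw [← hder]
    have h3 := hd.deriv_eq_smul_circleIntegral hR
    rw [h3, smul_smul, inv_mul_cancel₀ Complex.two_pi_I_ne_zero, one_smul]
  have hev : (fun x => fderiv ℂ f x v) =ᶠ[𝓝 x₀] fun x =>
      (2 * Real.pi * Complex.I : ℂ)⁻¹ • ∮ ζ in C(0, R), (1 / (ζ - 0) ^ 2) • f (x + ζ • v) := by
    filter_upwards [ball_mem_nhds x₀ (show 0 < ε/4 by positivity)] with x hx using hcauchy x hx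
  refine DifferentiableAt.congr_of_eventuallyEq ?_ hev
  refine DifferentiableAt.const_smul ?_ _
  unfold circleIntegral
  have hcm : ∀ θ : ℝ, circleMap 0 R θ ∈ closedBall (0:ℂ) R := fun θ =>
    circleMap_mem_closedBall _ hR.le _
  have hne : ∀ θ : ℝ, circleMap 0 R θ ≠ 0 := fun θ => circleMap_ne_center hR.ne'
  let a : ℝ → ℂ := fun θ => deriv (circleMap 0 R) θ * (1 / (circleMap 0 R θ - 0) ^ 2)
  have ha : Continuous a := by
    have h1 : Continuous (circleMap 0 R) := continuous_circleMap 0 R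
    simp only [a, deriv_circleMap, sub_zero]
    refine Continuous.mul (by fun_prop) (Continuous.div continuous_const (h1.pow 2) fun θ => pow_ne_zero 2 (hne θ))
  have key := intervalIntegral.hasFDerivAt_integral_of_dominated_of_fderiv_le (μ := volume)
    (𝕜 := ℂ) (s := ball x₀ (ε/4)) (x₀ := x₀) (a := 0) (b := 2 * Real.pi)
    (F := fun x θ => deriv (circleMap 0 R) θ • ((1 / (circleMap 0 R θ - 0) ^ 2) •
      f (x + circleMap 0 R θ • v)))
    (F' := fun x θ => a θ • fderiv ℂ f (x + circleMap 0 R θ • v))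
    (bound := fun θ => ‖a θ‖ * ((2*M)/(ε/2)))
    (ball_mem_nhds x₀ (by positivity)) ?_ ?_ ?_ ?_ ?_ ?_
  · exact key.differentiableAt
  · filter_upwards [ball_mem_nhds x₀ (show 0 < ε/4 by positivity)] with x hx
    simp only [smul_smul]
    refine Continuous.aestronglyMeasurable (ha.smul ?_)
    refine hf.continuousOn.comp_continuous (by fun_prop) fun θ => hballU (hmem x hx _ (hcm θ))
  · simp only [smul_smul]
    refine Continuous.intervalIntegrable (ha.smul ?_) _ _
    refine hf.continuousOn.comp_continuous (by fun_prop) fun θ =>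
      hballU (hmem x₀ (mem_ball_self (by positivity)) _ (hcm θ))
  · refine Continuous.aestronglyMeasurable ha |>.smul ?_
    borelize E
    borelize (E →L[ℂ] F)
    have h1 : Measurable (fderiv ℂ f) := measurable_fderiv ℂ f
    have h2 : Measurable (fun θ : ℝ => x₀ + circleMap 0 R θ • v) :=
      Continuous.measurable (by fun_prop)
    exact (h1.comp h2).aestronglyMeasurable
  · refine Eventually.of_forall fun θ _ x hx => ?_
    rw [norm_smul]
    gcongr
    exact hbd _ (hmem x hx _ (hcm θ))
  · exact (ha.norm.mul continuous_const).intervalIntegrable _ _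
  · refine Eventually.of_forall fun θ _ x hx => ?_
    have h1 := (hdU _ (hmem x hx _ (hcm θ))).hasFDerivAt
    have h2 : HasFDerivAt (fun x : E => x + circleMap 0 R θ • v) (ContinuousLinearMap.id ℂ E) x :=
      (hasFDerivAt_id x).add_const _
    have h3 := (h1.comp x h2).const_smul (a θ)
    simp only [smul_smul]
    exact h3

theorem holo_differentiableOn_fderiv_apply {E F : Type} [NormedAddCommGroup E] [NormedSpace ℂ E]
    [FiniteDimensional ℂ E] [NormedAddCommGroup F] [NormedSpace ℂ F] [FiniteDimensional ℂ F]
    {U : Set E} (hU : IsOpen U) {f : E → F} (hf : DifferentiableOn ℂ f U) (v : E) :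
    DifferentiableOn ℂ (fun x => fderiv ℂ f x v) U := fun _ hx =>
  (holo_differentiableAt_fderiv_apply hU hf v hx).differentiableWithinAt

theorem holo_contDiffOn_nat {E F : Type} [NormedAddCommGroup E] [NormedSpace ℂ E]
    [FiniteDimensional ℂ E] [NormedAddCommGroup F] [NormedSpace ℂ F] [FiniteDimensional ℂ F]
    {U : Set E} (hU : IsOpen U) (k : ℕ) {f : E → F} (hf : DifferentiableOn ℂ f U)  :
    ContDiffOn ℂ k f U := by
  induction k generalizing f with
  | zero => simpa using hf.continuousOn
  | succ k ih =>
    push_cast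
    rw [contDiffOn_succ_iff_fderiv_of_isOpen hU]
    refine ⟨hf, by simp, ?_⟩
    rw [contDiffOn_clm_apply]
    intro y
    exact ih (holo_differentiableOn_fderiv_apply hU hf y)

theorem holo_contDiffOn {E F : Type} [NormedAddCommGroup E] [NormedSpace ℂ E]
    [FiniteDimensional ℂ E] [NormedAddCommGroup F] [NormedSpace ℂ F] [FiniteDimensional ℂ F]
    {U : Set E} (hU : IsOpen U) {f : E → F} (hf : DifferentiableOn ℂ f U)  :
    ContDiffOn ℂ ∞ f U := contDiffOn_infty.2 fun k => holo_contDiffOn_nat hU k hf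

theorem holo_contDiffAt {E F : Type} [NormedAddCommGroup E] [NormedSpace ℂ E]
    [FiniteDimensional ℂ E] [NormedAddCommGroup F] [NormedSpace ℂ F] [FiniteDimensional ℂ F]
    {U : Set E} (hU : IsOpen U) {f : E → F} (hf : DifferentiableOn ℂ f U) {x : E} (hx : x ∈ U) :
    ContDiffAt ℂ ∞ f x := (holo_contDiffOn hU hf).contDiffAt (hU.mem_nhds hx)

end

section
open Metric Filter Set MeasureTheory
open scoped Topology ContDiff

/-- Straightening of a regular level set. -/
theorem holo_straighten {E : Type} [NormedAddCommGroup E] [NormedSpace ℂ E]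
    [FiniteDimensional ℂ E] {U : Set E} (hU : IsOpen U) {g : E → ℂ}
    (hg : DifferentiableOn ℂ g U) {p : E} (hp : p ∈ U) {v : E} (hv : fderiv ℂ g p v = 1) :
    ∃ (Ψ : E → E) (V : Set E), IsOpen V ∧ p ∈ V ∧ DifferentiableOn ℂ Ψ V ∧ Ψ p = p ∧
      HasFDerivAt Ψ (ContinuousLinearMap.id ℂ E) p ∧ MapsTo Ψ V U ∧ InjOn Ψ V ∧
      ∀ y ∈ V, g (Ψ y) = g p + fderiv ℂ g p (y - p) := by
  have : CompleteSpace E := FiniteDimensional.complete ℂ E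
  set l := fderiv ℂ g p with hl
  let Φ : E → E := fun x => x + (g x - g p - l (x - p)) • v
  have hgp : ContDiffAt ℂ 1 g p := (holo_contDiffAt hU hg hp).of_le (by simp)
  have hΦ : ContDiffAt ℂ 1 Φ p := by
    refine contDiffAt_id.add (ContDiffAt.smul ((hgp.sub contDiffAt_const).sub ?_) contDiffAt_const)
    exact l.contDiff.contDiffAt.comp p (contDiffAt_id.sub contDiffAt_const)
  have hgd : HasFDerivAt g l p := (hgp.differentiableAt (by simp)).hasFDerivAt
  have hΦd : HasFDerivAt Φ ((ContinuousLinearEquiv.refl ℂ E : E ≃L[ℂ] E) : E →L[ℂ] E) p := by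
    have h1 : HasFDerivAt (fun x => l (x - p)) l p :=
      l.hasFDerivAt.comp p ((hasFDerivAt_id p).sub_const p)
    have h2 := ((hasFDerivAt_id p).add (((hgd.sub_const (g p)).sub h1).smul_const v))
    refine h2.congr_fderiv ?_
    ext x; simp
  have hΦp : Φ p = p := by simp [Φ]
  let e := hΦ.toOpenPartialHomeomorph Φ hΦd (by simp)
  have he : ∀ x, e x = Φ x := fun x => rfl
  have hpt : p ∈ e.target := by
    have := hΦ.image_mem_toOpenPartialHomeomorph_target hΦd (by simp)
    rwa [hΦp] at this
  have hps : p ∈ e.source := hΦ.mem_toOpenPartialHomeomorph_source hΦd (by simp)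
  have hsp : e.symm p = p := by
    have := e.left_inv hps
    rwa [he, hΦp] at this
  have hsm : ContDiffAt ℂ 1 e.symm p := by
    have := hΦ.to_localInverse hΦd (by simp)
    rw [hΦp] at this
    exact this
  have hev : ∀ᶠ y in 𝓝 p, y ∈ e.target ∧ DifferentiableAt ℂ e.symm y ∧ e.symm y ∈ U := by
    refine Eventually.and (e.open_target.mem_nhds hpt) (Eventually.and ?_ ?_)
    · exact (hsm.eventually (by simp)).mono fun y hy => hy.differentiableAt (by simp)
    · refine hsm.continuousAt.eventually ?_
      rw [hsp]; exact hU.mem_nhds hp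
  obtain ⟨V, hV, hVo, hpV⟩ := _root_.eventually_nhds_iff.1 hev
  refine ⟨e.symm, V, hVo, hpV, fun y hy => (hV y hy).2.1.differentiableWithinAt, hsp, ?_,
    fun y hy => (hV y hy).2.2, ?_, ?_⟩
  · have := e.hasFDerivAt_symm (f' := ContinuousLinearEquiv.refl ℂ E) hpt (by rw [hsp]; exact hΦd)
    exact this
  · exact e.symm.injOn.mono fun y hy => (hV y hy).1
  · intro y hy
    have h1 : Φ (e.symm y) = y := e.right_inv (hV y hy).1
    have h2 : l (y - p) = l (Φ (e.symm y) - p) := by rw [h1]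
    simp only [Φ] at h2
    rw [h2]
    simp [hv]
    ring

/-- One-variable case: an injective analytic function has nonzero derivative. -/
theorem holo_deriv_ne_zero_of_injOn {f : ℂ → ℂ} {z₀ : ℂ} (hf : AnalyticAt ℂ f z₀) {s : Set ℂ}
    (hs : s ∈ 𝓝 z₀) (hinj : InjOn f s) : deriv f z₀ ≠ 0 := by
  have hg : AnalyticAt ℂ (fun z => f z - f z₀) z₀ := hf.sub analyticAt_const
  have hnz : ¬ ∀ᶠ z in 𝓝 z₀, f z - f z₀ = 0 := by
    intro h
    have h2 : ∀ᶠ z in 𝓝[≠] z₀, False := by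
      filter_upwards [nhdsWithin_le_nhds h, nhdsWithin_le_nhds hs, self_mem_nhdsWithin]
        with z h1 h2 h3
      exact h3 (hinj h2 (mem_of_mem_nhds hs) (sub_eq_zero.1 h1))
    simp at h2
    exact (NeBot.ne (inferInstance : NeBot (𝓝[≠] z₀))) h2
  obtain ⟨k, u, hu, hu0, huf⟩ := hg.exists_eventuallyEq_pow_smul_nonzero_iff.2 hnz
  have hk0 : k ≠ 0 := by
    rintro rfl
    have := huf.self_of_nhds
    simp at this
    exact hu0 this.symm
  rcases Nat.lt_or_ge 1 k with hk | hk
  swap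
  · have hk1 : k = 1 := by omega
    subst hk1
    have h1 : HasDerivAt (fun z => (z - z₀)^1 • u z) (u z₀) z₀ := by
      have := ((hasDerivAt_id z₀).sub_const z₀).mul hu.differentiableAt.hasDerivAt
      refine (this.congr_deriv (by simp)).congr_of_eventuallyEq (Eventually.of_forall fun z => ?_)
      simp
    have h2 : HasDerivAt (fun z => f z - f z₀) (u z₀) z₀ := h1.congr_of_eventuallyEq huf
    have h3 : HasDerivAt f (u z₀) z₀ := by simpa using h2.add_const (f z₀)
    rw [h3.deriv]; exact hu0
  exfalso
  obtain ⟨c, hc⟩ := IsAlgClosed.exists_pow_nat_eq (u z₀) (Nat.pos_of_ne_zero hk0)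
  have hc0 : c ≠ 0 := by
    rintro rfl
    rw [zero_pow hk0] at hc
    exact hu0 hc.symm
  let q : ℂ → ℂ := fun z => c * (u z / u z₀) ^ ((1:ℂ)/k)
  have hq : AnalyticAt ℂ q z₀ := by
    refine analyticAt_const.mul (AnalyticAt.cpow (hu.div analyticAt_const hu0) analyticAt_const ?_)
    simp [hu0]
  have hq0 : q z₀ = c := by simp [q, hu0]
  have hqk : ∀ z, q z ^ k = u z := by
    intro z
    simp only [q, mul_pow, hc]
    rw [one_div, Complex.cpow_nat_inv_pow _ hk0]
    field_simp
  let w : ℂ → ℂ := fun z => (z - z₀) * q z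
  have hw : AnalyticAt ℂ w z₀ := (analyticAt_id.sub analyticAt_const).mul hq
  have hwd : HasStrictDerivAt w c z₀ := by
    have h1 : HasDerivAt w c z₀ := by
      have := ((hasDerivAt_id z₀).sub_const z₀).mul hq.differentiableAt.hasDerivAt
      exact this.congr_deriv (by simp [hq0])
    have := hw.hasStrictDerivAt
    rwa [h1.deriv] at this
  have hw0 : w z₀ = 0 := by simp [w]
  have hmap : map w (𝓝 z₀) = 𝓝 0 := by rw [hwd.map_nhds_eq hc0, hw0]
  let N : Set ℂ := {z | z ∈ s ∧ f z - f z₀ = (z - z₀)^k • u z}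
  have hN : N ∈ 𝓝 z₀ := Filter.inter_mem hs huf
  have hWN : w '' N ∈ 𝓝 (0:ℂ) := by rw [← hmap]; exact image_mem_map hN
  have hprim := Complex.isPrimitiveRoot_exp k hk0
  set om := Complex.exp (2 * Real.pi * Complex.I / k)
  have hom1 : om ≠ 1 := hprim.ne_one hk
  have homk : om ^ k = 1 := hprim.pow_eq_one
  have hev : ∀ᶠ η in 𝓝 (0:ℂ), om * η ∈ w '' N := by
    have : Tendsto (fun η : ℂ => om * η) (𝓝 0) (𝓝 0) := by
      have : Continuous (fun η : ℂ => om * η) := by fun_prop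
      simpa using this.tendsto 0
    exact this.eventually hWN
  have hev2 : ∀ᶠ η in 𝓝[≠] (0:ℂ), η ∈ w '' N ∧ om * η ∈ w '' N ∧ η ≠ 0 := by
    filter_upwards [nhdsWithin_le_nhds hev, nhdsWithin_le_nhds hWN, self_mem_nhdsWithin]
      with η h1 h2 h3 using ⟨h2, h1, h3⟩
  obtain ⟨η, ⟨z1, hz1, hw1⟩, ⟨z2, hz2, hw2⟩, hη⟩ := hev2.exists
  have hval : ∀ z ∈ N, f z - f z₀ = w z ^ k := by
    intro z hz
    rw [hz.2]; simp [w, mul_pow, hqk]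
  have hEq : f z1 = f z2 := by
    have h1 := hval z1 hz1
    have h2 := hval z2 hz2
    rw [hw1] at h1
    rw [hw2, mul_pow, homk, one_mul, ← h1] at h2
    linear_combination -h2
  have hz := hinj hz1.1 hz2.1 hEq
  rw [hz, hw2] at hw1
  have : (om - 1) * η = 0 := by linear_combination hw1
  rcases mul_eq_zero.1 this with h | h
  · exact hom1 (sub_eq_zero.1 h)
  · exact hη h

end

section
open Metric Filter Set MeasureTheory
open scoped Topology

/-- The Jacobian determinant of a holomorphic map is holomorphic. -/
theorem holo_det_differentiableOn {E F : Type} [NormedAddCommGroup E] [NormedSpace ℂ E]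
    [FiniteDimensional ℂ E] [NormedAddCommGroup F] [NormedSpace ℂ F] [FiniteDimensional ℂ F]
    {U : Set E} (hU : IsOpen U) {f : E → F} (hf : DifferentiableOn ℂ f U) (e : F ≃L[ℂ] E) :
    DifferentiableOn ℂ
      (fun x => LinearMap.det ((e : F →ₗ[ℂ] E) ∘ₗ (fderiv ℂ f x : E →ₗ[ℂ] F))) U := by
  let b := Module.finBasis ℂ E
  have h1 : ∀ x, LinearMap.det ((e : F →ₗ[ℂ] E) ∘ₗ (fderiv ℂ f x : E →ₗ[ℂ] F)) =
      ∑ σ : Equiv.Perm (Fin (Module.finrank ℂ E)), ((Equiv.Perm.sign σ : ℤ) : ℂ) *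
        ∏ i, b.coord (σ i) (e (fderiv ℂ f x (b i))) := by
    intro x
    rw [← LinearMap.det_toMatrix b, Matrix.det_apply']
    simp [LinearMap.toMatrix_apply]
  simp only [h1]
  refine DifferentiableOn.fun_sum fun σ _ => (DifferentiableOn.const_mul ?_ _)
  classical
  suffices hs : ∀ i, DifferentiableOn ℂ (fun x => b.coord (σ i) (e (fderiv ℂ f x (b i)))) U by
    intro x hx
    have := HasFDerivWithinAt.finsetProd (u := Finset.univ)
      (g := fun i x => b.coord (σ i) (e (fderiv ℂ f x (b i)))) (s := U) (x := x)
      (fun i _ => (hs i x hx).hasFDerivWithinAt)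
    exact this.differentiableWithinAt
  intro i
  have h2 := holo_differentiableOn_fderiv_apply hU hf (b i)
  have h3 : Differentiable ℂ (fun y : F => b.coord (σ i) (e y)) :=
    (LinearMap.toContinuousLinearMap (b.coord (σ i))).differentiable.comp e.differentiable
  exact h3.comp_differentiableOn h2

/-- Step one of the induction: rank at least one. -/
theorem osgood_step {E F : Type} [NormedAddCommGroup E] [NormedSpace ℂ E]
    [FiniteDimensional ℂ E] [NormedAddCommGroup F] [NormedSpace ℂ F] [FiniteDimensional ℂ F]
    (n : ℕ) (hE : Module.finrank ℂ E = n + 1) (hF : Module.finrank ℂ F = n + 1)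
    (ih : ∀ (E F : Type) [NormedAddCommGroup E] [NormedSpace ℂ E]
      [FiniteDimensional ℂ E] [NormedAddCommGroup F] [NormedSpace ℂ F] [FiniteDimensional ℂ F],
      Module.finrank ℂ E = n → Module.finrank ℂ F = n → ∀ (U : Set E) (f : E → F), IsOpen U →
      DifferentiableOn ℂ f U → InjOn f U → ∀ p ∈ U, Function.Injective (fderiv ℂ f p))
    {U : Set E} {f : E → F} (hU : IsOpen U) (hf : DifferentiableOn ℂ f U) (hinj : InjOn f U)
    {p : E} (hp : p ∈ U) (hne : fderiv ℂ f p ≠ 0) : Function.Injective (fderiv ℂ f p) := by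
  obtain ⟨v, hv⟩ : ∃ v, fderiv ℂ f p v ≠ 0 := by
    by_contra h
    push Not at h
    exact hne (by ext x; simp [h x])
  set w := fderiv ℂ f p v with hw
  obtain ⟨l, hl⟩ := SeparatingDual.exists_eq_one (R := ℂ) hv
  have hfp : HasFDerivAt f (fderiv ℂ f p) p :=
    ((hf p hp).differentiableAt (hU.mem_nhds hp)).hasFDerivAt
  let g : E → ℂ := fun x => l (f x)
  have hg : DifferentiableOn ℂ g U := l.differentiable.comp_differentiableOn hf
  have hgp : fderiv ℂ g p = l.comp (fderiv ℂ f p) := (l.hasFDerivAt.comp p hfp).fderiv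
  have hgv : fderiv ℂ g p v = 1 := by rw [hgp]; simpa using hl
  obtain ⟨Ψ, V, hVo, hpV, hΨd, hΨp, hΨ1, hΨU, hΨinj, hΨg⟩ := holo_straighten hU hg hp hgv
  set la := fderiv ℂ g p with hla
  let K : Submodule ℂ E := LinearMap.ker (la : E →ₗ[ℂ] ℂ)
  let M : Submodule ℂ F := LinearMap.ker (l : F →ₗ[ℂ] ℂ)
  have hKr : Module.finrank ℂ K = n := by
    have h1 := LinearMap.finrank_range_add_finrank_ker (la : E →ₗ[ℂ] ℂ)
    have h2 : LinearMap.range (la : E →ₗ[ℂ] ℂ) = ⊤ := by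
      rw [LinearMap.range_eq_top]
      intro c; exact ⟨c • v, by simp [hgv]⟩
    rw [h2, finrank_top, Module.finrank_self, hE] at h1
    change Module.finrank ℂ (LinearMap.ker (la : E →ₗ[ℂ] ℂ)) = n
    omega
  have hMr : Module.finrank ℂ M = n := by
    have h1 := LinearMap.finrank_range_add_finrank_ker (l : F →ₗ[ℂ] ℂ)
    have h2 : LinearMap.range (l : F →ₗ[ℂ] ℂ) = ⊤ := by
      rw [LinearMap.range_eq_top]
      intro c; exact ⟨c • w, by simp [hl]⟩
    rw [h2, finrank_top, Module.finrank_self, hF] at h1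
    change Module.finrank ℂ (LinearMap.ker (l : F →ₗ[ℂ] ℂ)) = n
    omega
  let π : F →L[ℂ] M := (ContinuousLinearMap.id ℂ F - l.smulRight w).codRestrict M (by
    intro x
    simp [M, hl])
  have hπ : ∀ y, l y = 0 → (π y : F) = y := by
    intro y hy
    simp [π, hy]
  let ft : K → M := fun x => π (f (Ψ (p + x)) - f p)
  let W : Set K := {x | p + (x : E) ∈ V}
  have hcont : Continuous (fun x : K => p + (x : E)) := by fun_prop
  have hWo : IsOpen W := hVo.preimage hcont
  have h0W : (0 : K) ∈ W := by simpa [W] using hpV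
  have hdi : Differentiable ℂ (fun x : K => p + (x : E)) :=
    (differentiable_const p).add K.subtypeL.differentiable
  have hftd : DifferentiableOn ℂ ft W := by
    refine π.differentiable.comp_differentiableOn (DifferentiableOn.sub_const ?_ _)
    exact hf.comp (hΨd.comp hdi.differentiableOn (fun x hx => hx)) (fun x hx => hΨU hx)
  have hlz : ∀ x ∈ W, l (f (Ψ (p + (x:E))) - f p) = 0 := by
    intro x hx
    have h1 := hΨg _ hx
    have h2 : la (x : E) = 0 := x.2
    simp only [g, add_sub_cancel_left, h2, add_zero] at h1
    rw [map_sub, h1, sub_self]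
  have hftinj : InjOn ft W := by
    intro x hx y hy hxy
    have h1 := congrArg (Subtype.val) hxy
    simp only [ft] at h1
    rw [hπ _ (hlz x hx), hπ _ (hlz y hy)] at h1
    have h2 := hinj (hΨU hx) (hΨU hy) (sub_left_inj.1 h1)
    have h3 := hΨinj hx hy h2
    exact Subtype.ext (add_left_cancel h3)
  have key := ih K M hKr hMr W ft hWo hftd hftinj 0 h0W
  have hder : HasFDerivAt ft (π.comp ((fderiv ℂ f p).comp
      ((ContinuousLinearMap.id ℂ E).comp K.subtypeL))) 0 := by
    have h1 : HasFDerivAt (fun x : K => p + (x : E)) K.subtypeL 0 :=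
      K.subtypeL.hasFDerivAt.const_add p
    have h2 : HasFDerivAt Ψ (ContinuousLinearMap.id ℂ E) (p + ((0:K):E)) := by simpa using hΨ1
    have h3 : HasFDerivAt f (fderiv ℂ f p) (Ψ (p + ((0:K):E))) := by simpa [hΨp] using hfp
    have h4 := (h3.comp (0:K) (h2.comp (0:K) h1)).sub_const (f p)
    exact π.hasFDerivAt.comp (0:K) h4
  rw [hder.fderiv] at key
  rw [injective_iff_map_eq_zero]
  intro u hu
  have huK : u ∈ K := by
    change la u = 0
    rw [hgp]; simp [hu]
  have := (injective_iff_map_eq_zero _).1 key ⟨u, huK⟩ (by simp [hu])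
  exact congrArg Subtype.val this

end

section
open Metric Filter Set MeasureTheory
open scoped Topology

/-- A holomorphic function vanishing at a point but not identically has, somewhere on its zero set,
a holomorphic function vanishing on the zero set with non-zero differential. -/
theorem holo_regular_point {E : Type} [NormedAddCommGroup E] [NormedSpace ℂ E]
    [FiniteDimensional ℂ E] {U : Set E} (hU : IsOpen U) {J : E → ℂ} (hJ : DifferentiableOn ℂ J U)
    {p w : E} {δ : ℝ} (hδ : 0 < δ) (hB : ball p δ ⊆ U) (hw : p + w ∈ ball p δ) (hJp : J p = 0)
    (hJw : J (p + w) ≠ 0) :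
    ∃ g : E → ℂ, DifferentiableOn ℂ g U ∧ (∀ x ∈ U, J x = 0 → g x = 0) ∧
      ∃ q ∈ U, J q = 0 ∧ ∃ v, fderiv ℂ g q v = 1 := by
  let G : ℕ → E → ℂ := fun j => Nat.rec J (fun _ g x => fderiv ℂ g x w) j
  have hG0 : G 0 = J := rfl
  have hGs : ∀ j, G (j+1) = fun x => fderiv ℂ (G j) x w := fun j => rfl
  have hGd : ∀ j, DifferentiableOn ℂ (G j) U := by
    intro j
    induction j with
    | zero => exact hJ
    | succ j ihj => rw [hGs]; exact holo_differentiableOn_fderiv_apply hU ihj w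
  let Ω : Set ℂ := {ζ | p + ζ • w ∈ ball p δ}
  have hΩo : IsOpen Ω := isOpen_ball.preimage (by fun_prop)
  have hΩc : Convex ℝ Ω := by
    intro a ha b hb s t hs ht hst
    simp only [Ω, mem_ofPred_eq, mem_ball, dist_eq_norm, add_sub_cancel_left] at ha hb ⊢
    have : (s • a + t • b) • w = (s:ℂ) • (a • w) + (t:ℂ) • (b • w) := by
      simp [add_smul, mul_smul]
    rw [this]
    calc ‖(s:ℂ) • (a • w) + (t:ℂ) • (b • w)‖ ≤ s * ‖a • w‖ + t * ‖b • w‖ := by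
          refine (norm_add_le _ _).trans ?_
          rw [norm_smul (s:ℂ), norm_smul (t:ℂ)]
          simp [abs_of_nonneg hs, abs_of_nonneg ht]
      _ < δ := by
          rcases hs.eq_or_lt with h | h
          · subst h; simp at hst; subst hst; simpa using hb
          · nlinarith
  have h0Ω : (0:ℂ) ∈ Ω := by simp [Ω, hδ]
  have h1Ω : (1:ℂ) ∈ Ω := by simpa [Ω] using hw
  let h : ℂ → ℂ := fun ζ => J (p + ζ • w)
  have hder : ∀ j, ∀ ζ ∈ Ω, HasDerivAt (fun ζ : ℂ => G j (p + ζ • w)) (G (j+1) (p + ζ • w)) ζ := by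
    intro j ζ hζ
    have h1 : HasFDerivAt (G j) (fderiv ℂ (G j) (p + ζ • w)) (p + ζ • w) :=
      ((hGd j _ (hB hζ)).differentiableAt (hU.mem_nhds (hB hζ))).hasFDerivAt
    have h2 : HasDerivAt (fun ζ : ℂ => p + ζ • w) w ζ := by
      simpa using ((hasDerivAt_id ζ).smul_const w).const_add p
    exact h1.comp_hasDerivAt ζ h2
  have hit : ∀ j, ∀ ζ ∈ Ω, iteratedDeriv j h ζ = G j (p + ζ • w) := by
    intro j
    induction j with
    | zero => intro ζ _; simp [h, hG0]
    | succ j ihj =>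
      intro ζ hζ
      rw [iteratedDeriv_succ]
      have : iteratedDeriv j h =ᶠ[𝓝 ζ] fun ζ => G j (p + ζ • w) := by
        filter_upwards [hΩo.mem_nhds hζ] with y hy using ihj y hy
      rw [this.deriv_eq]
      exact (hder j ζ hζ).deriv
  have han : AnalyticOnNhd ℂ h Ω :=
    DifferentiableOn.analyticOnNhd
      (fun ζ hζ => (hder 0 ζ hζ).differentiableAt.differentiableWithinAt) hΩo
  have hex : ∃ j, ∃ q ∈ U, J q = 0 ∧ G j q ≠ 0 := by
    by_contra hcon
    push Not at hcon
    have hp : p ∈ U := hB (mem_ball_self hδ)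
    have htop : analyticOrderAt h 0 = ⊤ := by
      rw [ENat.eq_top_iff_forall_ge]
      intro m
      rw [natCast_le_analyticOrderAt_iff_iteratedDeriv_eq_zero (han 0 h0Ω)]
      intro i _
      rw [hit i 0 h0Ω]
      simpa using hcon i p hp hJp
    have hev := analyticOrderAt_eq_top.1 htop
    have := han.eqOn_zero_of_preconnected_of_eventuallyEq_zero hΩc.isPreconnected h0Ω hev h1Ω
    exact hJw (by simpa [h] using this)
  obtain ⟨j, ⟨q, hqU, hJq, hGq⟩, hmin⟩ : ∃ j, (∃ q ∈ U, J q = 0 ∧ G j q ≠ 0) ∧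
      ∀ m < j, ¬ ∃ q ∈ U, J q = 0 ∧ G m q ≠ 0 := by
    obtain ⟨j, hj⟩ := hex
    induction j using Nat.strong_induction_on with
    | _ j ihj =>
      by_cases hc : ∃ m < j, ∃ q ∈ U, J q = 0 ∧ G m q ≠ 0
      · obtain ⟨m, hm, hmq⟩ := hc
        exact ihj m hm hmq
      · push Not at hc
        refine ⟨j, hj, ?_⟩
        rintro m hm ⟨q, h1, h2, h3⟩
        exact h3 (hc m hm q h1 h2)
  obtain _ | i := j
  · exact absurd hJq hGq
  · refine ⟨G i, hGd i, ?_, q, hqU, hJq, (G (i+1) q)⁻¹ • w, ?_⟩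
    · intro x hx hJx
      by_contra hne
      exact hmin i (Nat.lt_succ_self i) ⟨x, hx, hJx, hne⟩
    · rw [map_smul, smul_eq_mul]
      exact inv_mul_cancel₀ hGq

/-- If the zero set of `J` lies in a hyperplane through a zero, it contains the hyperplane
locally. -/
theorem holo_zero_hyperplane {E : Type} [NormedAddCommGroup E] [NormedSpace ℂ E]
    [FiniteDimensional ℂ E] {V : Set E} (hV : IsOpen V) {J : E → ℂ} (hJ : DifferentiableOn ℂ J V)
    {q v : E} (hq : q ∈ V) (hJq : J q = 0) (l : E →L[ℂ] ℂ) (hv : l v = 1)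
    (hz : ∀ y ∈ V, J y = 0 → l (y - q) = 0) :
    ∀ᶠ x in 𝓝 (0 : E), l x = 0 → J (q + x) = 0 := by
  have hv0 : 0 < ‖v‖ := norm_pos_iff.2 (by rintro rfl; simp at hv)
  obtain ⟨R, hR, hRV⟩ := Metric.isOpen_iff.1 hV q hq
  set d : ℝ := R / 4 / ‖v‖ with hd
  have hd0 : 0 < d := by positivity
  have hdv : d * ‖v‖ = R / 4 := by rw [hd]; field_simp
  have hin : ∀ x : E, ‖x‖ < R / 4 → ∀ ζ ∈ closedBall (0:ℂ) d, q + x + ζ • v ∈ V := by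
    intro x hx ζ hζ
    apply hRV
    rw [mem_ball, dist_eq_norm]
    have hζ' : ‖ζ‖ ≤ d := by simpa using hζ
    have : q + x + ζ • v - q = x + ζ • v := by abel
    rw [this]
    calc _ ≤ ‖x‖ + ‖ζ‖ * ‖v‖ := by simpa [norm_smul] using norm_add_le x (ζ • v)
      _ < R := by nlinarith
  have hcc : ContinuousOn J V := hJ.continuousOn
  have hS : IsCompact (sphere (0:ℂ) d) := isCompact_sphere _ _
  have hSne : (sphere (0:ℂ) d).Nonempty := ⟨(d:ℂ), by simp [abs_of_pos hd0]⟩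
  have h00 : ‖(0:E)‖ < R/4 := by simp; positivity
  have hcS : ContinuousOn (fun ζ : ℂ => ‖J (q + ζ • v)‖) (sphere (0:ℂ) d) := by
    refine (hcc.comp (by fun_prop) ?_).norm
    intro ζ hζ
    simpa using hin 0 h00 ζ (sphere_subset_closedBall hζ)
  obtain ⟨ζ₀, hζ₀, hmin⟩ := hS.exists_isMinOn hSne hcS
  set c := ‖J (q + ζ₀ • v)‖ with hc
  have hc0 : 0 < c := by
    rw [hc, norm_pos_iff]
    intro h0
    have h1 := hz _ (by simpa using hin 0 h00 ζ₀ (sphere_subset_closedBall hζ₀)) h0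
    simp [hv] at h1
    rw [h1] at hζ₀
    simp at hζ₀
    exact hd0.ne hζ₀
  -- uniform continuity
  have hev1 : ∀ᶠ x in 𝓝 (0:E), ∀ ζ ∈ sphere (0:ℂ) d, c / 2 < ‖J (q + x + ζ • v)‖ := by
    refine hS.eventually_forall_of_forall_eventually (x₀ := (0:E))
      (P := fun x ζ => c / 2 < ‖J (q + x + ζ • v)‖) ?_
    intro ζ hζ
    have hmem : q + (0:E) + ζ • v ∈ V := hin 0 h00 ζ (sphere_subset_closedBall hζ)
    have hcat : ContinuousAt (fun z : E × ℂ => ‖J (q + z.1 + z.2 • v)‖) (0, ζ) := by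
      refine ContinuousAt.norm ?_
      exact ContinuousAt.comp (f := fun z : E × ℂ => q + z.1 + z.2 • v)
        (x := ((0:E), ζ)) (hcc.continuousAt (hV.mem_nhds hmem)) (by fun_prop)
    refine hcat.eventually (lt_mem_nhds ?_)
    have : c ≤ ‖J (q + ζ • v)‖ := hmin hζ
    simp only [add_zero]
    linarith
  have hev2 : ∀ᶠ x in 𝓝 (0:E), ‖J (q + x)‖ < c / 2 := by
    have hcat : ContinuousAt (fun x : E => ‖J (q + x)‖) 0 := by
      refine ContinuousAt.norm ?_
      exact ContinuousAt.comp (f := fun x : E => q + x)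
        (x := (0:E)) (hcc.continuousAt (hV.mem_nhds (by simpa using hq))) (by fun_prop)
    refine hcat.eventually (gt_mem_nhds ?_)
    simp [hJq, hc0]
  filter_upwards [hev1, hev2, Metric.ball_mem_nhds (0:E) (by positivity : 0 < R/4)] with x h1 h2 h3 hx
  by_contra hne
  have h3' : ‖x‖ < R/4 := by simpa using h3
  have hnz : ∀ ζ ∈ closedBall (0:ℂ) d, J (q + x + ζ • v) ≠ 0 := by
    intro ζ hζ h0
    have h5 := hz _ (hin x h3' ζ hζ) h0
    have : q + x + ζ • v - q = x + ζ • v := by abel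
    rw [this, map_add, hx, map_smul, hv] at h5
    simp at h5
    rw [h5] at h0
    simp at h0
    exact hne h0
  have hdc : DiffContOnCl ℂ (fun ζ : ℂ => (J (q + x + ζ • v))⁻¹) (ball 0 d) := by
    have hdd : DifferentiableOn ℂ (fun ζ : ℂ => (J (q + x + ζ • v))⁻¹) (closedBall 0 d) := by
      refine DifferentiableOn.inv ?_ hnz
      exact hJ.comp (by fun_prop) (fun ζ hζ => hin x h3' ζ hζ)
    refine DifferentiableOn.diffContOnCl ?_
    rw [closure_ball _ hd0.ne']
    exact hdd
  have hmax := Complex.norm_le_of_forall_mem_frontier_norm_le (U := ball (0:ℂ) d) isBounded_ball hdc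
    (C := (c/2)⁻¹) (by
      intro ζ hζ
      rw [frontier_ball _ hd0.ne'] at hζ
      rw [norm_inv]
      exact inv_anti₀ (by positivity) (h1 ζ hζ).le) (z := 0) (subset_closure (mem_ball_self hd0))
  simp only [zero_smul, add_zero, norm_inv] at hmax
  have := (inv_le_inv₀ (norm_pos_iff.2 hne) (by positivity)).1 hmax
  linarith

end

section
open Metric Filter Set MeasureTheory
open scoped Topology

/-- Dimension at least two: impossibility of vanishing differential at degenerate points. -/
theorem osgood_big {E F : Type} [NormedAddCommGroup E] [NormedSpace ℂ E]
    [FiniteDimensional ℂ E] [NormedAddCommGroup F] [NormedSpace ℂ F] [FiniteDimensional ℂ F]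
    (n : ℕ) (hE : Module.finrank ℂ E = n + 2) (hF : Module.finrank ℂ F = n + 2)
    {U : Set E} {f : E → F} (hU : IsOpen U) (hf : DifferentiableOn ℂ f U) (hinj : InjOn f U)
    (hdeg : ∀ p ∈ U, ¬ Function.Injective (fderiv ℂ f p) → fderiv ℂ f p = 0) :
    ∀ p ∈ U, Function.Injective (fderiv ℂ f p) := by
  intro p hp
  by_contra hninj
  let e : F ≃L[ℂ] E := ContinuousLinearEquiv.ofFinrankEq (hF.trans hE.symm)
  let J : E → ℂ := fun x => LinearMap.det ((e : F →ₗ[ℂ] E) ∘ₗ (fderiv ℂ f x : E →ₗ[ℂ] F))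
  have hJ : DifferentiableOn ℂ J U := holo_det_differentiableOn hU hf e
  have hJ0 : ∀ x ∈ U, J x = 0 → fderiv ℂ f x = 0 := by
    intro x hx h0
    apply hdeg x hx
    intro hi
    have h1 : LinearMap.ker ((e : F →ₗ[ℂ] E) ∘ₗ (fderiv ℂ f x : E →ₗ[ℂ] F)) = ⊥ := by
      rw [LinearMap.ker_eq_bot]
      exact e.injective.comp hi
    have h2 := LinearMap.bot_lt_ker_of_det_eq_zero h0
    rw [h1] at h2
    exact lt_irrefl _ h2
  have hJ0' : ∀ x, fderiv ℂ f x = 0 → J x = 0 := by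
    intro x hx
    simp only [J, hx]
    have : (((0 : E →L[ℂ] F)) : E →ₗ[ℂ] F) = 0 := rfl
    rw [this, LinearMap.comp_zero, LinearMap.det_zero, hE]
    simp
  have hJp : J p = 0 := hJ0' p (hdeg p hp hninj)
  obtain ⟨δ, hδ, hB⟩ := Metric.isOpen_iff.1 hU p hp
  have : Nontrivial E := Module.nontrivial_of_finrank_pos (R := ℂ) (by omega)
  -- J is not identically zero
  have hw : ∃ w, p + w ∈ ball p δ ∧ J (p + w) ≠ 0 := by
    by_contra hcon
    push Not at hcon
    obtain ⟨u, hu⟩ := exists_ne (0:E)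
    have hupos : 0 < ‖u‖ := norm_pos_iff.2 hu
    have hz : ∀ x ∈ ball p δ, fderiv ℂ f x = 0 := by
      intro x hx
      apply hJ0 x (hB hx)
      have := hcon (x - p) (by simpa using hx)
      simpa using this
    have hx : p + ((δ / 2 / ‖u‖ : ℝ) : ℂ) • u ∈ ball p δ := by
      rw [mem_ball, dist_eq_norm, add_sub_cancel_left, norm_smul, Complex.norm_real,
        Real.norm_of_nonneg (by positivity)]
      rw [div_mul_cancel₀ _ hupos.ne']; linarith
    have hceq := (convex_ball p δ).is_const_of_fderivWithin_eq_zero (𝕜 := ℂ) (hf.mono hB)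
      (fun x hx => by rw [fderivWithin_of_isOpen isOpen_ball hx]; exact hz x hx)
      (mem_ball_self hδ) hx
    have := hinj hp (hB hx) hceq
    have h2 : ((δ / 2 / ‖u‖ : ℝ) : ℂ) • u = 0 := by
      have h3 : p + ((δ / 2 / ‖u‖ : ℝ) : ℂ) • u = p + 0 := by rw [← this, add_zero]
      exact add_left_cancel h3
    rw [smul_eq_zero] at h2
    rcases h2 with h2 | h2
    · have : (δ / 2 / ‖u‖ : ℝ) = 0 := by exact_mod_cast h2
      have h4 : 0 < (δ / 2 / ‖u‖ : ℝ) := by positivity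
      linarith
    · exact hu h2
  obtain ⟨w, hwB, hJw⟩ := hw
  obtain ⟨g, hgd, hgz, q, hqU, hJq, v, hv⟩ := holo_regular_point hU hJ hδ hB hwB hJp hJw
  obtain ⟨Ψ, V, hVo, hqV, hΨd, hΨq, -, hΨU, hΨinj, hΨg⟩ := holo_straighten hU hgd hqU hv
  set la := fderiv ℂ g q with hla
  have hgq : g q = 0 := hgz q hqU hJq
  have hev := holo_zero_hyperplane hVo (J := fun y => J (Ψ y)) (hJ.comp hΨd hΨU) hqV
    (by simpa [hΨq] using hJq) la hv (by
      intro y hy h0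
      have h1 := hΨg y hy
      rw [hgz _ (hΨU hy) h0, hgq, zero_add] at h1
      exact h1.symm)
  have hevV : ∀ᶠ x in 𝓝 (0:E), q + x ∈ V := by
    have : ContinuousAt (fun x : E => q + x) 0 := by fun_prop
    exact this.eventually (hVo.mem_nhds (by simpa using hqV))
  obtain ⟨ρ, hρ, hρB⟩ := Metric.eventually_nhds_iff_ball.1 (hev.and hevV)
  -- a nonzero vector in the kernel
  have hker : ∃ u, u ≠ 0 ∧ la u = 0 := by
    have h1 := LinearMap.finrank_range_add_finrank_ker (la : E →ₗ[ℂ] ℂ)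
    have h2 : Module.finrank ℂ (LinearMap.range (la : E →ₗ[ℂ] ℂ)) ≤ 1 := by
      have := Submodule.finrank_le (LinearMap.range (la : E →ₗ[ℂ] ℂ))
      simpa using this
    have h3 : 0 < Module.finrank ℂ (LinearMap.ker (la : E →ₗ[ℂ] ℂ)) := by omega
    have := Module.nontrivial_of_finrank_pos h3
    obtain ⟨x, hx⟩ := exists_ne (0 : LinearMap.ker (la : E →ₗ[ℂ] ℂ))
    exact ⟨x, by simpa using hx, x.2⟩
  obtain ⟨u, hu, hlu⟩ := hker
  have hupos : 0 < ‖u‖ := norm_pos_iff.2 hu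
  set d : ℝ := ρ / 2 / ‖u‖ with hd
  have hd0 : 0 < d := by positivity
  have hdu : d * ‖u‖ = ρ / 2 := by rw [hd]; field_simp
  have hmem : ∀ ζ ∈ closedBall (0:ℂ) d, ζ • u ∈ ball (0:E) ρ := by
    intro ζ hζ
    have : ‖ζ‖ ≤ d := by simpa using hζ
    rw [mem_ball_zero_iff, norm_smul]
    nlinarith
  have hder : ∀ ζ ∈ closedBall (0:ℂ) d,
      HasDerivWithinAt (fun ζ : ℂ => f (Ψ (q + ζ • u))) 0 (closedBall (0:ℂ) d) ζ := by
    intro ζ hζ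
    obtain ⟨h1, h2⟩ := hρB _ (hmem ζ hζ)
    have h3 : fderiv ℂ f (Ψ (q + ζ • u)) = 0 := hJ0 _ (hΨU h2) (h1 (by simp [hlu]))
    have h4 : HasFDerivAt f (0 : E →L[ℂ] F) (Ψ (q + ζ • u)) := by
      have := ((hf _ (hΨU h2)).differentiableAt (hU.mem_nhds (hΨU h2))).hasFDerivAt
      rwa [h3] at this
    have h5 : HasFDerivAt Ψ (fderiv ℂ Ψ (q + ζ • u)) (q + ζ • u) :=
      ((hΨd _ h2).differentiableAt (hVo.mem_nhds h2)).hasFDerivAt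
    have h6 : HasDerivAt (fun ζ : ℂ => q + ζ • u) u ζ := by
      simpa using ((hasDerivAt_id ζ).smul_const u).const_add q
    have h7 := (h4.comp _ h5).comp_hasDerivAt ζ h6
    simpa [Function.comp_def] using h7.hasDerivWithinAt
  have hconst := (convex_closedBall (0:ℂ) d).norm_image_sub_le_of_norm_hasDerivWithin_le (C := 0)
    hder (fun _ _ => by simp) (mem_closedBall_self hd0.le)
    (y := (d:ℂ)) (by simp [abs_of_pos hd0])
  simp only [zero_mul, norm_le_zero_iff, sub_eq_zero] at hconst
  have hm1 := (hρB _ (hmem (d:ℂ) (by simp [abs_of_pos hd0]))).2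
  have hm0 := (hρB _ (hmem 0 (mem_closedBall_self hd0.le))).2
  have h8 := hΨinj hm1 hm0 (hinj (hΨU hm1) (hΨU hm0) hconst)
  have h9 := add_left_cancel h8
  simp [hu, hd0.ne'] at h9

/-- **Osgood's theorem**: an injective holomorphic map between equidimensional spaces has
invertible differential. -/
theorem osgood (n : ℕ) : ∀ (E F : Type) [NormedAddCommGroup E] [NormedSpace ℂ E]
      [FiniteDimensional ℂ E] [NormedAddCommGroup F] [NormedSpace ℂ F] [FiniteDimensional ℂ F],
      Module.finrank ℂ E = n → Module.finrank ℂ F = n → ∀ (U : Set E) (f : E → F), IsOpen U →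
      DifferentiableOn ℂ f U → InjOn f U → ∀ p ∈ U, Function.Injective (fderiv ℂ f p) := by
  induction n with
  | zero =>
    intro E F _ _ _ _ _ _ hE hF U f hU hf hinj p hp
    have : Subsingleton E := Module.finrank_zero_iff.1 hE
    exact Function.injective_of_subsingleton _
  | succ n ih =>
    intro E F _ _ _ _ _ _ hE hF U f hU hf hinj
    have hdeg : ∀ p ∈ U, ¬ Function.Injective (fderiv ℂ f p) → fderiv ℂ f p = 0 := by
      intro p hp hni
      by_contra hne
      exact hni (osgood_step n hE hF ih hU hf hinj hp hne)
    obtain _ | m := n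
    · intro p hp
      by_contra hni
      have h0 := hdeg p hp hni
      let a : ℂ ≃L[ℂ] E := ContinuousLinearEquiv.ofFinrankEq (by rw [hE]; simp)
      let b : F ≃L[ℂ] ℂ := ContinuousLinearEquiv.ofFinrankEq (by rw [hF]; simp)
      let h : ℂ → ℂ := fun ζ => b (f (a ζ))
      let s : Set ℂ := a ⁻¹' U
      have hso : IsOpen s := hU.preimage a.continuous
      have hps : a.symm p ∈ s := by simpa [s] using hp
      have hhd : DifferentiableOn ℂ h s :=
        b.differentiable.comp_differentiableOn
          (hf.comp a.differentiable.differentiableOn (fun x hx => hx))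
      have hhi : InjOn h s := by
        intro x hx y hy hxy
        exact a.injective (hinj hx hy (b.injective hxy))
      have := holo_deriv_ne_zero_of_injOn (hhd.analyticOnNhd hso _ hps) (hso.mem_nhds hps) hhi
      apply this
      have hfp : HasFDerivAt f (0 : E →L[ℂ] F) (a (a.symm p)) := by
        have := ((hf _ hp).differentiableAt (hU.mem_nhds hp)).hasFDerivAt
        rw [h0] at this
        simpa using this
      have h1 := (b.hasFDerivAt.comp _ (hfp.comp (a.symm p) a.hasFDerivAt)).hasDerivAt.deriv
      simpa [Function.comp_def] using h1
    · exact osgood_big m hE hF hU hf hinj hdeg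

end

section
open Metric Filter Set MeasureTheory
open scoped Topology

section
variable {E : Type} [NormedAddCommGroup E] [NormedSpace ℂ E] [FiniteDimensional ℂ E]

theorem univ_map_nhds {U : Set E} {f : E → E} (hU : IsOpen U) (hf : DifferentiableOn ℂ f U)
    (hinj : InjOn f U) {p : E} (hp : p ∈ U) :
    ∃ f' : E ≃L[ℂ] E, HasFDerivAt f (f' : E →L[ℂ] E) p ∧ map f (𝓝 p) = 𝓝 (f p) := by
  have h1 := osgood _ E E rfl rfl U f hU hf hinj p hp
  have hd : HasFDerivAt f (fderiv ℂ f p) p :=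
    ((hf p hp).differentiableAt (hU.mem_nhds hp)).hasFDerivAt
  let f' : E ≃L[ℂ] E := (LinearEquiv.ofInjectiveEndo _ h1).toContinuousLinearEquiv
  have hf' : (f' : E →L[ℂ] E) = fderiv ℂ f p := by
    ext x; rfl
  rw [← hf'] at hd
  have : CompleteSpace E := FiniteDimensional.complete ℂ E
  exact ⟨f', hd, ((holo_contDiffAt hU hf hp).hasStrictFDerivAt' hd (by simp)).map_nhds_eq_of_equiv⟩

theorem univ_isOpen_image {U V : Set E} {f : E → E} (hU : IsOpen U) (hf : DifferentiableOn ℂ f U)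
    (hinj : InjOn f U) (hV : IsOpen V) (hVU : V ⊆ U) : IsOpen (f '' V) := by
  rw [isOpen_iff_mem_nhds]
  rintro _ ⟨x, hx, rfl⟩
  obtain ⟨f', -, h⟩ := univ_map_nhds hU hf hinj (hVU hx)
  rw [← h]
  exact image_mem_map (hV.mem_nhds hx)

theorem univ_inv_hasFDerivAt {U : Set E} {f : E → E} (hU : IsOpen U) (hf : DifferentiableOn ℂ f U)
    (hinj : InjOn f U) {p : E} (hp : p ∈ U) :
    DifferentiableAt ℂ (Function.invFunOn f U) (f p) := by
  obtain ⟨f', hd, h⟩ := univ_map_nhds hU hf hinj hp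
  have hgp : Function.invFunOn f U (f p) = p := hinj.leftInvOn_invFunOn hp
  have hc : ContinuousAt (Function.invFunOn f U) (f p) := by
    rw [ContinuousAt, hgp]
    intro N hN
    rw [← h, mem_map, mem_map]
    filter_upwards [hN, hU.mem_nhds hp] with x hx hxU
    change Function.invFunOn f U (f x) ∈ N
    rw [hinj.leftInvOn_invFunOn hxU]; exact hx
  refine (HasFDerivAt.of_local_left_inverse hc (by rw [hgp]; exact hd) ?_).differentiableAt
  have : f '' U ∈ 𝓝 (f p) := (univ_isOpen_image hU hf hinj hU le_rfl).mem_nhds ⟨p, hp, rfl⟩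
  filter_upwards [this] with y hy
  exact Function.invFunOn_eq hy

theorem univ_inv_differentiableOn {U : Set E} {f : E → E} (hU : IsOpen U)
    (hf : DifferentiableOn ℂ f U) (hinj : InjOn f U) :
    DifferentiableOn ℂ (Function.invFunOn f U) (f '' U) := by
  rintro _ ⟨x, hx, rfl⟩
  exact (univ_inv_hasFDerivAt hU hf hinj hx).differentiableWithinAt
end

theorem ball_isOpen (n : ℕ) : IsOpen (Ball n) := isOpen_ball

theorem zero_mem_Ball (n : ℕ) : (0 : En n) ∈ Ball n := by simp [Ball]

theorem mem_Ball_iff {n : ℕ} {z : En n} : z ∈ Ball n ↔ ‖z‖ < 1 := by simp [Ball]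

/-- Basic properties of a self-map of the ball in the evolution family. -/
structure EvMap (n : ℕ) (φ : En n → En n) (a : ℝ) : Prop where
  maps : MapsTo φ (Ball n) (Ball n)
  diff : DifferentiableOn ℂ φ (Ball n)
  inj : InjOn φ (Ball n)
  zero : φ 0 = 0
  der : HasFDerivAt φ ((a : ℂ) • ContinuousLinearMap.id ℂ (En n)) 0

theorem EvMap.norm_le {n : ℕ} {φ : En n → En n} {a : ℝ} (h : EvMap n φ a) {z : En n}
    (hz : z ∈ Ball n) : ‖φ z‖ ≤ ‖z‖ :=
  Complex.norm_le_norm_of_mapsTo_ball (R := 1) h.diff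
    (fun x hx => ball_subset_closedBall (h.maps hx)) h.zero (mem_Ball_iff.1 hz)

section

theorem ev_spec {n : ℕ} {F : ℝ → En n → En n} (hF : IsNormalizedLoewnerChain n F)
    {s t : ℝ} (hs : 0 ≤ s) (hst : s ≤ t) {z : En n} (hz : z ∈ Ball n) :
    evolution n F s t z ∈ Ball n ∧ F t (evolution n F s t z) = F s z := by
  have h : F s z ∈ F t '' Ball n := hF.1.2.1 s t hs hst ⟨z, hz, rfl⟩
  exact ⟨Function.invFunOn_mem h, Function.invFunOn_eq h⟩

theorem chain_hasFDerivAt {n : ℕ} {F : ℝ → En n → En n} (hF : IsNormalizedLoewnerChain n F)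
    {t : ℝ} (ht : 0 ≤ t) :
    HasFDerivAt (F t) ((Real.exp t : ℂ) • ContinuousLinearMap.id ℂ (En n)) 0 := by
  rw [← (hF.2 t ht).2]
  exact (((hF.1.1 t ht).1 0 (zero_mem_Ball n)).differentiableAt
    ((ball_isOpen n).mem_nhds (zero_mem_Ball n))).hasFDerivAt

theorem ev_map {n : ℕ} {F : ℝ → En n → En n} (hF : IsNormalizedLoewnerChain n F)
    {s t : ℝ} (hs : 0 ≤ s) (hst : s ≤ t) :
    EvMap n (evolution n F s t) (Real.exp (s - t)) := by
  have ht := hs.trans hst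
  have hdiff : DifferentiableOn ℂ (evolution n F s t) (Ball n) :=
    (univ_inv_differentiableOn (ball_isOpen n) (hF.1.1 t ht).1 (hF.1.1 t ht).2).comp
      (hF.1.1 s hs).1 (fun z hz => hF.1.2.1 s t hs hst ⟨z, hz, rfl⟩)
  have hzero : evolution n F s t 0 = 0 := by
    obtain ⟨h1, h2⟩ := ev_spec hF hs hst (zero_mem_Ball n)
    exact (hF.1.1 t ht).2 h1 (zero_mem_Ball n) (by rw [h2, (hF.2 s hs).1, (hF.2 t ht).1])
  refine ⟨fun z hz => (ev_spec hF hs hst hz).1, hdiff, ?_, hzero, ?_⟩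
  · intro x hx y hy hxy
    have h1 := (ev_spec hF hs hst hx).2
    have h2 := (ev_spec hF hs hst hy).2
    rw [hxy, h2] at h1
    exact (hF.1.1 s hs).2 hx hy h1.symm
  · have hd : HasFDerivAt (evolution n F s t) (fderiv ℂ (evolution n F s t) 0) 0 :=
      ((hdiff 0 (zero_mem_Ball n)).differentiableAt
        ((ball_isOpen n).mem_nhds (zero_mem_Ball n))).hasFDerivAt
    have h1 : HasFDerivAt (F t) ((Real.exp t : ℂ) • ContinuousLinearMap.id ℂ (En n))
        (evolution n F s t 0) := by rw [hzero]; exact chain_hasFDerivAt hF ht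
    have h2 := h1.comp 0 hd
    have h3 : (F t ∘ evolution n F s t) =ᶠ[𝓝 0] F s := by
      filter_upwards [(ball_isOpen n).mem_nhds (zero_mem_Ball n)] with z hz
      exact (ev_spec hF hs hst hz).2
    have h4 := (h2.congr_of_eventuallyEq h3.symm).unique (chain_hasFDerivAt hF hs)
    have h5 : fderiv ℂ (evolution n F s t) 0 =
        (Real.exp (s - t) : ℂ) • ContinuousLinearMap.id ℂ (En n) := by
      ext1 v
      have h6 := DFunLike.congr_fun h4 v
      simp only [ContinuousLinearMap.comp_apply, _root_.smul_apply,
        ContinuousLinearMap.id_apply] at h6 ⊢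
      have hne : (Real.exp t : ℂ) ≠ 0 := by
        exact_mod_cast (Real.exp_pos t).ne'
      apply smul_right_injective _ hne
      simp only
      rw [h6, smul_smul]
      congr 1
      rw [← Complex.ofReal_mul, ← Real.exp_add]; ring_nf
    rw [← h5]; exact hd

theorem ev_comp {n : ℕ} {F : ℝ → En n → En n} (hF : IsNormalizedLoewnerChain n F)
    {s r t : ℝ} (hs : 0 ≤ s) (hsr : s ≤ r) (hrt : r ≤ t) {z : En n} (hz : z ∈ Ball n) :
    evolution n F r t (evolution n F s r z) = evolution n F s t z := by
  obtain ⟨h1, h2⟩ := ev_spec hF hs hsr hz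
  obtain ⟨h3, h4⟩ := ev_spec hF (hs.trans hsr) hrt h1
  obtain ⟨h5, h6⟩ := ev_spec hF hs (hsr.trans hrt) hz
  apply (hF.1.1 t (hs.trans (hsr.trans hrt))).2 h3 h5
  rw [h4, h2, h6]

theorem ev_self {n : ℕ} {F : ℝ → En n → En n} (hF : IsNormalizedLoewnerChain n F)
    {t : ℝ} (ht : 0 ≤ t) {z : En n} (hz : z ∈ Ball n) : evolution n F t t z = z :=
  (hF.1.1 t ht).2.leftInvOn_invFunOn hz

end

end

section
open Metric Filter Set MeasureTheory
open scoped Topology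

theorem shift_integral (c : ℝ → ℝ) (t a b : ℝ) :
    ∫ τ in Icc a b, c (t + τ) = ∫ τ in Icc (t + a) (t + b), c τ := by
  have h := (measurePreserving_add_left volume t).setIntegral_preimage_emb
    (measurableEmbedding_addLeft t) c (Icc (t + a) (t + b))
  rw [preimage_const_add_Icc] at h
  simpa using h

theorem shift_integrableOn {c : ℝ → ℝ} (t a b : ℝ) (hc : IntegrableOn c (Icc (t + a) (t + b))) :
    IntegrableOn (fun τ => c (t + τ)) (Icc a b) := by
  have h := ((measurePreserving_add_left volume t).integrableOn_comp_preimage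
    (measurableEmbedding_addLeft t)).2 hc
  rw [preimage_const_add_Icc] at h
  simpa [Function.comp_def] using h

theorem holo_lipschitz_compact {E : Type} [NormedAddCommGroup E] [NormedSpace ℂ E]
    [FiniteDimensional ℂ E] {W S : Set E} {q : E → E} (hW : IsOpen W)
    (hq : DifferentiableOn ℂ q W) (hS : IsCompact S) (hSW : S ⊆ W) :
    ∃ C : ℝ, 0 ≤ C ∧ ∀ x ∈ S, ∀ y ∈ S, ‖q x - q y‖ ≤ C * ‖x - y‖ := by
  have h1 : LocallyLipschitzOn S q := by
    intro x hx
    obtain ⟨K, t, ht, hK⟩ := ((holo_contDiffAt hW hq (hSW hx)).of_le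
      (m := 1) (by exact_mod_cast le_top)).exists_lipschitzOnWith
    exact ⟨K, t, mem_nhdsWithin_of_mem_nhds ht, hK⟩
  obtain ⟨K, hK⟩ := h1.exists_lipschitzOnWith_of_compact hS
  refine ⟨K, K.2, fun x hx y hy => ?_⟩
  have := hK.dist_le_mul x hx y hy
  simpa [dist_eq_norm] using this

theorem exists_radius {n : ℕ} {K : Set (En n)} (hK : IsCompact K) (hKB : K ⊆ Ball n) :
    ∃ r : ℝ, 0 < r ∧ r < 1 ∧ K ⊆ closedBall 0 r := by
  rcases K.eq_empty_or_nonempty with h | h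
  · exact ⟨1/2, by norm_num, by norm_num, by simp [h]⟩
  · obtain ⟨z, hz, hmax⟩ := hK.exists_isMaxOn h continuous_norm.continuousOn
    have h1 : ‖z‖ < 1 := mem_Ball_iff.1 (hKB hz)
    have h0 := norm_nonneg z
    refine ⟨(‖z‖ + 1)/2, by linarith, by linarith, fun x hx => ?_⟩
    have : ‖x‖ ≤ ‖z‖ := hmax hx
    rw [mem_closedBall_zero_iff]; linarith

theorem closedBall_subset_Ball {n : ℕ} {r : ℝ} (hr : r < 1) : closedBall (0 : En n) r ⊆ Ball n :=
  closedBall_subset_ball hr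

theorem memS0_of_chain {n : ℕ} {F : ℝ → En n → En n} (hF : IsNormalizedLoewnerChain n F)
    (hN : IsNormalFamilyChain n F) : MemS0 n (F 0) := by
  refine ⟨⟨hF.1.1 0 le_rfl, (hF.2 0 le_rfl).1, ?_⟩, F, hF, hN, rfl⟩
  rw [(hF.2 0 le_rfl).2]; simp

theorem differentiableAt_of_chain {n : ℕ} {f : En n → En n} (hf : DifferentiableOn ℂ f (Ball n))
    {z : En n} (hz : z ∈ Ball n) : DifferentiableAt ℂ f z :=
  (hf z hz).differentiableAt ((ball_isOpen n).mem_nhds hz)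

/-- Shifted chain. -/
theorem memS0_shift {n : ℕ} {F : ℝ → En n → En n} (hF : IsNormalizedLoewnerChain n F)
    (hN : IsNormalFamilyChain n F) {t : ℝ} (ht : 0 ≤ t) :
    MemS0 n (fun z => (Real.exp (-t) : ℂ) • F t z) := by
  let G : ℝ → En n → En n := fun s z => (Real.exp (-t) : ℂ) • F (t + s) z
  have hne : (Real.exp (-t) : ℂ) ≠ 0 := by exact_mod_cast (Real.exp_pos (-t)).ne'
  have hnn : ‖(Real.exp (-t) : ℂ)‖ = Real.exp (-t) := by
    rw [Complex.norm_real, Real.norm_of_nonneg (Real.exp_pos _).le]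
  have hG : IsNormalizedLoewnerChain n G := by
    refine ⟨⟨?_, ?_, ?_⟩, ?_⟩
    · intro s hs
      obtain ⟨h1, h2⟩ := hF.1.1 (t+s) (by linarith)
      refine ⟨h1.fun_const_smul _, fun x hx y hy hxy => h2 hx hy ?_⟩
      exact smul_right_injective _ hne hxy
    · rintro s s' hs hss' _ ⟨z, hz, rfl⟩
      obtain ⟨w, hw, hwz⟩ := hF.1.2.1 (t+s) (t+s') (by linarith) (by linarith) ⟨z, hz, rfl⟩
      exact ⟨w, hw, by simp only [G, hwz]⟩
    · intro K hK hKc T hT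
      obtain ⟨c, hc0, hci, hc⟩ := hF.1.2.2 K hK hKc (t + T) (by linarith)
      refine ⟨fun τ => Real.exp (-t) * c (t + τ),
        fun τ => mul_nonneg (Real.exp_pos _).le (hc0 _), ?_, ?_⟩
      · refine Integrable.const_mul ?_ _
        refine shift_integrableOn t 0 T (hci.mono_set (Icc_subset_Icc (by linarith) le_rfl))
      · intro z hz s s' hs hss' hs'
        rw [integral_const_mul, shift_integral]
        simp only [G]
        rw [← smul_sub, norm_smul, hnn]
        exact mul_le_mul_of_nonneg_left
          (hc z hz _ _ (by linarith) (by linarith) (by linarith)) (Real.exp_pos _).le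
    · intro s hs
      refine ⟨by simp [G, (hF.2 (t+s) (by linarith)).1], ?_⟩
      have h1 := (chain_hasFDerivAt hF (t := t + s) (by linarith)).const_smul
        (Real.exp (-t) : ℂ)
      have h2 : fderiv ℂ (G s) 0 = _ := h1.fderiv
      rw [h2, smul_smul, ← Complex.ofReal_mul, ← Real.exp_add]
      ring_nf
  have hGN : IsNormalFamilyChain n G := by
    intro K hK hKc
    obtain ⟨M, hM⟩ := hN K hK hKc
    refine ⟨M, fun s hs z hz => ?_⟩
    have := hM (t+s) (by linarith) z hz
    simp only [G, norm_smul, hnn]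
    rwa [← mul_assoc, ← Real.exp_add, show -s + -t = -(t+s) by ring]
  have := memS0_of_chain hG hGN
  simpa [G] using this

/-- Transport of `S⁰` through the evolution family. -/
theorem memS0_transport {n : ℕ} {F : ℝ → En n → En n} (hF : IsNormalizedLoewnerChain n F)
    {t : ℝ} (ht : 0 ≤ t) {g : En n → En n} (hg : MemS0 n g) :
    MemS0 n (fun z => (Real.exp t : ℂ) • g (evolution n F 0 t z)) := by
  obtain ⟨-, G, hG, hGN, rfl⟩ := hg
  let H : ℝ → En n → En n := fun s z => if s ≤ t then (Real.exp t : ℂ) • G 0 (evolution n F s t z)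
    else (Real.exp t : ℂ) • G (s - t) z
  have hne : (Real.exp t : ℂ) ≠ 0 := by exact_mod_cast (Real.exp_pos t).ne'
  have hnn : ‖(Real.exp t : ℂ)‖ = Real.exp t := by
    rw [Complex.norm_real, Real.norm_of_nonneg (Real.exp_pos _).le]
  have hH1 : ∀ s, s ≤ t → H s = fun z => (Real.exp t : ℂ) • G 0 (evolution n F s t z) := by
    intro s hs; funext z; simp only [H, if_pos hs]
  have hH2 : ∀ s, ¬ s ≤ t → H s = fun z => (Real.exp t : ℂ) • G (s - t) z := by
    intro s hs; funext z; simp only [H, if_neg hs]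
  have hH3 : ∀ s, t ≤ s → ∀ z ∈ Ball n, H s z = (Real.exp t : ℂ) • G (s - t) z := by
    intro s hs z hz
    rcases hs.eq_or_lt with h | h
    · subst h
      rw [hH1 _ le_rfl]
      simp only
      rw [ev_self hF ht hz, sub_self]
    · rw [hH2 s (not_le.2 h)]
  obtain ⟨hg1, hg2⟩ := hG.1.1 0 le_rfl
  have hHC : IsNormalizedLoewnerChain n H := by
    refine ⟨⟨?_, ?_, ?_⟩, ?_⟩
    · intro s hs
      by_cases hst : s ≤ t
      · have hE := ev_map hF hs hst
        rw [hH1 s hst]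
        refine ⟨(hg1.comp hE.diff hE.maps).fun_const_smul _, fun x hx y hy hxy => ?_⟩
        exact hE.inj hx hy (hg2 (hE.maps hx) (hE.maps hy) (smul_right_injective _ hne hxy))
      · rw [hH2 s hst]
        obtain ⟨h1, h2⟩ := hG.1.1 (s - t) (by linarith)
        refine ⟨h1.fun_const_smul _, fun x hx y hy hxy => h2 hx hy ?_⟩
        exact smul_right_injective _ hne hxy
    · rintro s s' hs hss' _ ⟨z, hz, rfl⟩
      by_cases hst' : s' ≤ t
      · refine ⟨evolution n F s s' z, (ev_spec hF hs hss' hz).1, ?_⟩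
        rw [hH1 s' hst', hH1 s (hss'.trans hst')]
        simp only
        rw [ev_comp hF hs hss' hst' hz]
      · by_cases hst : s ≤ t
        · obtain ⟨w, hw, hwz⟩ := hG.1.2.1 0 (s' - t) le_rfl (by linarith)
            ⟨_, (ev_spec hF hs hst hz).1, rfl⟩
          refine ⟨w, hw, ?_⟩
          rw [hH2 s' hst', hH1 s hst]
          simp only [hwz]
        · obtain ⟨w, hw, hwz⟩ := hG.1.2.1 (s - t) (s' - t) (by linarith) (by linarith)
            ⟨z, hz, rfl⟩
          refine ⟨w, hw, ?_⟩
          rw [hH2 s' hst', hH2 s hst]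
          simp only [hwz]
    · intro K hK hKc T hT
      obtain ⟨r, hr0, hr1, hKr⟩ := exists_radius hKc hK
      obtain ⟨c1, hc10, hc1i, hc1⟩ := hF.1.2.2 K hK hKc (t + 1) (by linarith)
      obtain ⟨c2, hc20, hc2i, hc2⟩ := hG.1.2.2 K hK hKc T hT
      obtain ⟨hFt1, hFt2⟩ := hF.1.1 t ht
      let q : En n → En n := fun y => (Real.exp t : ℂ) • G 0 (Function.invFunOn (F t) (Ball n) y)
      have hqd : DifferentiableOn ℂ q (F t '' Ball n) :=
        (hg1.comp (univ_inv_differentiableOn (ball_isOpen n) hFt1 hFt2)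
          (fun y hy => Function.invFunOn_mem hy)).fun_const_smul _
      have hScomp : IsCompact (F t '' closedBall 0 r) :=
        (isCompact_closedBall _ _).image_of_continuousOn
          (hFt1.continuousOn.mono (closedBall_subset_Ball hr1))
      obtain ⟨C, hC0, hC⟩ := holo_lipschitz_compact
        (univ_isOpen_image (ball_isOpen n) hFt1 hFt2 (ball_isOpen n) le_rfl) hqd hScomp
        (image_mono (closedBall_subset_Ball hr1))
      let d1 : ℝ → ℝ := (Icc 0 t).indicator c1
      let d2 : ℝ → ℝ := (Icc t (t + T)).indicator (fun τ => c2 (-t + τ))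
      have hd10 : ∀ τ, 0 ≤ d1 τ := fun τ => indicator_nonneg (fun x _ => hc10 x) τ
      have hd20 : ∀ τ, 0 ≤ d2 τ := fun τ => indicator_nonneg (fun x _ => hc20 _) τ
      have hd1i : Integrable d1 := by
        rw [integrable_indicator_iff measurableSet_Icc]
        exact hc1i.mono_set (Icc_subset_Icc le_rfl (by linarith))
      have hd2i : Integrable d2 := by
        rw [integrable_indicator_iff measurableSet_Icc]
        apply shift_integrableOn
        simpa using hc2i
      have hA : ∀ z ∈ K, ∀ s s', 0 ≤ s → s ≤ s' → s' ≤ t →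
          ‖H s z - H s' z‖ ≤ C * ∫ τ in Icc s s', d1 τ := by
        intro z hz s s' hs hss' hs't
        have e1 : ∫ τ in Icc s s', d1 τ = ∫ τ in Icc s s', c1 τ := by
          refine setIntegral_congr_fun measurableSet_Icc fun τ hτ => ?_
          exact indicator_of_mem (Icc_subset_Icc hs hs't hτ) _
        rw [e1, hH1 s (hss'.trans hs't), hH1 s' hs't]
        have hmem : ∀ u, 0 ≤ u → u ≤ t → F u z ∈ F t '' closedBall 0 r := by
          intro u hu hut
          refine ⟨evolution n F u t z, ?_, (ev_spec hF hu hut (hK hz)).2⟩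
          have h1 := (ev_map hF hu hut).norm_le (hK hz)
          have h2 := hKr hz
          simp only [mem_closedBall_zero_iff] at h2 ⊢
          exact h1.trans h2
        refine (hC _ (hmem s hs (hss'.trans hs't)) _ (hmem s' (hs.trans hss') hs't)).trans ?_
        exact mul_le_mul_of_nonneg_left (hc1 z hz s s' hs hss' (by linarith)) hC0
      have hB : ∀ z ∈ K, ∀ s s', t ≤ s → s ≤ s' → s' ≤ T →
          ‖H s z - H s' z‖ ≤ Real.exp t * ∫ τ in Icc s s', d2 τ := by
        intro z hz s s' hts hss' hs'T
        have e1 : ∫ τ in Icc s s', d2 τ = ∫ τ in Icc (-t + s) (-t + s'), c2 τ := by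
          rw [← shift_integral]
          refine setIntegral_congr_fun measurableSet_Icc fun τ hτ => ?_
          exact indicator_of_mem (Icc_subset_Icc hts (by linarith) hτ) _
        rw [e1, hH3 s hts z (hK hz), hH3 s' (hts.trans hss') z (hK hz), ← smul_sub, norm_smul, hnn]
        refine mul_le_mul_of_nonneg_left ?_ (Real.exp_pos _).le
        have := hc2 z hz (s - t) (s' - t) (by linarith) (by linarith) (by linarith)
        rwa [show -t + s = s - t by ring, show -t + s' = s' - t by ring]
      have mono : ∀ d : ℝ → ℝ, (∀ τ, 0 ≤ d τ) → Integrable d → ∀ a b a' b', a' ≤ a → b ≤ b' →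
          ∫ τ in Icc a b, d τ ≤ ∫ τ in Icc a' b', d τ := by
        intro d hd0 hdi a b a' b' h1 h2
        exact setIntegral_mono_set hdi.integrableOn (Eventually.of_forall hd0)
          (Eventually.of_forall (Icc_subset_Icc h1 h2))
      have nn : ∀ d : ℝ → ℝ, (∀ τ, 0 ≤ d τ) → ∀ a b, 0 ≤ ∫ τ in Icc a b, d τ :=
        fun d hd a b => integral_nonneg hd
      refine ⟨fun τ => C * d1 τ + Real.exp t * d2 τ, fun τ => add_nonneg
        (mul_nonneg hC0 (hd10 _)) (mul_nonneg (Real.exp_pos _).le (hd20 _)),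
        ((hd1i.const_mul C).add (hd2i.const_mul _)).integrableOn, ?_⟩
      intro z hz s s' hs hss' hs'T
      rw [integral_add (hd1i.const_mul C).integrableOn (hd2i.const_mul _).integrableOn,
        integral_const_mul, integral_const_mul]
      have n1 := mul_nonneg hC0 (nn d1 hd10 s s')
      have n2 := mul_nonneg (Real.exp_pos t).le (nn d2 hd20 s s')
      by_cases hst' : s' ≤ t
      · linarith [hA z hz s s' hs hss' hst']
      · push Not at hst'
        by_cases hst : t ≤ s
        · linarith [hB z hz s s' hst hss' hs'T]
        · push Not at hst
          have a1 := hA z hz s t hs hst.le le_rfl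
          have a2 := hB z hz t s' le_rfl hst'.le hs'T
          have a3 := mul_le_mul_of_nonneg_left (mono d1 hd10 hd1i s t s s' le_rfl hst'.le) hC0
          have a4 := mul_le_mul_of_nonneg_left (mono d2 hd20 hd2i t s' s s' hst.le le_rfl)
            (Real.exp_pos t).le
          have a5 := norm_sub_le_norm_sub_add_norm_sub (H s z) (H t z) (H s' z)
          linarith
    · intro s hs
      by_cases hst : s ≤ t
      · have hE := ev_map hF hs hst
        rw [hH1 s hst]
        refine ⟨by simp [hE.zero, (hG.2 0 le_rfl).1], ?_⟩
        have h1 := chain_hasFDerivAt hG (t := 0) le_rfl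
        have h1' : HasFDerivAt (G 0) ((Real.exp 0 : ℂ) • ContinuousLinearMap.id ℂ (En n))
          (evolution n F s t 0) := by rw [hE.zero]; exact h1
        have h2 := ((h1'.comp 0 hE.der).const_smul (Real.exp t : ℂ)).fderiv
        refine Eq.trans h2 ?_
        ext1 v
        simp only [_root_.smul_apply, ContinuousLinearMap.comp_apply, ContinuousLinearMap.id_apply,
          smul_smul]
        congr 1
        rw [← Complex.ofReal_mul, ← Complex.ofReal_mul, ← Real.exp_add, ← Real.exp_add]
        ring_nf
      · rw [hH2 s hst]
        refine ⟨by simp [(hG.2 (s-t) (by linarith)).1], ?_⟩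
        have h1 := ((chain_hasFDerivAt hG (t := s - t) (by linarith)).const_smul
          (Real.exp t : ℂ)).fderiv
        refine Eq.trans h1 ?_
        rw [smul_smul, ← Complex.ofReal_mul, ← Real.exp_add]
        ring_nf
  have hHN : IsNormalFamilyChain n H := by
    intro K hK hKc
    obtain ⟨r, hr0, hr1, hKr⟩ := exists_radius hKc hK
    obtain ⟨M, hM⟩ := hGN (closedBall 0 r) (closedBall_subset_Ball hr1) (isCompact_closedBall _ _)
    have hM0 : 0 ≤ M := le_trans (by positivity) (hM 0 le_rfl 0 (by simp [hr0.le]))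
    refine ⟨Real.exp t * M, fun s hs z hz => ?_⟩
    by_cases hst : s ≤ t
    · rw [hH1 s hst]
      simp only [norm_smul, hnn]
      have h1 := (ev_map hF hs hst).norm_le (hK hz)
      have h2 := hKr hz
      have h3 := hM 0 le_rfl (evolution n F s t z) (by
        simp only [mem_closedBall_zero_iff] at h2 ⊢
        exact h1.trans h2)
      simp only [neg_zero, Real.exp_zero, one_mul] at h3
      have h4 : Real.exp (-s) ≤ 1 := by simpa using hs
      calc _ ≤ 1 * (Real.exp t * M) := by gcongr
        _ = _ := one_mul _
    · rw [hH2 s hst]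
      simp only [norm_smul, hnn]
      have h3 := hM (s - t) (by linarith) z (hKr hz)
      have h4 : Real.exp (-s) * Real.exp t = Real.exp (-(s-t)) := by
        rw [← Real.exp_add]; ring_nf
      rw [← mul_assoc, h4]
      have h5 : 1 ≤ Real.exp t := by simpa using ht
      nlinarith
  have := memS0_of_chain hHC hHN
  rwa [hH1 0 ht] at this

end

section
open Metric Filter Set MeasureTheory
open scoped Topology

theorem clf_congr {n : ℕ} {L : (En n → En n) → ℂ} (hL : IsContinuousLinearFunctional n L)
    {f g : En n → En n} (hf : DifferentiableOn ℂ f (Ball n)) (hg : DifferentiableOn ℂ g (Ball n))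
    (h : EqOn f g (Ball n)) : L f = L g := by
  have h1 := hL.2.2 (fun _ => f) g (fun _ => hf) hg (by
    rw [Metric.tendstoLocallyUniformlyOn_iff]
    intro ε hε x hx
    refine ⟨Ball n, self_mem_nhdsWithin, Eventually.of_forall fun _ y hy => ?_⟩
    rw [h hy]; simpa using hε)
  exact tendsto_nhds_unique tendsto_const_nhds h1

theorem clf_sub {n : ℕ} {L : (En n → En n) → ℂ} (hL : IsContinuousLinearFunctional n L)
    (f g : En n → En n) : L (f - g) = L f - L g := by
  have h := hL.1 (f - g) g
  rw [sub_add_cancel] at h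
  rw [h]; ring

theorem clf_zero {n : ℕ} {L : (En n → En n) → ℂ} (hL : IsContinuousLinearFunctional n L) :
    L 0 = 0 := by
  have := hL.2.1 0 0
  simpa using this

theorem clf_bound {n : ℕ} {L : (En n → En n) → ℂ} (hL : IsContinuousLinearFunctional n L) :
    ∃ r : ℝ, 0 < r ∧ r < 1 ∧ ∃ C : ℝ, 0 < C ∧ ∀ h : En n → En n, DifferentiableOn ℂ h (Ball n) →
      ∀ M : ℝ, (∀ z ∈ closedBall (0 : En n) r, ‖h z‖ ≤ M) → ‖L h‖ ≤ C * M := by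
  by_contra hcon
  push Not at hcon
  have hk : ∀ k : ℕ, ∃ h : En n → En n, DifferentiableOn ℂ h (Ball n) ∧ ∃ M : ℝ,
      (∀ z ∈ closedBall (0 : En n) (1 - 1/((k:ℝ)+2)), ‖h z‖ ≤ M) ∧ ((k:ℝ)+1) * M < ‖L h‖ := by
    intro k
    refine hcon (1 - 1/((k:ℝ)+2)) ?_ ?_ ((k:ℝ)+1) (by positivity)
    · rw [sub_pos, div_lt_one (by positivity)]; linarith [k.cast_nonneg (α := ℝ)]
    · have : 0 < 1/((k:ℝ)+2) := by positivity
      linarith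
  choose h hd M hM hlt using hk
  have hr0 : ∀ k : ℕ, 0 ≤ 1 - 1/((k:ℝ)+2) := by
    intro k
    rw [sub_nonneg, div_le_one (by positivity)]; linarith [k.cast_nonneg (α := ℝ)]
  have hM0 : ∀ k, 0 ≤ M k := fun k => (norm_nonneg _).trans (hM k 0 (mem_closedBall_self (hr0 k)))
  have hLpos : ∀ k, 0 < ‖L (h k)‖ := fun k => lt_of_le_of_lt
    (mul_nonneg (by positivity) (hM0 k)) (hlt k)
  let u : ℕ → En n → En n := fun k => (L (h k))⁻¹ • h k
  have hLu : ∀ k, L (u k) = 1 := by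
    intro k
    rw [hL.2.1]
    exact inv_mul_cancel₀ (norm_pos_iff.1 (hLpos k))
  have hu : ∀ k : ℕ, ∀ z ∈ closedBall (0 : En n) (1 - 1/((k:ℝ)+2)), ‖u k z‖ ≤ 1 / ((k:ℝ)+1) := by
    intro k z hz
    have h1 := hM k z hz
    have h2 := hlt k
    simp only [u, Pi.smul_apply, norm_smul, norm_inv]
    rw [inv_mul_le_iff₀ (hLpos k), mul_one_div, le_div_iff₀ (by positivity)]
    nlinarith [k.cast_nonneg (α := ℝ)]
  have htend := hL.2.2 u 0 (fun k => (hd k).const_smul _) (differentiableOn_const _) (by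
    rw [tendstoLocallyUniformlyOn_iff_forall_isCompact (ball_isOpen n)]
    intro K hKB hK
    obtain ⟨r, hr0', hr1, hKr⟩ := exists_radius hK hKB
    rw [Metric.tendstoUniformlyOn_iff]
    intro ε hε
    have e1 : ∀ᶠ k : ℕ in atTop, 1 / ((k:ℝ)+1) < ε :=
      tendsto_one_div_add_atTop_nhds_zero_nat.eventually (gt_mem_nhds hε)
    have e2 : ∀ᶠ k : ℕ in atTop, 1 / ((k:ℝ)+1) < 1 - r :=
      tendsto_one_div_add_atTop_nhds_zero_nat.eventually (gt_mem_nhds (by linarith))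
    filter_upwards [e1, e2] with k h1 h2 z hz
    have h3 : 1 / ((k:ℝ)+2) ≤ 1 / ((k:ℝ)+1) := by gcongr; norm_num
    simp only [Pi.zero_apply, dist_zero_left]
    refine lt_of_le_of_lt (hu k z ?_) h1
    exact closedBall_subset_closedBall (by linarith) (hKr hz))
  simp only [hLu, clf_zero hL] at htend
  exact zero_ne_one (tendsto_nhds_unique htend tendsto_const_nhds)

theorem clf_comp {n : ℕ} {L : (En n → En n) → ℂ} (hL : IsContinuousLinearFunctional n L)
    {φ : En n → En n} {a : ℝ} (hφ : EvMap n φ a) (c : ℂ) :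
    IsContinuousLinearFunctional n (fun g => c * L (fun z => g (φ z))) := by
  refine ⟨?_, ?_, ?_⟩
  · intro f g
    have : (fun z => (f + g) (φ z)) = (fun z => f (φ z)) + fun z => g (φ z) := rfl
    simp only [this, hL.1]; ring
  · intro d f
    have : (fun z => (d • f) (φ z)) = d • fun z => f (φ z) := rfl
    simp only [this, hL.2.1]; ring
  · intro f g hf hg hfg
    refine Tendsto.const_mul c ?_
    refine hL.2.2 (fun k z => f k (φ z)) (fun z => g (φ z)) (fun k => (hf k).comp hφ.diff hφ.maps)
      (hg.comp hφ.diff hφ.maps) ?_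
    exact hfg.comp φ hφ.maps hφ.diff.continuousOn

end

section
open Metric Filter Set MeasureTheory
open scoped Topology

theorem memS0_perturb {n : ℕ} {h : En n → En n} (hd : Differentiable ℂ h) (h0 : h 0 = 0)
    (hd0 : fderiv ℂ h 0 = 0) : ∃ ε : ℝ, 0 < ε ∧ ∀ c : ℂ, ‖c‖ ≤ ε →
      MemS0 n (fun z => z + c • h z) := by
  obtain ⟨C, hC0, hC⟩ := holo_lipschitz_compact isOpen_univ (hd.differentiableOn (s := univ))
    (isCompact_closedBall (0 : En n) 1) (subset_univ _)
  refine ⟨1 / (2 * (C + 1)), by positivity, fun c hc => ?_⟩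
  have hη : ∀ x ∈ closedBall (0 : En n) 1, ∀ y ∈ closedBall (0 : En n) 1,
      ‖c • (h x - h y)‖ ≤ 1 / 2 * ‖x - y‖ := by
    intro x hx y hy
    rw [norm_smul]
    have h1 := hC x hx y hy
    have h2 : ‖c‖ * C ≤ 1 / 2 := by
      rw [le_div_iff₀ (by positivity)] at hc
      nlinarith [norm_nonneg c]
    calc _ ≤ ‖c‖ * (C * ‖x - y‖) := by gcongr
      _ = (‖c‖ * C) * ‖x - y‖ := by ring
      _ ≤ _ := by gcongr
  have hsub : Ball n ⊆ closedBall (0 : En n) 1 := ball_subset_closedBall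
  let G : ℝ → En n → En n := fun τ z => (Real.exp τ : ℂ) • z + c • h z
  have hnn : ∀ t, ‖(Real.exp t : ℂ)‖ = Real.exp t := by
    intro t
    rw [Complex.norm_real, Real.norm_of_nonneg (Real.exp_pos _).le]
  have hG : IsNormalizedLoewnerChain n G := by
    refine ⟨⟨?_, ?_, ?_⟩, ?_⟩
    · intro t ht
      refine ⟨?_, ?_⟩
      · exact ((differentiable_id.fun_const_smul (Real.exp t : ℂ)).add
          (hd.fun_const_smul c)).differentiableOn
      · intro x hx y hy hxy
        have h1 := hη x (hsub hx) y (hsub hy)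
        have h2 : (Real.exp t : ℂ) • (x - y) = - (c • (h x - h y)) := by
          simp only [G] at hxy
          rw [smul_sub, smul_sub, sub_eq_iff_eq_add, ← sub_eq_zero]
          rw [← sub_eq_zero] at hxy
          rw [← hxy]; abel
        have h3 := congrArg norm h2
        rw [norm_neg, norm_smul, hnn] at h3
        have h4 : 1 ≤ Real.exp t := by simpa using ht
        have h5 : ‖x - y‖ = 0 := by nlinarith [norm_nonneg (x - y)]
        exact sub_eq_zero.1 (norm_eq_zero.1 h5)
    · rintro s t hs hst _ ⟨z, hz, rfl⟩
      have hz1 : ‖z‖ < 1 := mem_Ball_iff.1 hz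
      set a := Real.exp (s - t) with ha
      have ha0 : 0 < a := Real.exp_pos _
      have ha1 : a ≤ 1 := by rw [ha]; simpa using hst
      let T : En n → En n := fun w => (a : ℂ) • z + (Real.exp (-t) : ℂ) • (c • (h z - h w))
      let S : Set (En n) := closedBall ((a:ℂ) • z) ((1 - a) * ‖z‖)
      have hSn : ∀ w ∈ S, ‖w‖ ≤ ‖z‖ := by
        intro w hw
        have h1 : ‖w - (a:ℂ) • z‖ ≤ (1 - a) * ‖z‖ := by simpa [S, dist_eq_norm] using hw
        have h2 : ‖(a:ℂ) • z‖ = a * ‖z‖ := by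
          rw [norm_smul, Complex.norm_real, Real.norm_of_nonneg ha0.le]
        have h3 := norm_le_norm_add_norm_sub' w ((a:ℂ) • z)
        linarith
      have hSc : ∀ w ∈ S, w ∈ closedBall (0 : En n) 1 := by
        intro w hw
        rw [mem_closedBall_zero_iff]
        exact (hSn w hw).trans hz1.le
      have het : Real.exp (-t) ≤ 1 := by simpa using hs.trans hst
      have hzS : ∀ w ∈ S, ‖z - w‖ ≤ 2 * ((1 - a) * ‖z‖) := by
        intro w hw
        have h1 : ‖w - (a:ℂ) • z‖ ≤ (1 - a) * ‖z‖ := by simpa [S, dist_eq_norm] using hw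
        have h2 : ‖z - (a:ℂ) • z‖ = (1 - a) * ‖z‖ := by
          have : z - (a:ℂ) • z = ((1 - a : ℝ) : ℂ) • z := by
            push_cast; rw [sub_smul, one_smul]
          rw [this, norm_smul, Complex.norm_real, Real.norm_of_nonneg (by linarith)]
        have h3 := norm_sub_le_norm_sub_add_norm_sub z ((a:ℂ) • z) w
        rw [norm_sub_rev ((a:ℂ) • z) w] at h3
        linarith
      have hmaps : MapsTo T S S := by
        intro w hw
        simp only [S, mem_closedBall, dist_eq_norm, T, add_sub_cancel_left]
        rw [norm_smul, hnn]
        have h1 := hη z (hsub hz) w (hSc w hw)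
        have h2 := hzS w hw
        calc _ ≤ 1 * (1 / 2 * ‖z - w‖) := by gcongr
          _ ≤ _ := by linarith
      have hcontr : ContractingWith (1/2) (hmaps.restrict T S S) := by
        refine ⟨by
          rw [← NNReal.coe_lt_coe]; norm_num, LipschitzWith.of_dist_le_mul fun x y => ?_⟩
        rw [Subtype.dist_eq, Subtype.dist_eq]
        simp only [MapsTo.val_restrict_apply, T, dist_eq_norm]
        rw [add_sub_add_left_eq_sub, ← smul_sub, ← smul_sub, sub_sub_sub_cancel_left,
          norm_smul, hnn]
        have h1 := hη y (hSc y y.2) x (hSc x x.2)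
        rw [norm_sub_rev (y : En n)] at h1
        calc _ ≤ 1 * (1 / 2 * ‖(x : En n) - y‖) := by gcongr
          _ = _ := by push_cast; ring
      obtain ⟨w, hw, hfix, -⟩ := hcontr.exists_fixedPoint' (x := (a:ℂ) • z)
        (isClosed_closedBall.isComplete) hmaps
        (mem_closedBall_self (mul_nonneg (by linarith) (norm_nonneg z)))
        (edist_ne_top _ _)
      refine ⟨w, mem_Ball_iff.2 ((hSn w hw).trans_lt hz1), ?_⟩
      have hfix' : (a : ℂ) • z + (Real.exp (-t) : ℂ) • (c • (h z - h w)) = w := hfix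
      have h5 : (Real.exp t : ℂ) • w = (Real.exp s : ℂ) • z + c • (h z - h w) := by
        have h6 := congrArg (fun y => (Real.exp t : ℂ) • y) hfix'
        rw [← h6, smul_add, smul_smul, smul_smul, ← Complex.ofReal_mul, ← Complex.ofReal_mul,
          ha, ← Real.exp_add, ← Real.exp_add]
        simp
      simp only [G]
      rw [h5, smul_sub]; abel
    · intro K hK hKc T hT
      refine ⟨Real.exp, fun τ => (Real.exp_pos τ).le,
        Real.continuous_exp.continuousOn.integrableOn_Icc, ?_⟩
      intro z hz s t hs hst htT
      rw [integral_Icc_eq_integral_Ioc, ← intervalIntegral.integral_of_le hst, integral_exp]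
      simp only [G]
      rw [add_sub_add_right_eq_sub, ← sub_smul, norm_smul, ← Complex.ofReal_sub, Complex.norm_real,
        Real.norm_eq_abs, abs_sub_comm, abs_of_nonneg (by simpa using hst)]
      have h1 : ‖z‖ ≤ 1 := (mem_Ball_iff.1 (hK hz)).le
      have h2 : 0 ≤ Real.exp t - Real.exp s := by simpa using hst
      nlinarith
    · intro t ht
      refine ⟨by simp [G, h0], ?_⟩
      have h1 : HasFDerivAt h (0 : En n →L[ℂ] En n) 0 := by
        rw [← hd0]; exact (hd 0).hasFDerivAt
      have h2 := (((hasFDerivAt_id (0 : En n)).const_smul (Real.exp t : ℂ)).add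
        (h1.const_smul c)).fderiv
      refine Eq.trans h2 ?_
      simp
  have hGN : IsNormalFamilyChain n G := by
    intro K hK hKc
    refine ⟨2, fun t ht z hz => ?_⟩
    have h1 : ‖z‖ ≤ 1 := (mem_Ball_iff.1 (hK hz)).le
    have h2 := hη z (hsub (hK hz)) 0 (by simp)
    simp only [h0, sub_zero] at h2
    have h3 : ‖G t z‖ ≤ Real.exp t * ‖z‖ + ‖c • h z‖ := by
      refine (norm_add_le _ _).trans ?_
      rw [norm_smul, hnn]
    have h4 : Real.exp (-t) ≤ 1 := by simpa using ht
    have h5 : Real.exp (-t) * Real.exp t = 1 := by rw [← Real.exp_add]; simp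
    calc Real.exp (-t) * ‖G t z‖ ≤ Real.exp (-t) * (Real.exp t * ‖z‖ + ‖c • h z‖) := by gcongr
      _ = ‖z‖ + Real.exp (-t) * ‖c • h z‖ := by rw [mul_add, ← mul_assoc, h5, one_mul]
      _ ≤ 1 + 1 * (1 / 2 * 1) := by
        gcongr
        linarith
      _ ≤ 2 := by norm_num
  have := memS0_of_chain hG hGN
  simpa [G] using this

theorem memS0_id (n : ℕ) : MemS0 n (fun z => z) := by
  obtain ⟨ε, hε, h⟩ := memS0_perturb (n := n) (h := fun _ => 0) (differentiable_const _) rfl (by simp)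
  simpa using h 0 (by simpa using hε.le)

/-- If `Re L` is constant on `S⁰` then `L` kills entire maps of order at least two. -/
theorem clf_kill_entire {n : ℕ} {L : (En n → En n) → ℂ} (hL : IsContinuousLinearFunctional n L)
    (hc : ∀ g₁, MemS0 n g₁ → ∀ g₂, MemS0 n g₂ → (L g₁).re = (L g₂).re)
    {h : En n → En n} (hd : Differentiable ℂ h) (h0 : h 0 = 0) (hd0 : fderiv ℂ h 0 = 0) :
    L h = 0 := by
  obtain ⟨ε, hε, hm⟩ := memS0_perturb hd h0 hd0
  have key : ∀ c : ℂ, ‖c‖ ≤ ε → (c * L h).re = 0 := by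
    intro c hcε
    have h1 := hc _ (hm c hcε) _ (memS0_id n)
    have h2 : (fun z => z + c • h z) = (fun z => z) + c • h := rfl
    rw [h2, hL.1, hL.2.1, Complex.add_re] at h1
    linarith
  have k1 := key (ε : ℂ) (by simp [abs_of_pos hε])
  have k2 := key (ε * Complex.I : ℂ) (by simp [abs_of_pos hε])
  apply Complex.ext
  · simpa [hε.ne'] using k1
  · simpa [hε.ne'] using k2

end

section
open Metric Filter Set MeasureTheory
open scoped Topology

/-- Approximation of holomorphic maps on balls by entire maps. -/
theorem holo_taylor_approx {E : Type} [NormedAddCommGroup E] [NormedSpace ℂ E]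
    [FiniteDimensional ℂ E] {h : E → E} {r R : ℝ} (hr : 0 < r) (hrR : r < R)
    (hh : DifferentiableOn ℂ h (ball 0 R)) (h0 : h 0 = 0) (hd0 : fderiv ℂ h 0 = 0)
    {ε : ℝ} (hε : 0 < ε) :
    ∃ q : E → E, Differentiable ℂ q ∧ q 0 = 0 ∧ fderiv ℂ q 0 = 0 ∧
      ∀ z ∈ closedBall (0:E) r, ‖h z - q z‖ ≤ ε := by
  have : CompleteSpace E := FiniteDimensional.complete ℂ E
  have : ProperSpace E := FiniteDimensional.proper ℂ E
  set R' := (r + R) / 2 with hR'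
  have hrR' : r < R' := by rw [hR']; linarith
  have hR'R : R' < R := by rw [hR']; linarith
  have hR'0 : 0 < R' := by linarith
  have hsub : closedBall (0:E) R' ⊆ ball 0 R := closedBall_subset_ball hR'R
  obtain ⟨M, hM⟩ := (isCompact_closedBall (0:E) R').exists_bound_of_continuousOn
    (hh.continuousOn.mono hsub)
  have hM0 : 0 ≤ M := (norm_nonneg _).trans (hM 0 (mem_closedBall_self hR'0.le))
  let P : ℕ → E → E := fun m z => ((m.factorial : ℂ))⁻¹ • iteratedFDeriv ℂ m h 0 (fun _ => z)
  have hPd : ∀ m, Differentiable ℂ (P m) := by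
    intro m
    have h1 : Differentiable ℂ (iteratedFDeriv ℂ m h 0) :=
      (ContinuousMultilinearMap.contDiff (n := 1) (iteratedFDeriv ℂ m h 0)).differentiable (by simp)
    have h2 : Differentiable ℂ (fun z : E => (fun _ : Fin m => z)) :=
      differentiable_pi.2 fun _ => differentiable_id
    exact (h1.comp h2).fun_const_smul _
  have hP0 : ∀ m, P m 0 = 0 ∧ HasFDerivAt (P m) (0 : E →L[ℂ] E) 0 := by
    intro m
    match m with
    | 0 =>
      have : P 0 = fun _ => 0 := by funext z; simp [P, h0]
      rw [this]
      exact ⟨rfl, hasFDerivAt_const _ _⟩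
    | 1 =>
      have : P 1 = fun _ => 0 := by
        funext z
        simp only [P]
        rw [iteratedFDeriv_one_apply, hd0]
        simp
      rw [this]
      exact ⟨rfl, hasFDerivAt_const _ _⟩
    | m + 2 =>
      have hb : ∀ z, ‖P (m+2) z‖ ≤ (‖((m+2).factorial : ℂ)⁻¹‖ * ‖iteratedFDeriv ℂ (m+2) h 0‖)
          * ‖z‖ ^ (m+2) := by
        intro z
        simp only [P]
        rw [norm_smul, mul_assoc]
        gcongr
        refine (ContinuousMultilinearMap.le_opNorm _ _).trans ?_
        simp
      refine ⟨?_, ?_⟩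
      · have := hb 0
        simpa using this
      · refine Asymptotics.IsBigO.hasFDerivAt (n := m + 2) ?_ (by omega)
        refine Asymptotics.IsBigO.of_bound (‖((m+2).factorial : ℂ)⁻¹‖ *
          ‖iteratedFDeriv ℂ (m+2) h 0‖) (Eventually.of_forall fun z => ?_)
        simpa using hb z
  set ρ := R' / r with hρ
  have hρ1 : 1 < ρ := by rw [hρ, one_lt_div hr]; exact hrR'
  have hρ0 : 0 < ρ := by linarith
  have hcd : ContDiffOn ℂ (⊤ : ℕ∞) h (ball 0 R) := holo_contDiffOn isOpen_ball hh
  have hkey : ∀ z ∈ closedBall (0:E) r, HasSum (fun m => P m z) (h z) ∧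
      ∀ m, ‖P m z‖ ≤ M * (ρ⁻¹) ^ m := by
    intro z hz
    have hz' : ‖z‖ ≤ r := by simpa using hz
    let g : ℂ →L[ℂ] E := (ContinuousLinearMap.id ℂ ℂ).smulRight z
    have hg : ∀ ζ, g ζ = ζ • z := fun ζ => by simp [g]
    have hin : ∀ ζ ∈ closedBall (0:ℂ) ρ, g ζ ∈ closedBall (0:E) R' := by
      intro ζ hζ
      have : ‖ζ‖ ≤ ρ := by simpa using hζ
      rw [mem_closedBall_zero_iff, hg, norm_smul]
      calc _ ≤ ρ * r := by gcongr
        _ = R' := by rw [hρ]; field_simp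
    have hud : DifferentiableOn ℂ (h ∘ g) (closedBall 0 ρ) :=
      hh.comp g.differentiable.differentiableOn fun ζ hζ => hsub (hin ζ hζ)
    have hit : ∀ m, iteratedDeriv m (h ∘ g) 0 = iteratedFDeriv ℂ m h 0 (fun _ => z) := by
      intro m
      have hop : IsOpen (g ⁻¹' ball 0 R) := isOpen_ball.preimage g.continuous
      have h0R : (0:E) ∈ ball (0:E) R := mem_ball_self (by linarith)
      have hm0 : g 0 ∈ ball (0:E) R := by rw [map_zero]; exact h0R
      have h1 := g.iteratedFDerivWithin_comp_right hcd isOpen_ball.uniqueDiffOn hop.uniqueDiffOn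
        hm0 (i := m) (by exact_mod_cast le_top)
      rw [iteratedFDerivWithin_of_isOpen m hop hm0, iteratedFDerivWithin_of_isOpen m isOpen_ball hm0,
        map_zero] at h1
      rw [iteratedDeriv_eq_iteratedFDeriv, h1]
      simp [ContinuousMultilinearMap.compContinuousLinearMap_apply, hg]
    have hPm : ∀ m, P m z = ((m.factorial : ℂ))⁻¹ • iteratedDeriv m (h ∘ g) 0 := by
      intro m; rw [hit m]
    refine ⟨?_, ?_⟩
    · have h1 := Complex.hasSum_taylorSeries_on_ball (hud.mono ball_subset_closedBall)
        (z := 1) (by simpa using hρ1)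
      have h2 : (h ∘ g) 1 = h z := by simp [hg]
      rw [h2] at h1
      convert h1 using 2 with m
      rw [hPm m]; simp
    · intro m
      have h1 := Complex.norm_iteratedDeriv_le_of_forall_mem_sphere_norm_le (C := M) m hρ0
        (f := h ∘ g) (c := 0) (by
          refine DifferentiableOn.diffContOnCl ?_
          rw [closure_ball _ hρ0.ne']
          exact hud) (fun ζ hζ => hM _ (hin ζ (sphere_subset_closedBall hζ)))
      rw [hPm m, norm_smul, norm_inv, Complex.norm_natCast, inv_mul_le_iff₀ (by positivity)]
      refine h1.trans (le_of_eq ?_)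
      rw [inv_pow]; ring
  have hρi : ρ⁻¹ < 1 := inv_lt_one_of_one_lt₀ hρ1
  have htend : Tendsto (fun N : ℕ => M * (ρ⁻¹) ^ N / (1 - ρ⁻¹)) atTop (𝓝 0) := by
    have h1 := tendsto_pow_atTop_nhds_zero_of_lt_one (inv_nonneg.2 hρ0.le) hρi
    have := (h1.const_mul M).div_const (1 - ρ⁻¹)
    simpa using this
  obtain ⟨N, hN⟩ := (htend.eventually (gt_mem_nhds hε)).exists
  refine ⟨fun z => ∑ m ∈ Finset.range N, P m z, ?_, ?_, ?_, ?_⟩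
  · exact Differentiable.fun_sum fun m _ => hPd m
  · exact Finset.sum_eq_zero fun m _ => (hP0 m).1
  · have := HasFDerivAt.fun_sum (u := Finset.range N) (fun m _ => (hP0 m).2)
    simpa using this.fderiv
  · intro z hz
    obtain ⟨h1, h2⟩ := hkey z hz
    rw [norm_sub_rev]
    exact (norm_sub_le_of_geometric_bound_of_hasSum hρi h2 h1 N).trans hN.le

end

section
open Metric Filter Set MeasureTheory
open scoped Topology

theorem ev_close {n : ℕ} {φ : En n → En n} {a η ρ : ℝ} (hφ : EvMap n φ a) (hη : 0 < η)
    (ha : |1 - a| ≤ η) (hρ1 : ρ < 1) {z : En n} (hz : ‖z‖ ≤ ρ) :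
    ‖φ z - z‖ ^ 2 ≤ 8 * η / (1 - ρ) := by
  have hρ : 0 < 1 - ρ := by linarith
  rcases eq_or_ne z 0 with rfl | hz0
  · rw [hφ.zero, sub_zero, norm_zero]
    have : 0 ≤ 8 * η / (1 - ρ) := by positivity
    simpa using this
  have hzp : 0 < ‖z‖ := norm_pos_iff.2 hz0
  set v : En n := ((‖z‖⁻¹ : ℝ) : ℂ) • z with hv
  have hv1 : ‖v‖ = 1 := by
    rw [hv, norm_smul, Complex.norm_real, norm_inv, norm_norm, inv_mul_cancel₀ hzp.ne']
  have hzv : z = ((‖z‖ : ℝ) : ℂ) • v := by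
    rw [hv, smul_smul, ← Complex.ofReal_mul, mul_inv_cancel₀ hzp.ne']; simp
  let f : ℂ → ℂ := fun ζ => innerSL ℂ v (φ (ζ • v))
  have hmem : ∀ ζ ∈ ball (0:ℂ) 1, ζ • v ∈ Ball n := by
    intro ζ hζ
    rw [mem_Ball_iff, norm_smul, hv1, mul_one]
    simpa using hζ
  have hfd : DifferentiableOn ℂ f (ball 0 1) :=
    (innerSL ℂ v).differentiable.comp_differentiableOn
      (hφ.diff.comp (by fun_prop) hmem)
  have hf0 : f 0 = 0 := by simp [f, hφ.zero]
  have hfm : MapsTo f (ball 0 1) (closedBall (f 0) 1) := by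
    intro ζ hζ
    rw [hf0, mem_closedBall_zero_iff]
    have h1 : ‖φ (ζ • v)‖ < 1 := mem_Ball_iff.1 (hφ.maps (hmem ζ hζ))
    have h2 : ‖f ζ‖ ≤ ‖v‖ * ‖φ (ζ • v)‖ := by
      simp only [f, innerSL_apply_apply]
      exact norm_inner_le_norm _ _
    rw [hv1] at h2; linarith
  let ψ : ℂ → ℂ := dslope f 0
  have hψd : DifferentiableOn ℂ ψ (ball 0 1) :=
    (Complex.differentiableOn_dslope (ball_mem_nhds 0 one_pos)).2 hfd
  have hψ1 : ∀ ζ ∈ ball (0:ℂ) 1, ‖ψ ζ‖ ≤ 1 := by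
    intro ζ hζ
    simpa using Complex.norm_dslope_le_div_of_mapsTo_ball hfd hfm hζ
  have hψ0 : ψ 0 = a := by
    simp only [ψ, dslope_same]
    have h1 : HasDerivAt (fun ζ : ℂ => ζ • v) v 0 := by
      simpa using (hasDerivAt_id (0:ℂ)).smul_const v
    have h2 : HasFDerivAt φ ((a : ℂ) • ContinuousLinearMap.id ℂ (En n)) ((0:ℂ) • v) := by
      rw [zero_smul]; exact hφ.der
    have h3 := ((innerSL ℂ v).hasFDerivAt.comp _ h2).comp_hasDerivAt (0:ℂ) h1
    have h4 : deriv f 0 = _ := h3.deriv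
    rw [h4]
    simp [hv1]
  have hbc := Complex.borelCaratheodory (f := fun ζ => ψ ζ - 1) (M := η) (R := 1)
    (z := ((‖z‖ : ℝ) : ℂ)) hη (hψd.sub_const 1) (by
      intro ζ hζ
      have h1 := (Complex.re_le_norm (ψ ζ)).trans (hψ1 ζ hζ)
      simp only [mem_ofPred_eq, Complex.sub_re, Complex.one_re]
      linarith) one_pos (by
      rw [mem_ball_zero_iff, Complex.norm_real, norm_norm]; linarith)
  simp only [Complex.norm_real, norm_norm, hψ0] at hbc
  have h5 : ‖(a:ℂ) - 1‖ ≤ η := by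
    rw [← Complex.ofReal_one, ← Complex.ofReal_sub, Complex.norm_real, Real.norm_eq_abs,
      abs_sub_comm]
    exact ha
  have h6 : ‖ψ ((‖z‖ : ℝ) : ℂ) - 1‖ ≤ 4 * η / (1 - ρ) := by
    refine hbc.trans ?_
    rw [← add_div]
    apply div_le_div₀ (by positivity) _ hρ (by linarith)
    nlinarith [norm_nonneg ((a:ℂ) - 1)]
  have h7 : ψ ((‖z‖ : ℝ) : ℂ) = ((‖z‖⁻¹ : ℝ) : ℂ) * f ((‖z‖ : ℝ) : ℂ) := by
    have hne : ((‖z‖ : ℝ) : ℂ) ≠ 0 := by exact_mod_cast hzp.ne'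
    simp only [ψ]
    rw [dslope_of_ne _ hne, slope_def_field, hf0]
    field_simp
    push_cast
    field_simp
    simp
  -- inner product
  have h8 : inner ℂ z (φ z) = ((‖z‖ ^ 2 : ℝ) : ℂ) * ψ ((‖z‖ : ℝ) : ℂ) := by
    have : f ((‖z‖ : ℝ) : ℂ) = inner ℂ v (φ z) := by
      simp only [f, innerSL_apply_apply, ← hzv]
    rw [h7, this]
    conv_lhs => rw [show inner ℂ z (φ z) = inner ℂ (((‖z‖ : ℝ) : ℂ) • v) (φ z) by rw [← hzv]]
    rw [inner_smul_left, Complex.conj_ofReal, ← mul_assoc, ← Complex.ofReal_mul]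
    congr 2
    field_simp
  have h9 : (1 - (ψ ((‖z‖ : ℝ) : ℂ)).re) ≤ 4 * η / (1 - ρ) := by
    have := Complex.re_le_norm (1 - ψ ((‖z‖ : ℝ) : ℂ))
    rw [norm_sub_rev] at this
    simp only [Complex.sub_re, Complex.one_re] at this
    linarith
  have h10 : RCLike.re (inner ℂ (φ z) z) = ‖z‖ ^ 2 * (ψ ((‖z‖ : ℝ) : ℂ)).re := by
    rw [inner_re_symm, h8]
    simp only [RCLike.re_to_complex, Complex.re_ofReal_mul]
  have h11 := norm_sub_sq (𝕜 := ℂ) (φ z) z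
  rw [h10] at h11
  have h12 : ‖φ z‖ ≤ ‖z‖ := hφ.norm_le (mem_Ball_iff.2 (by linarith))
  have h13 : ‖φ z‖ ^ 2 ≤ ‖z‖ ^ 2 := by gcongr
  have h14 : ‖z‖ ^ 2 ≤ 1 := by nlinarith
  have h15 : 0 ≤ 4 * η / (1 - ρ) := by positivity
  have h16 : 8 * η / (1 - ρ) = 2 * (4 * η / (1 - ρ)) := by ring
  rw [h11, h16]
  nlinarith [sq_nonneg ‖z‖]

theorem ev_surj {n : ℕ} {r : ℝ} (hr0 : 0 < r) (hr1 : r < 1) : ∃ η : ℝ, 0 < η ∧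
    ∀ (φ : En n → En n) (a : ℝ), EvMap n φ a → |1 - a| ≤ η → ball (0 : En n) r ⊆ φ '' Ball n := by
  set ρ := (1 + r) / 2 with hρ
  have hρ1 : ρ < 1 := by rw [hρ]; linarith
  have hrρ : r < ρ := by rw [hρ]; linarith
  set δ := (ρ - r) / 3 with hδ
  have hδ0 : 0 < δ := by rw [hδ]; linarith
  have h1ρ : 0 < 1 - ρ := by linarith
  refine ⟨δ ^ 2 * (1 - ρ) / 8, by positivity, fun φ a hφ ha w hw => ?_⟩
  have hw' : ‖w‖ < r := by simpa using hw
  have hclose : ∀ z, ‖z‖ ≤ ρ → ‖φ z - z‖ ≤ δ := by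
    intro z hz
    have h1 := ev_close hφ (by positivity) ha hρ1 hz
    have h2 : 8 * (δ ^ 2 * (1 - ρ) / 8) / (1 - ρ) = δ ^ 2 := by field_simp
    rw [h2] at h1
    exact le_of_sq_le_sq h1 hδ0.le
  have hsub : closedBall (0 : En n) ρ ⊆ Ball n := closedBall_subset_Ball hρ1
  obtain ⟨z₀, hz₀, hmin⟩ := (isCompact_closedBall (0 : En n) ρ).exists_isMinOn
    ⟨0, mem_closedBall_self (by linarith)⟩
    ((hφ.diff.continuousOn.mono hsub).sub continuousOn_const (g := fun _ => w)).norm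
  have hz₀' : ‖z₀‖ ≤ ρ := by simpa using hz₀
  have hw2 : ‖φ z₀ - w‖ ≤ δ :=
    (hmin (show w ∈ closedBall (0 : En n) ρ by simp; linarith)).trans (hclose w (by linarith))
  have hz0lt : ‖z₀‖ < ρ := by
    have h1 := hclose z₀ hz₀'
    have h2 : ‖z₀‖ ≤ ‖φ z₀ - z₀‖ + ‖φ z₀ - w‖ + ‖w‖ := by
      have : z₀ = -(φ z₀ - z₀) + (φ z₀ - w) + w := by abel
      calc ‖z₀‖ = ‖-(φ z₀ - z₀) + (φ z₀ - w) + w‖ := by rw [← this]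
        _ ≤ _ := by
          refine (norm_add_le _ _).trans ?_
          gcongr
          refine (norm_add_le _ _).trans ?_
          rw [norm_neg]
    have : 3 * δ = ρ - r := by rw [hδ]; ring
    linarith
  refine ⟨z₀, hsub hz₀, ?_⟩
  by_contra hne
  have hopen := univ_isOpen_image (ball_isOpen n) hφ.diff hφ.inj (isOpen_ball (x := (0 : En n)) (ε := ρ))
    (ball_subset_closedBall.trans hsub)
  have hnb : φ '' ball 0 ρ ∈ 𝓝 (φ z₀) := hopen.mem_nhds ⟨z₀, by simpa using hz0lt, rfl⟩
  have hcont : Tendsto (fun s : ℝ => φ z₀ + (s : ℂ) • (w - φ z₀)) (𝓝[>] 0) (𝓝 (φ z₀)) := by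
    have : Continuous (fun s : ℝ => φ z₀ + (s : ℂ) • (w - φ z₀)) := by fun_prop
    have h := this.tendsto 0
    simp only [Complex.ofReal_zero, zero_smul, add_zero] at h
    exact h.mono_left nhdsWithin_le_nhds
  have hs1 : ∀ᶠ s : ℝ in 𝓝[>] 0, s ∈ Ioo (0:ℝ) 1 := Ioo_mem_nhdsGT one_pos
  obtain ⟨s, ⟨x, hx, hxs⟩, hs0, hs1⟩ := ((hcont.eventually hnb).and hs1).exists
  have h1 : ‖φ z₀ - w‖ ≤ ‖φ x - w‖ := hmin (ball_subset_closedBall hx)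
  have h2 : φ x - w = ((1 - s : ℝ) : ℂ) • (φ z₀ - w) := by
    rw [hxs]; push_cast; module
  rw [h2, norm_smul, Complex.norm_real, Real.norm_of_nonneg (by linarith)] at h1
  have h3 : 0 < ‖φ z₀ - w‖ := norm_pos_iff.2 (sub_ne_zero.2 hne)
  nlinarith

end

section
open Metric Filter Set MeasureTheory
open scoped Topology

/-- The functional kills all entire maps of order at least two composed with `φ_{0,s}`. -/
def KillsAt (n : ℕ) (L : (En n → En n) → ℂ) (F : ℝ → En n → En n) (s : ℝ) : Prop :=
  ∀ h : En n → En n, Differentiable ℂ h → h 0 = 0 → fderiv ℂ h 0 = 0 →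
    L (fun z => h (evolution n F 0 s z)) = 0

theorem eq_zero_of_norm_le_mul {x : ℂ} {C : ℝ} (hC : 0 < C) (h : ∀ ε : ℝ, 0 < ε → ‖x‖ ≤ C * ε) :
    x = 0 := by
  by_contra hx
  have hp : 0 < ‖x‖ := norm_pos_iff.2 hx
  have h1 := h (‖x‖ / (2 * C)) (by positivity)
  have h2 : C * (‖x‖ / (2 * C)) = ‖x‖ / 2 := by field_simp
  rw [h2] at h1
  linarith

theorem kills_step {n : ℕ} {L : (En n → En n) → ℂ} (hL : IsContinuousLinearFunctional n L)
    {F : ℝ → En n → En n} (hF : IsNormalizedLoewnerChain n F) :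
    ∃ η : ℝ, 0 < η ∧ ∀ s t : ℝ, 0 ≤ s → s ≤ t → |1 - Real.exp (s - t)| ≤ η →
      KillsAt n L F t → KillsAt n L F s := by
  obtain ⟨r, hr0, hr1, C, hC, hb⟩ := clf_bound hL
  obtain ⟨η, hη, hsurj⟩ := ev_surj (n := n) (r := (1 + r) / 2) (by linarith) (by linarith)
  refine ⟨η, hη, fun s t hs hst hd hk h hh h0 hd0 => ?_⟩
  have hφ := ev_map hF hs hst
  have hφs := ev_map hF le_rfl hs
  have hφt := ev_map hF le_rfl (hs.trans hst)
  have hsub := hsurj _ _ hφ hd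
  set φ := evolution n F s t with hφdef
  set ψ := Function.invFunOn φ (Ball n) with hψ
  have hψd : DifferentiableOn ℂ ψ (φ '' Ball n) :=
    univ_inv_differentiableOn (ball_isOpen n) hφ.diff hφ.inj
  have hψ0 : ψ 0 = 0 := by
    have := hφ.inj.leftInvOn_invFunOn (zero_mem_Ball n)
    rwa [hφ.zero] at this
  have hψd0 : DifferentiableAt ℂ ψ 0 := by
    have := univ_inv_hasFDerivAt (ball_isOpen n) hφ.diff hφ.inj (zero_mem_Ball n)
    rwa [hφ.zero] at this
  have hkd : DifferentiableOn ℂ (fun z => h (ψ z)) (ball 0 ((1 + r) / 2)) :=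
    hh.comp_differentiableOn (hψd.mono hsub)
  have hkd0 : fderiv ℂ (fun z => h (ψ z)) 0 = 0 := by
    have h1 : HasFDerivAt h (0 : En n →L[ℂ] En n) (ψ 0) := by
      rw [hψ0, ← hd0]; exact (hh 0).hasFDerivAt
    have h2 := h1.comp 0 hψd0.hasFDerivAt
    rw [ContinuousLinearMap.zero_comp] at h2
    exact h2.fderiv
  have hBd : ∀ g : En n → En n, Differentiable ℂ g → ∀ u : ℝ, 0 ≤ u →
      DifferentiableOn ℂ (fun z => g (evolution n F 0 u z)) (Ball n) := fun g hg u hu =>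
    hg.comp_differentiableOn (ev_map hF le_rfl hu).diff
  refine eq_zero_of_norm_le_mul hC fun ε hε => ?_
  obtain ⟨q, hq, hq0, hqd0, hqa⟩ := holo_taylor_approx hr0 (by linarith : r < (1 + r) / 2) hkd
    (by simp only [hψ0, h0]) hkd0 hε
  have e1 : L (fun z => h (evolution n F 0 s z)) =
      L ((fun z => h (evolution n F 0 s z)) - fun z => q (evolution n F 0 t z)) := by
    rw [clf_sub hL, hk q hq hq0 hqd0, sub_zero]
  rw [e1]
  refine hb _ ((hBd h hh s hs).sub (hBd q hq t (hs.trans hst))) ε fun z hz => ?_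
  have hzB : z ∈ Ball n := closedBall_subset_Ball hr1 hz
  have hw : evolution n F 0 s z ∈ Ball n := (ev_spec hF le_rfl hs hzB).1
  have hy : φ (evolution n F 0 s z) = evolution n F 0 t z := ev_comp hF le_rfl hs hst hzB
  have hyr : evolution n F 0 t z ∈ closedBall (0 : En n) r := by
    rw [mem_closedBall_zero_iff] at hz ⊢
    exact (hφt.norm_le hzB).trans hz
  have h3 := hqa _ hyr
  have h4 : ψ (evolution n F 0 t z) = evolution n F 0 s z := by
    rw [← hy]; exact hφ.inj.leftInvOn_invFunOn hw
  rw [h4] at h3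
  exact h3

theorem kills_zero {n : ℕ} {L : (En n → En n) → ℂ} (hL : IsContinuousLinearFunctional n L)
    {F : ℝ → En n → En n} (hF : IsNormalizedLoewnerChain n F) {t : ℝ} (ht : 0 ≤ t)
    (hk : KillsAt n L F t) : KillsAt n L F 0 := by
  obtain ⟨η, hη, hstep⟩ := kills_step hL hF
  have hcont : Tendsto (fun k : ℕ => |1 - Real.exp (-(t / (k : ℝ)))|) atTop (𝓝 0) := by
    have h1 : Tendsto (fun k : ℕ => t / (k : ℝ)) atTop (𝓝 0) := tendsto_const_div_atTop_nhds_zero_nat t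
    have h2 : Continuous fun x : ℝ => |1 - Real.exp (-x)| := by fun_prop
    have := (h2.tendsto 0).comp h1
    simpa [Function.comp_def] using this
  obtain ⟨k, hkη, hk1⟩ := ((hcont.eventually (gt_mem_nhds hη)).and (eventually_ge_atTop 1)).exists
  have hkp : (0 : ℝ) < k := by exact_mod_cast hk1
  have key : ∀ j : ℕ, j ≤ k → KillsAt n L F (t - j * (t / k)) := by
    intro j
    induction j with
    | zero => intro _; simpa using hk
    | succ j ih =>
      intro hj
      have hd : 0 ≤ t / (k : ℝ) := by positivity
      have hjk : ((j : ℝ) + 1) * (t / k) ≤ t := by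
        have : ((j : ℝ) + 1) ≤ k := by exact_mod_cast hj
        calc ((j : ℝ) + 1) * (t / k) ≤ k * (t / k) := by gcongr
          _ = t := by field_simp
      refine hstep _ (t - j * (t / k)) ?_ ?_ ?_ (ih (by omega))
      · push_cast; linarith
      · push_cast; linarith
      · have : t - ((j + 1 : ℕ) : ℝ) * (t / k) - (t - j * (t / k)) = -(t / k) := by
          push_cast; ring
        rw [this]; exact hkη.le
  have := key k le_rfl
  have e : t - k * (t / k) = 0 := by field_simp; simp
  rwa [e] at this

theorem const_of_kills {n : ℕ} {L : (En n → En n) → ℂ} (hL : IsContinuousLinearFunctional n L)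
    {F : ℝ → En n → En n} (hF : IsNormalizedLoewnerChain n F) (hk : KillsAt n L F 0)
    {g : En n → En n} (hg : MemS0 n g) : L g = L (fun z => z) := by
  have hk' : ∀ h : En n → En n, Differentiable ℂ h → h 0 = 0 → fderiv ℂ h 0 = 0 → L h = 0 := by
    intro h hh h0 hd0
    rw [← hk h hh h0 hd0]
    refine clf_congr hL hh.differentiableOn
      (hh.comp_differentiableOn (ev_map hF le_rfl le_rfl).diff) fun z hz => ?_
    simp only [ev_self hF le_rfl hz]
  obtain ⟨⟨⟨hgd, -⟩, hg0, hgd0⟩, -⟩ := hg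
  obtain ⟨r, hr0, hr1, C, hC, hb⟩ := clf_bound hL
  have hgat : DifferentiableAt ℂ g 0 := hgd.differentiableAt ((ball_isOpen n).mem_nhds (zero_mem_Ball n))
  have hsubd : DifferentiableOn ℂ (g - fun z => z) (Ball n) := hgd.sub differentiableOn_id
  have hfd : fderiv ℂ (g - fun z => z) 0 = 0 := by
    have h1 := hgat.hasFDerivAt.sub (hasFDerivAt_id (𝕜 := ℂ) (0 : En n))
    rw [hgd0, sub_self] at h1
    exact h1.fderiv
  rw [← sub_eq_zero, ← clf_sub hL]
  refine eq_zero_of_norm_le_mul hC fun ε hε => ?_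
  obtain ⟨q, hq, hq0, hqd0, hqa⟩ := holo_taylor_approx hr0 hr1 hsubd (by simp [hg0]) hfd hε
  have e1 : L (g - fun z => z) = L ((g - fun z => z) - q) := by
    rw [clf_sub hL _ q, hk' q hq hq0 hqd0, sub_zero]
  rw [e1]
  exact hb _ (hsubd.sub hq.differentiableOn) ε hqa

end

/-- If f is a support point of S⁰(𝔹ₙ) and (f_t) is a normalized Loewner chain
with f₀ = f such that {e^{−t} f_t} is a normal family, then e^{−t}·f_t is a
support point of S⁰(𝔹ₙ) for every t ≥ 0. -/
theorem isSupportPoint_along_chain (n : ℕ) (f : En n → En n)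
    (F : ℝ → En n → En n) (hF : IsNormalizedLoewnerChain n F)
    (hN : IsNormalFamilyChain n F) (h0 : F 0 = f)
    (hf : IsSupportPoint n {g | MemS0 n g} f) :
    ∀ t : ℝ, 0 ≤ t →
      IsSupportPoint n {g | MemS0 n g} (fun z => (Real.exp (-t) : ℂ) • F t z) := by
  intro t ht
  obtain ⟨-, L, hL, ⟨g₁, hg₁, g₂, hg₂, hne⟩, hmax⟩ := hf
  have hφ := ev_map hF le_rfl ht
  have het : (Real.exp t : ℂ) ≠ 0 := by exact_mod_cast (Real.exp_pos t).ne'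
  have hform : ∀ g : En n → En n, (Real.exp t : ℂ) * L (fun z => g (evolution n F 0 t z)) =
      L (fun z => (Real.exp t : ℂ) • g (evolution n F 0 t z)) := fun g =>
    (hL.2.1 _ (fun z => g (evolution n F 0 t z))).symm
  have hL' := clf_comp hL hφ (Real.exp t : ℂ)
  have hval : (Real.exp t : ℂ) *
      L (fun z => (Real.exp (-t) : ℂ) • F t (evolution n F 0 t z)) = L f := by
    rw [hform (fun z => (Real.exp (-t) : ℂ) • F t z)]
    have hdt := (memS0_transport hF ht (memS0_shift hF hN ht)).1.1.1
    refine clf_congr hL hdt (h0 ▸ (hF.1.1 0 le_rfl).1) fun z hz => ?_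
    simp only [(ev_spec hF le_rfl ht hz).2, smul_smul, h0]
    rw [← Complex.ofReal_mul, ← Real.exp_add]
    simp
  refine ⟨memS0_shift hF hN ht, _, hL', ?_, ?_⟩
  · by_contra hcon
    push Not at hcon
    have hk : KillsAt n L F t := by
      intro h hh hh0 hd0
      have := clf_kill_entire hL' (fun a ha b hb => hcon a ha b hb) hh hh0 hd0
      exact (mul_eq_zero.1 this).resolve_left het
    have hk0 := kills_zero hL hF ht hk
    exact hne (by rw [const_of_kills hL hF hk0 hg₁, const_of_kills hL hF hk0 hg₂])
  · intro g hg
    simp only [hval]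
    rw [hform g]
    exact hmax _ (memS0_transport hF ht hg)

end
end

section
/- Let f be an extreme point of S⁰(𝔹ₙ) and let (f_t)_{t≥0} be a normalized Loewner chain with f₀ = f such that {e^{−t} f_t : t ≥ 0} is a normal family on 𝔹ₙ. Then e^{−t}·f_t is an extreme point of S⁰(𝔹ₙ) for every t ≥ 0. -/
open Metric Filter Set MeasureTheory

noncomputable section

/-- f is an extreme point of A: f ∈ A and any representation
f = s·a + (1−s)·b on 𝔹ₙ with a, b ∈ A and s ∈ (0,1) forces a = b on 𝔹ₙ. -/
def IsExtremePointOf (n : ℕ) (A : Set (En n → En n)) (f : En n → En n) : Prop :=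
  f ∈ A ∧ ∀ a ∈ A, ∀ b ∈ A, ∀ s : ℝ, 0 < s → s < 1 →
    Set.EqOn f (fun z => s • a z + (1 - s) • b z) (Ball n) → Set.EqOn a b (Ball n)

namespace Osg
set_option linter.unusedSectionVars false
open scoped Topology

variable {E F : Type} [NormedAddCommGroup E] [NormedSpace ℂ E] [FiniteDimensional ℂ E]
  [NormedAddCommGroup F] [NormedSpace ℂ F] [FiniteDimensional ℂ F]


/-- Continuity of the derivative of a holomorphic map. -/
lemma continuousOn_fderiv {f : E → F} {U : Set E} (hU : IsOpen U) (hf : DifferentiableOn ℂ f U) :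
    ContinuousOn (fderiv ℂ f) U := by
  intro p hp
  apply ContinuousAt.continuousWithinAt
  have hfc : ContinuousAt f p := (hf.differentiableAt (hU.mem_nhds hp)).continuousAt
  have h1 : ∀ᶠ z in 𝓝 p, z ∈ U ∧ dist (f z) (f p) < 1 :=
    Filter.Eventually.and (hU.mem_nhds hp) (Metric.tendsto_nhds.1 hfc 1 one_pos)
  obtain ⟨R, hR, hRb⟩ := Metric.eventually_nhds_iff_ball.1 h1
  set r := R / 4 with hr
  have hr0 : 0 < r := by positivity
  have hb : ∀ x ∈ ball p (2 * r), ‖fderiv ℂ f x‖ ≤ 1 / r := by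
    intro x hx
    have hsub : ball x (2 * r) ⊆ ball p R := by
      apply ball_subset_ball'
      rw [mem_ball] at hx; linarith
    have := Complex.norm_fderiv_le_div_of_mapsTo_ball (f := f) (c := x) (R₁ := 2 * r) (R₂ := 2)
      (hf.mono fun z hz => (hRb z (hsub hz)).1) (fun z hz => by
        rw [mem_closedBall]
        have a1 := (hRb z (hsub hz)).2
        have a2 := (hRb x (hsub (mem_ball_self (by positivity)))).2
        have := dist_triangle_right (f z) (f x) (f p)
        linarith) (by positivity)
    refine this.trans (le_of_eq ?_)
    field_simp
  have hlip : ∀ x ∈ ball p (2 * r), ∀ y ∈ ball p (2 * r), ‖f y - f x‖ ≤ 1 / r * ‖y - x‖ := by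
    intro x hx y hy
    refine (convex_ball p (2 * r)).norm_image_sub_le_of_norm_fderiv_le (𝕜 := ℂ) (fun z hz => ?_) hb hx hy
    apply hf.differentiableAt (hU.mem_nhds (hRb z _).1)
    exact ball_subset_ball (by linarith) hz
  have key : ∀ x ∈ ball p r, ‖fderiv ℂ f x - fderiv ℂ f p‖ ≤ (2 / r ^ 2) * ‖x - p‖ := by
    intro x hx
    have hxn : ‖x - p‖ < r := by simpa [dist_eq_norm] using hx
    have hadd : ∀ z ∈ ball p r, z + (x - p) ∈ ball p (2 * r) := by
      intro z hz
      rw [mem_ball, dist_eq_norm] at hz ⊢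
      calc ‖z + (x - p) - p‖ = ‖(z - p) + (x - p)‖ := by congr 1; abel
        _ ≤ ‖z - p‖ + ‖x - p‖ := norm_add_le _ _
        _ < 2 * r := by linarith
    have hD : ∀ z ∈ ball p (2 * r), DifferentiableAt ℂ f z := fun z hz =>
      hf.differentiableAt (hU.mem_nhds (hRb z (ball_subset_ball (by linarith) hz)).1)
    have hs : ball p r ⊆ ball p (2 * r) := ball_subset_ball (by linarith)
    have hval : ∀ z ∈ ball p r, ‖f (z + (x - p)) - f z‖ ≤ 1 / r * ‖x - p‖ := by
      intro z hz
      have := hlip z (hs hz) _ (hadd z hz)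
      simpa using this
    have h2 := Complex.norm_fderiv_le_div_of_mapsTo_ball (f := fun z => f (z + (x - p)) - f z)
      (c := p) (R₁ := r) (R₂ := 2 * (1 / r * ‖x - p‖))
      (fun z hz => (((hD _ (hadd z hz)).comp z (by fun_prop : DifferentiableAt ℂ (fun z => z + (x - p)) z)).sub
        (hD z (hs hz))).differentiableWithinAt) (fun z hz => by
        rw [mem_closedBall, dist_eq_norm]
        have a1 := hval z hz
        have a2 := hval p (mem_ball_self hr0)
        refine (norm_sub_le _ _).trans ?_
        linarith) hr0
    have h3 : fderiv ℂ (fun z => f (z + (x - p)) - f z) p = fderiv ℂ f x - fderiv ℂ f p := by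
      rw [fderiv_fun_sub]
      · rw [fderiv_comp_add_right]; simp
      · exact (hD _ (hadd p (mem_ball_self hr0))).comp p (by fun_prop : DifferentiableAt ℂ (fun z => z + (x - p)) p)
      · exact hD p (mem_ball_self (by positivity))
    rw [h3] at h2
    refine h2.trans (le_of_eq ?_)
    field_simp
  rw [ContinuousAt, tendsto_iff_norm_sub_tendsto_zero]
  refine squeeze_zero' (Eventually.of_forall fun _ => norm_nonneg _)
    (Filter.mem_of_superset (ball_mem_nhds p hr0) key) ?_
  have : Tendsto (fun x => (2 / r ^ 2) * ‖x - p‖) (𝓝 p) (𝓝 ((2 / r ^ 2) * ‖p - p‖)) := by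
    apply Continuous.tendsto; fun_prop
  simpa using this

lemma contDiffOn_one {f : E → F} {U : Set E} (hU : IsOpen U) (hf : DifferentiableOn ℂ f U) :
    ContDiffOn ℂ 1 f U := by
  rw [show (1 : WithTop ℕ∞) = 0 + 1 by simp, contDiffOn_succ_iff_fderiv_of_isOpen hU]
  exact ⟨hf, by simp, contDiffOn_zero.2 (continuousOn_fderiv hU hf)⟩

lemma hasStrict {f : E → F} {U : Set E} (hU : IsOpen U) (hf : DifferentiableOn ℂ f U) {p : E}
    (hp : p ∈ U) : HasStrictFDerivAt f (fderiv ℂ f p) p :=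
  ((contDiffOn_one hU hf).contDiffAt (hU.mem_nhds hp)).hasStrictFDerivAt one_ne_zero

/-- Directional derivatives of holomorphic maps are holomorphic. -/
lemma differentiableOn_dir {f : E → F} {U : Set E} (hU : IsOpen U) (hf : DifferentiableOn ℂ f U)
    (v : E) : DifferentiableOn ℂ (fun z => fderiv ℂ f z v) U := by
  intro p hp
  apply DifferentiableAt.differentiableWithinAt
  obtain ⟨R₀, hR₀, hRU⟩ := Metric.isOpen_iff.1 hU p hp
  set R := R₀ / 4 with hR
  have hR0 : 0 < R := by positivity
  have hK : closedBall p (2 * R) ⊆ U := (closedBall_subset_ball (by linarith)).trans hRU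
  have hcf := continuousOn_fderiv hU hf
  obtain ⟨C, hC⟩ := (isCompact_closedBall p (2 * R)).exists_bound_of_continuousOn (hcf.mono hK)
  set ρ := R / (‖v‖ + 1) with hρ
  have hρ0 : 0 < ρ := by positivity
  have hρv : ρ * ‖v‖ ≤ R := by
    rw [hρ, div_mul_eq_mul_div, div_le_iff₀ (by positivity)]
    nlinarith [norm_nonneg v]
  have hin : ∀ x ∈ ball p R, ∀ ζ : ℂ, ‖ζ‖ ≤ ρ → x + ζ • v ∈ closedBall p (2 * R) := by
    intro x hx ζ hζ
    rw [mem_ball, dist_eq_norm] at hx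
    rw [mem_closedBall, dist_eq_norm]
    calc ‖x + ζ • v - p‖ = ‖(x - p) + ζ • v‖ := by congr 1; abel
      _ ≤ ‖x - p‖ + ‖ζ‖ * ‖v‖ := (norm_add_le _ _).trans (by rw [norm_smul])
      _ ≤ R + ρ * ‖v‖ := by gcongr
      _ ≤ 2 * R := by linarith
  have hdz : ∀ x ∈ ball p R, ∀ ζ : ℂ, ‖ζ‖ ≤ ρ → DifferentiableAt ℂ f (x + ζ • v) :=
    fun x hx ζ hζ => hf.differentiableAt (hU.mem_nhds (hK (hin x hx ζ hζ)))
  set Φ : E → ℝ → F := fun x θ => deriv (circleMap 0 ρ) θ •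
    (((circleMap 0 ρ θ - 0) ^ 2)⁻¹ • f (x + circleMap 0 ρ θ • v)) with hΦ
  set Φ' : E → ℝ → E →L[ℂ] F := fun x θ => deriv (circleMap 0 ρ) θ •
    (((circleMap 0 ρ θ - 0) ^ 2)⁻¹ • fderiv ℂ f (x + circleMap 0 ρ θ • v)) with hΦ'
  have hnc : ∀ θ, ‖circleMap 0 ρ θ‖ = ρ := fun θ => by simp [abs_of_pos hρ0]
  have hne : ∀ θ, circleMap 0 ρ θ ≠ 0 := fun θ => by
    rw [← norm_pos_iff, hnc]; exact hρ0
  have hcd : Continuous (deriv (circleMap 0 ρ)) := by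
    have : deriv (circleMap 0 ρ) = fun θ => circleMap 0 ρ θ * Complex.I := by
      ext θ; simp
    rw [this]; fun_prop
  have hpre : Continuous (fun θ => ((circleMap 0 ρ θ - 0) ^ 2)⁻¹) := by
    apply Continuous.inv₀ (by fun_prop)
    intro θ; simpa using hne θ
  have hΦc : ∀ x ∈ ball p R, Continuous (Φ x) := by
    intro x hx
    refine hcd.smul (hpre.smul ?_)
    refine (hf.continuousOn.mono hK).comp_continuous (by fun_prop) fun θ => hin x hx _ (hnc θ).le
  have hΦ'c : ∀ x ∈ ball p R, Continuous (Φ' x) := by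
    intro x hx
    refine hcd.smul (hpre.smul ?_)
    refine (hcf.mono hK).comp_continuous (by fun_prop) fun θ => hin x hx _ (hnc θ).le
  have hpb : p ∈ ball p R := mem_ball_self hR0
  have main := intervalIntegral.hasFDerivAt_integral_of_dominated_of_fderiv_le (𝕜 := ℂ)
    (μ := volume) (a := 0) (b := 2 * Real.pi) (F := Φ) (F' := Φ') (x₀ := p) (s := ball p R)
    (bound := fun _ => ρ * ((ρ ^ 2)⁻¹ * C)) (ball_mem_nhds p hR0)
    (Filter.mem_of_superset (ball_mem_nhds p hR0) fun x hx => (hΦc x hx).aestronglyMeasurable)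
    ((hΦc p hpb).intervalIntegrable _ _)
    (hΦ'c p hpb).aestronglyMeasurable
    (Eventually.of_forall fun θ _ x hx => by
      simp only [hΦ', norm_smul, norm_inv, norm_pow, sub_zero, hnc, deriv_circleMap, norm_mul,
        Complex.norm_I, mul_one]
      gcongr
      exact hC _ (hin x hx _ (hnc θ).le))
    (by simp)
    (Eventually.of_forall fun θ _ x hx => by
      have h1 := (hdz x hx _ (hnc θ).le).hasFDerivAt.comp x
        ((hasFDerivAt_id x).add_const (circleMap 0 ρ θ • v))
      simp only [ContinuousLinearMap.comp_id] at h1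
      exact (h1.const_smul _).const_smul _)
  have hrepr : ∀ x ∈ ball p R, fderiv ℂ f x v = (2 * Real.pi * Complex.I : ℂ)⁻¹ •
      ∫ θ in (0:ℝ)..2 * Real.pi, Φ x θ := by
    intro x hx
    set V : Set ℂ := (fun ζ : ℂ => x + ζ • v) ⁻¹' U
    have hV : IsOpen V := hU.preimage (by fun_prop)
    have h1 := Complex.two_pi_I_inv_smul_circleIntegral_sub_sq_inv_smul_of_differentiable
      hV (c := 0) (w₀ := 0) (R := ρ) (f := fun ζ : ℂ => f (x + ζ • v))
      (fun ζ hζ => hK (hin x hx ζ (by simpa using hζ)))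
      (fun ζ hζ => ((hf.differentiableAt (hU.mem_nhds hζ)).comp ζ
        (by fun_prop : DifferentiableAt ℂ (fun ζ : ℂ => x + ζ • v) ζ)).differentiableWithinAt)
      (mem_ball_self hρ0)
    have h2 : deriv (fun ζ : ℂ => f (x + ζ • v)) 0 = fderiv ℂ f x v := by
      have hd := hdz x hx 0 (by simpa using hρ0.le)
      have h3 : HasDerivAt (fun ζ : ℂ => x + ζ • v) v 0 := by
        simpa using ((hasDerivAt_id (0:ℂ)).smul_const v).const_add x
      have := hd.hasFDerivAt.comp_hasDerivAt (0:ℂ) h3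
      simpa [Function.comp_def] using this.deriv
    rw [← h2, ← h1]
    rfl
  have : (fun z => fderiv ℂ f z v) =ᶠ[𝓝 p] fun x => (2 * Real.pi * Complex.I : ℂ)⁻¹ •
      ∫ θ in (0:ℝ)..2 * Real.pi, Φ x θ :=
    Filter.mem_of_superset (ball_mem_nhds p hR0) hrepr
  exact ((main.const_smul _).congr_of_eventuallyEq this).differentiableAt

/-- A map `Ψ` straightening the level sets of `g` near a non-critical point. -/
lemma straighten {g : E → ℂ} {U : Set E} (hU : IsOpen U) (hg : DifferentiableOn ℂ g U) {q : E}
    (hq : q ∈ U) {u : E} (hu : fderiv ℂ g q u = 1) :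
    ∃ (Ψ : E → E) (ε : ℝ), 0 < ε ∧ DifferentiableOn ℂ Ψ (ball 0 ε) ∧ Ψ 0 = q ∧
      InjOn Ψ (ball 0 ε) ∧ HasFDerivAt Ψ (ContinuousLinearMap.id ℂ E) 0 ∧
      ∀ k ∈ ball (0 : E) ε, Ψ k ∈ U ∧ g (Ψ k) = g q + fderiv ℂ g q k := by
  set l := fderiv ℂ g q with hl
  set Φ : E → E := fun z => (z - q) + (g z - g q - l (z - q)) • u with hΦ
  have hgd : ContDiffAt ℂ 1 g q := (contDiffOn_one hU hg).contDiffAt (hU.mem_nhds hq)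
  have hΦc : ContDiffAt ℂ 1 Φ q := by
    apply ContDiffAt.add (by fun_prop)
    apply ContDiffAt.smul _ (by fun_prop)
    apply ContDiffAt.sub (by fun_prop) (by fun_prop)
  have hΦq : Φ q = 0 := by simp [hΦ]
  have hgl : HasFDerivAt g l q := (hg.differentiableAt (hU.mem_nhds hq)).hasFDerivAt
  have hd : HasFDerivAt Φ ((ContinuousLinearEquiv.refl ℂ E : E ≃L[ℂ] E) : E →L[ℂ] E) q := by
    have h1 : HasFDerivAt (fun z : E => z - q) (ContinuousLinearMap.id ℂ E) q :=
      (hasFDerivAt_id q).sub_const q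
    have h2 : HasFDerivAt (fun z => l (z - q)) l q := by
      have := HasFDerivAt.comp (g := l) (f := fun z : E => z - q) q (l.hasFDerivAt) h1
      exact this
    have h3 := h1.add (((hgl.sub_const (g q)).sub h2).smul_const u)
    have h4 : ((ContinuousLinearEquiv.refl ℂ E : E ≃L[ℂ] E) : E →L[ℂ] E) =
        ContinuousLinearMap.id ℂ E + (l - l).smulRight u := by
      ext x; simp
    rw [h4]
    exact h3
  have hne : (1 : WithTop ℕ∞) ≠ 0 := one_ne_zero
  set Ψ := hΦc.localInverse hd hne with hΨ
  have hst := hΦc.hasStrictFDerivAt' hd hne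
  have hΨc : ContDiffAt ℂ 1 Ψ 0 := by
    have := hΦc.to_localInverse hd hne
    rwa [hΦq] at this
  have hΨ0 : Ψ 0 = q := by
    have := hΦc.localInverse_apply_image hd hne
    rwa [hΦq] at this
  have hright : ∀ᶠ y in 𝓝 (0 : E), Φ (Ψ y) = y := by
    have := hst.eventually_right_inverse
    rw [hΦq] at this
    exact this
  have hΨd : HasFDerivAt Ψ (ContinuousLinearMap.id ℂ E) 0 := by
    have := hst.to_localInverse.hasFDerivAt
    rw [hΦq] at this
    exact this
  have hU' : ∀ᶠ y in 𝓝 (0 : E), Ψ y ∈ U := by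
    apply hΨc.continuousAt.eventually_mem
    rw [hΨ0]; exact hU.mem_nhds hq
  have hcd : ∀ᶠ y in 𝓝 (0 : E), ContDiffAt ℂ 1 Ψ y := hΨc.eventually (by simp)
  obtain ⟨ε, hε, hb⟩ := Metric.eventually_nhds_iff_ball.1 (hright.and (hU'.and hcd))
  refine ⟨Ψ, ε, hε, fun y hy => ((hb y hy).2.2.differentiableAt hne).differentiableWithinAt, hΨ0,
    fun x hx y hy hxy => ?_, hΨd, fun k hk => ⟨(hb k hk).2.1, ?_⟩⟩
  · rw [← (hb x hx).1, ← (hb y hy).1, hxy]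
  · have h1 := congrArg l (hb k hk).1
    simp only [hΦ, map_add, map_smul, hu, smul_eq_mul, mul_one] at h1
    rw [← h1]; ring

/-- One variable: injective holomorphic functions have nonvanishing derivative. -/
lemma one_var {h : ℂ → ℂ} {U : Set ℂ} (hU : IsOpen U) (hh : DifferentiableOn ℂ h U)
    (hi : InjOn h U) {p : ℂ} (hp : p ∈ U) : deriv h p ≠ 0 := by
  intro h0
  have han : AnalyticAt ℂ h p := hh.analyticAt (hU.mem_nhds hp)
  have hnc : ¬ ∀ᶠ z in 𝓝 p, h z = h p := by
    intro hc
    have h1 : ∀ᶠ z in 𝓝 p, z = p := by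
      filter_upwards [hc, hU.mem_nhds hp] with z hz hzU using hi hzU hp hz
    have h2 : ∀ᶠ z in 𝓝[≠] p, z = p := nhdsWithin_le_nhds h1
    have h3 : ∀ᶠ z in 𝓝[≠] p, z ≠ p := eventually_mem_nhdsWithin
    obtain ⟨z, hz, hz'⟩ := (h2.and h3).exists
    exact hz' hz
  have hopen : ∀ z ∈ U, (¬ ∀ᶠ w in 𝓝 z, h w = h z) → 𝓝 (h z) ≤ map h (𝓝 z) := fun z hz hzn =>
    ((hh.analyticAt (hU.mem_nhds hz)).eventually_constant_or_nhds_le_map_nhds).resolve_left hzn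
  have hd : ∀ᶠ z in 𝓝[≠] p, deriv h z ≠ 0 := by
    rcases han.deriv.eventually_eq_zero_or_eventually_ne_zero with h1 | h1
    · exfalso
      apply hnc
      obtain ⟨ε, hε, hb⟩ := Metric.eventually_nhds_iff_ball.1
        (Filter.Eventually.and h1 (hU.mem_nhds hp))
      refine Filter.mem_of_superset (ball_mem_nhds p hε) fun z hz => ?_
      refine (convex_ball p ε).is_const_of_fderivWithin_eq_zero (𝕜 := ℂ)
        (hh.mono fun w hw => (hb w hw).2) (fun w hw => ?_) hz (mem_ball_self hε)
      rw [fderivWithin_of_isOpen isOpen_ball hw]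
      ext
      simpa using (hb w hw).1
    · exact h1
  have hd' : ∀ᶠ z in 𝓝 p, z ≠ p → deriv h z ≠ 0 := eventually_nhdsWithin_iff.1 hd
  obtain ⟨ε, hε, hb⟩ := Metric.eventually_nhds_iff_ball.1
    (Filter.Eventually.and hd' (hU.mem_nhds hp))
  set B := ball p ε
  have hBU : B ⊆ U := fun w hw => (hb w hw).2
  set g := Function.invFunOn h B with hg
  have hgl : ∀ z ∈ B, g (h z) = z := fun z hz => (hi.mono hBU).leftInvOn_invFunOn hz
  have hpB : p ∈ B := mem_ball_self hε
  have hgev : ∀ z ∈ B, ∀ᶠ w in 𝓝 z, g (h w) = w := fun z hz =>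
    Filter.mem_of_superset (isOpen_ball.mem_nhds hz) hgl
  have hgc : ContinuousAt g (h p) := by
    have h1 : Tendsto g (map h (𝓝 p)) (𝓝 p) := by
      rw [tendsto_map'_iff]
      exact tendsto_id.congr' ((hgev p hpB).mono fun w hw => hw.symm)
    have := h1.mono_left (hopen p hp hnc)
    rwa [ContinuousAt, hgl p hpB]
  have hW : h '' B ∈ 𝓝 (h p) := hopen p hp hnc (image_mem_map (isOpen_ball.mem_nhds hpB))
  have hgd : DifferentiableOn ℂ g (h '' B \ {h p}) := by
    rintro _ ⟨⟨z, hz, rfl⟩, hzp⟩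
    have hzp' : z ≠ p := by rintro rfl; exact hzp rfl
    have hs := (hh.analyticAt (hU.mem_nhds (hBU hz))).hasStrictDerivAt
    exact (hs.to_local_left_inverse ((hb z hz).1 hzp') (hgev z hz)).hasDerivAt.differentiableAt.differentiableWithinAt
  have hgd' := ((Complex.differentiableOn_compl_singleton_and_continuousAt_iff hW).1 ⟨hgd, hgc⟩).differentiableAt hW
  have h1 : HasDerivAt (g ∘ h) (deriv g (h p) * deriv h p) p :=
    hgd'.hasDerivAt.comp p han.differentiableAt.hasDerivAt
  have h2 : HasDerivAt (g ∘ h) 1 p :=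
    (hasDerivAt_id p).congr_of_eventuallyEq (hgev p hpB)
  have := h1.unique h2
  rw [h0] at this
  simp at this

/-- Iterated directional derivatives. -/
def dirIter (J : E → ℂ) (v : E) : ℕ → E → ℂ
  | 0 => J
  | k + 1 => fun z => fderiv ℂ (dirIter J v k) z v

lemma dirIter_diff {J : E → ℂ} {U : Set E} (hU : IsOpen U) (hJ : DifferentiableOn ℂ J U) (v : E)
    (k : ℕ) : DifferentiableOn ℂ (dirIter J v k) U := by
  induction k with
  | zero => exact hJ
  | succ k ih => exact differentiableOn_dir hU ih v

lemma dirIter_line {J : E → ℂ} {U : Set E} (hU : IsOpen U) (hJ : DifferentiableOn ℂ J U) (p v : E)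
    (k : ℕ) : ∀ ζ : ℂ, p + ζ • v ∈ U →
      iteratedDeriv k (fun ζ : ℂ => J (p + ζ • v)) ζ = dirIter J v k (p + ζ • v) := by
  induction k with
  | zero => intro ζ _; simp [dirIter]
  | succ k ih =>
    intro ζ hζ
    rw [iteratedDeriv_succ]
    have hV : IsOpen ((fun ζ : ℂ => p + ζ • v) ⁻¹' U) := hU.preimage (by fun_prop)
    have h1 : iteratedDeriv k (fun ζ : ℂ => J (p + ζ • v)) =ᶠ[𝓝 ζ]
        fun ζ => dirIter J v k (p + ζ • v) :=
      Filter.mem_of_superset (hV.mem_nhds hζ) ih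
    rw [h1.deriv_eq]
    have h3 : HasDerivAt (fun ζ : ℂ => p + ζ • v) v ζ := by
      simpa using ((hasDerivAt_id ζ).smul_const v).const_add p
    have := ((dirIter_diff hU hJ v k).differentiableAt (hU.mem_nhds hζ)).hasFDerivAt.comp_hasDerivAt
      ζ h3
    exact this.deriv

lemma exists_simple {J : E → ℂ} {U : Set E} (hU : IsOpen U) (hJ : DifferentiableOn ℂ J U) {p : E}
    (hp : p ∈ U) (hJp : J p = 0) (hne : ¬ ∀ᶠ z in 𝓝 p, J z = 0) :
    ∃ q ∈ U, J q = 0 ∧ ∃ (g : E → ℂ) (v : E), DifferentiableOn ℂ g U ∧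
      (∀ z ∈ U, J z = 0 → g z = 0) ∧ fderiv ℂ g q v ≠ 0 := by
  obtain ⟨r, hr, hrU⟩ := Metric.isOpen_iff.1 hU p hp
  have hq' : ∃ q' ∈ ball p r, J q' ≠ 0 := by
    by_contra! hcon
    exact hne (Filter.mem_of_superset (ball_mem_nhds p hr) hcon)
  obtain ⟨q', hq', hJq'⟩ := hq'
  set v := q' - p with hv
  have hv0 : v ≠ 0 := by
    intro h0
    apply hJq'
    rw [sub_eq_zero.1 h0, hJp]
  have hvpos : 0 < ‖v‖ := norm_pos_iff.2 hv0
  have hvr : ‖v‖ < r := by simpa [dist_eq_norm] using hq'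
  have hex : ∃ k, ∃ z ∈ U, J z = 0 ∧ dirIter J v k z ≠ 0 := by
    by_contra! hcon
    apply hJq'
    have hmem : ∀ ζ ∈ ball (0 : ℂ) (r / ‖v‖), p + ζ • v ∈ U := by
      intro ζ hζ
      apply hrU
      rw [mem_ball_zero_iff, lt_div_iff₀ hvpos] at hζ
      simpa [dist_eq_norm, norm_smul] using hζ
    have h1 := Complex.hasSum_taylorSeries_on_ball (f := fun ζ : ℂ => J (p + ζ • v)) (c := 0)
      (r := r / ‖v‖) (z := 1) (fun ζ hζ => ((hJ.differentiableAt (hU.mem_nhds (hmem ζ hζ))).comp ζ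
        (by fun_prop : DifferentiableAt ℂ (fun ζ : ℂ => p + ζ • v) ζ)).differentiableWithinAt)
      (by rw [mem_ball_zero_iff, lt_div_iff₀ hvpos]; simpa using hvr)
    have h2 : ∀ k, iteratedDeriv k (fun ζ : ℂ => J (p + ζ • v)) 0 = 0 := by
      intro k
      rw [dirIter_line hU hJ p v k 0 (by simpa using hp)]
      simpa using hcon k p hp hJp
    simp only [h2, smul_zero, one_smul] at h1
    have := h1.unique hasSum_zero
    simpa [hv] using this
  classical
  set m := Nat.find hex with hm
  obtain ⟨q, hq, hJq, hmq⟩ := Nat.find_spec hex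
  rw [← hm] at hmq
  obtain ⟨k, hk⟩ : ∃ k, m = k + 1 := by
    apply Nat.exists_eq_succ_of_ne_zero
    intro h0
    rw [h0] at hmq
    exact hmq hJq
  refine ⟨q, hq, hJq, dirIter J v k, v, dirIter_diff hU hJ v k, fun z hz hJz => ?_, ?_⟩
  · by_contra hcon
    exact Nat.find_min hex (m := k) (by omega) ⟨z, hz, hJz, hcon⟩
  · rw [hk] at hmq
    exact hmq

lemma zero_set_param {J : E → ℂ} {U : Set E} (hU : IsOpen U) (hJ : DifferentiableOn ℂ J U) {p : E}
    (hp : p ∈ U) (hJp : J p = 0) (hne : ¬ ∀ᶠ z in 𝓝 p, J z = 0) :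
    ∃ (Ψ : E → E) (ε : ℝ) (l : E →L[ℂ] ℂ), 0 < ε ∧ DifferentiableOn ℂ Ψ (ball 0 ε) ∧
      InjOn Ψ (ball 0 ε) ∧ ∀ k ∈ ball (0 : E) ε, Ψ k ∈ U ∧ (l k = 0 → J (Ψ k) = 0) := by
  obtain ⟨q, hq, hJq, g, v, hg, hgJ, hgv⟩ := exists_simple hU hJ hp hJp hne
  set l := fderiv ℂ g q with hl
  set u := (l v)⁻¹ • v with hu
  have hlu : l u = 1 := by simp [hu, hgv]
  obtain ⟨Ψ, ε, hε, hΨd, hΨ0, hΨi, -, hΨ⟩ := straighten hU hg hq (u := u) hlu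
  have hgq : g q = 0 := hgJ q hq hJq
  set ρ := ε / (2 * (‖u‖ + 1)) with hρ
  have hρ0 : 0 < ρ := by positivity
  have hρu : ρ * ‖u‖ ≤ ε / 2 := by
    rw [hρ, div_mul_eq_mul_div, div_le_div_iff₀ (by positivity) (by positivity)]
    nlinarith [norm_nonneg u]
  have hin : ∀ k ∈ ball (0 : E) (ε / 2), ∀ ζ : ℂ, ‖ζ‖ ≤ ρ → k + ζ • u ∈ ball (0 : E) ε := by
    intro k hk ζ hζ
    rw [mem_ball_zero_iff] at hk ⊢
    calc ‖k + ζ • u‖ ≤ ‖k‖ + ‖ζ‖ * ‖u‖ := (norm_add_le _ _).trans (by rw [norm_smul])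
      _ ≤ ‖k‖ + ρ * ‖u‖ := by gcongr
      _ < ε := by linarith
  have hJΨ : DifferentiableOn ℂ (fun y => J (Ψ y)) (ball 0 ε) :=
    hJ.comp hΨd fun y hy => (hΨ y hy).1
  have h0 : (0 : E) ∈ ball (0 : E) (ε / 2) := mem_ball_self (by positivity)
  have hnz : ∀ k ∈ ball (0 : E) (ε / 2), l k = 0 → ∀ ζ : ℂ, ‖ζ‖ ≤ ρ → ζ ≠ 0 →
      J (Ψ (k + ζ • u)) ≠ 0 := by
    intro k hk hlk ζ hζ hζ0 hcon
    have h1 := hΨ _ (hin k hk ζ hζ)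
    have h2 := hgJ _ h1.1 hcon
    rw [h1.2, hgq, ← hl] at h2
    apply hζ0
    simpa [hlk, hlu] using h2
  have hcont0 : ContinuousOn (fun ζ : ℂ => ‖J (Ψ ((0 : E) + ζ • u))‖) (sphere (0:ℂ) ρ) := by
    apply ContinuousOn.norm
    refine hJΨ.continuousOn.comp (by fun_prop) fun ζ hζ => hin 0 h0 ζ ?_
    exact (mem_sphere_zero_iff_norm.1 hζ).le
  obtain ⟨ζ₀, hζ₀, hmin⟩ := (isCompact_sphere (0 : ℂ) ρ).exists_isMinOn
    (NormedSpace.sphere_nonempty.2 hρ0.le) hcont0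
  set δ := ‖J (Ψ ((0 : E) + ζ₀ • u))‖ with hδ
  have hζ₀n : ‖ζ₀‖ = ρ := mem_sphere_zero_iff_norm.1 hζ₀
  have hδ0 : 0 < δ := norm_pos_iff.2 (hnz 0 h0 (map_zero l) ζ₀ hζ₀n.le
    (by rw [← norm_pos_iff, hζ₀n]; exact hρ0))
  have hev1 : ∀ᶠ k in 𝓝 (0 : E), ∀ ζ ∈ sphere (0 : ℂ) ρ, δ / 2 < ‖J (Ψ (k + ζ • u))‖ := by
    apply (isCompact_sphere (0 : ℂ) ρ).eventually_forall_of_forall_eventually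
    intro ζ hζ
    have hζn : ‖ζ‖ = ρ := mem_sphere_zero_iff_norm.1 hζ
    have hc : ContinuousAt (fun y => J (Ψ y)) (0 + ζ • u) :=
      hJΨ.continuousOn.continuousAt (isOpen_ball.mem_nhds (hin 0 h0 ζ hζn.le))
    have hc2 : ContinuousAt (fun z : E × ℂ => ‖J (Ψ (z.1 + z.2 • u))‖) (0, ζ) := by
      apply ContinuousAt.norm
      exact ContinuousAt.comp (f := fun z : E × ℂ => z.1 + z.2 • u) (x := (0, ζ)) hc (by fun_prop)
    apply hc2.eventually (lt_mem_nhds _)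
    have : δ ≤ ‖J (Ψ (0 + ζ • u))‖ := hmin hζ
    exact lt_of_lt_of_le (by linarith) this
  have hev2 : ∀ᶠ k in 𝓝 (0 : E), ‖J (Ψ k)‖ < δ / 2 := by
    have hc : ContinuousAt (fun y => ‖J (Ψ y)‖) 0 :=
      (hJΨ.continuousOn.continuousAt (isOpen_ball.mem_nhds (mem_ball_self hε))).norm
    apply hc.eventually (gt_mem_nhds _)
    simp only [hΨ0, hJq]; simpa using hδ0
  obtain ⟨η, hη, hb⟩ := Metric.eventually_nhds_iff_ball.1 ((hev1.and hev2).and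
    (ball_mem_nhds (0 : E) (by positivity : 0 < ε / 2)))
  have hηε : ball (0 : E) η ⊆ ball 0 ε := fun k hk =>
    ball_subset_ball (by linarith) (hb k hk).2
  refine ⟨Ψ, η, l, hη, hΨd.mono hηε, hΨi.mono hηε, fun k hk => ⟨(hΨ k (hηε hk)).1, fun hlk => ?_⟩⟩
  by_contra hcon
  obtain ⟨⟨hb1, hb2⟩, hb3⟩ := hb k hk
  have hnz' : ∀ ζ ∈ closedBall (0 : ℂ) ρ, J (Ψ (k + ζ • u)) ≠ 0 := by
    intro ζ hζ
    by_cases hζ0 : ζ = 0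
    · simpa [hζ0] using hcon
    · exact hnz k hb3 hlk ζ (mem_closedBall_zero_iff.1 hζ) hζ0
  have hdiff : DifferentiableOn ℂ (fun ζ : ℂ => (J (Ψ (k + ζ • u)))⁻¹) (closedBall 0 ρ) := by
    apply DifferentiableOn.inv _ hnz'
    exact hJΨ.comp (f := fun ζ : ℂ => k + ζ • u) (by fun_prop)
      fun ζ hζ => hin k hb3 ζ (mem_closedBall_zero_iff.1 hζ)
  have hmax := Complex.norm_le_of_forall_mem_frontier_norm_le (U := ball (0 : ℂ) ρ)
    (f := fun ζ : ℂ => (J (Ψ (k + ζ • u)))⁻¹) (C := (δ / 2)⁻¹) (z := 0) isBounded_ball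
    (hdiff.mono closure_ball_subset_closedBall).diffContOnCl (fun ζ hζ => by
      rw [frontier_ball _ hρ0.ne'] at hζ
      rw [norm_inv]
      exact inv_anti₀ (by positivity) (hb1 ζ hζ).le)
    (subset_closure (mem_ball_self hρ0))
  simp only [zero_smul, add_zero, norm_inv] at hmax
  have := (inv_le_inv₀ (norm_pos_iff.2 hcon) (by positivity)).1 hmax
  linarith

/-- Injective holomorphic maps in dimension `d` have injective derivatives. -/
def OsgP (d : ℕ) : Prop :=
  ∀ (E F : Type) [NormedAddCommGroup E] [NormedSpace ℂ E] [FiniteDimensional ℂ E]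
    [NormedAddCommGroup F] [NormedSpace ℂ F] [FiniteDimensional ℂ F],
    Module.finrank ℂ E = d → Module.finrank ℂ F = d → ∀ (f : E → F) (U : Set E), IsOpen U →
    DifferentiableOn ℂ f U → InjOn f U → ∀ p ∈ U, ∀ v, fderiv ℂ f p v = 0 → v = 0

lemma finrank_ker_of {d : ℕ} (hE : Module.finrank ℂ E = d + 1) (l : E →L[ℂ] ℂ) {u : E}
    (hu : l u = 1) : Module.finrank ℂ (LinearMap.ker l.toLinearMap) = d := by
  have h1 := LinearMap.finrank_range_add_finrank_ker l.toLinearMap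
  have h2 : LinearMap.range l.toLinearMap = ⊤ := by
    rw [LinearMap.range_eq_top]
    intro c
    exact ⟨c • u, by simp [hu]⟩
  rw [h2, finrank_top, Module.finrank_self, hE] at h1
  omega

lemma stepA {d : ℕ} (ih : OsgP d) (hE : Module.finrank ℂ E = d + 1)
    (hF : Module.finrank ℂ F = d + 1) {f : E → F} {U : Set E} (hU : IsOpen U)
    (hf : DifferentiableOn ℂ f U) (hi : InjOn f U) {p : E} (hp : p ∈ U)
    (hne : fderiv ℂ f p ≠ 0) {v : E} (hv : fderiv ℂ f p v = 0) : v = 0 := by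
  obtain ⟨e, he⟩ : ∃ e, fderiv ℂ f p e ≠ 0 := by
    by_contra! hcon
    exact hne (ContinuousLinearMap.ext hcon)
  set w := fderiv ℂ f p e with hw
  obtain ⟨m, hm⟩ : ∃ m : F →L[ℂ] ℂ, m w = 1 := SeparatingDual.exists_eq_one he
  have hfp := hf.differentiableAt (hU.mem_nhds hp)
  have hl : fderiv ℂ (fun z => m (f z)) p = m.comp (fderiv ℂ f p) :=
    (m.hasFDerivAt.comp p hfp.hasFDerivAt).fderiv
  have hle : fderiv ℂ (fun z => m (f z)) p e = 1 := by rw [hl]; exact hm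
  obtain ⟨Ψ, ε, hε, hΨd, hΨ0, hΨi, hΨ1, hΨ⟩ := straighten (g := fun z => m (f z)) hU
    (m.differentiable.comp_differentiableOn hf : DifferentiableOn ℂ (fun z => m (f z)) U) hp hle
  rw [hl] at hle hΨ
  set l := m.comp (fderiv ℂ f p) with hldef
  set K := LinearMap.ker l.toLinearMap with hK
  set L := LinearMap.ker m.toLinearMap with hL
  set Q : F →L[ℂ] L := (ContinuousLinearMap.id ℂ F - m.smulRight w).codRestrict L (by
    intro y; simp [hL, hm]) with hQ
  have hQm : ∀ y, m y = 0 → ((Q y : L) : F) = y := by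
    intro y hy; simp [hQ, hy]
  set G : K → L := fun k => Q (f (Ψ (k : E)) - f p) with hG
  have hmem : ∀ k : K, k ∈ ball (0 : K) ε → (k : E) ∈ ball (0 : E) ε := by
    intro k hk; simpa using hk
  have hker : ∀ k : K, l (k : E) = 0 := fun k => k.2
  have hGv : ∀ k ∈ ball (0 : K) ε, ((G k : L) : F) = f (Ψ (k : E)) - f p := by
    intro k hk
    apply hQm
    have := (hΨ k (hmem k hk)).2
    rw [hker k] at this
    rw [map_sub, this]; simp
  have hfΨ : DifferentiableOn ℂ (fun y => f (Ψ y)) (ball 0 ε) :=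
    hf.comp hΨd fun y hy => (hΨ y hy).1
  have hGd : DifferentiableOn ℂ G (ball 0 ε) := by
    apply Q.differentiable.comp_differentiableOn
    apply DifferentiableOn.sub_const
    exact hfΨ.comp (f := fun k : K => (k : E)) K.subtypeL.differentiable.differentiableOn
      fun k hk => hmem k hk
  have hGi : InjOn G (ball 0 ε) := by
    intro k hk k' hk' hkk
    have h1 := congrArg (fun y : L => (y : F)) hkk
    simp only [hGv k hk, hGv k' hk'] at h1
    have h2 := hi (hΨ k (hmem k hk)).1 (hΨ k' (hmem k' hk')).1 (sub_left_injective h1)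
    exact Subtype.ext (hΨi (hmem k hk) (hmem k' hk') h2)
  have hG' : HasFDerivAt G (Q.comp ((fderiv ℂ f p).comp K.subtypeL)) 0 := by
    have h1 : HasFDerivAt f (fderiv ℂ f p) (Ψ 0) := by rw [hΨ0]; exact hfp.hasFDerivAt
    have h2 : HasFDerivAt (fun y => f (Ψ y)) (fderiv ℂ f p) 0 := by
      simpa using! h1.comp 0 hΨ1
    have h3 : HasFDerivAt (fun k : K => f (Ψ (k : E))) ((fderiv ℂ f p).comp K.subtypeL) 0 :=
      HasFDerivAt.comp (g := fun y => f (Ψ y)) (0 : K) (by simpa using h2) K.subtypeL.hasFDerivAt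
    exact Q.hasFDerivAt.comp (0 : K) (h3.sub_const (f p))
  have hvK : l v = 0 := by simp [hldef, hv]
  have := ih K L (finrank_ker_of hE l hle) (finrank_ker_of hF m hm) G (ball 0 ε) isOpen_ball hGd hGi 0
    (mem_ball_self hε) ⟨v, hvK⟩ (by rw [hG'.fderiv]; simp [hv])
  exact congrArg Subtype.val this

lemma diff_prod {ι : Type} (s : Finset ι) (c : ι → E → ℂ) {U : Set E}
    (h : ∀ i, DifferentiableOn ℂ (c i) U) : DifferentiableOn ℂ (fun y => ∏ i ∈ s, c i y) U := by
  classical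
  induction s using Finset.induction_on with
  | empty => simp
  | insert a s ha ih =>
    simp only [Finset.prod_insert ha]
    exact (h a).mul ih

lemma stepB (hE : 1 < Module.finrank ℂ E) (hEF : Module.finrank ℂ F = Module.finrank ℂ E)
    {f : E → F} {U : Set E} (hU : IsOpen U)
    (hf : DifferentiableOn ℂ f U) (hi : InjOn f U)
    (hdich : ∀ z ∈ U, fderiv ℂ f z ≠ 0 → ∀ v, fderiv ℂ f z v = 0 → v = 0) {p : E} (hp : p ∈ U) :
    fderiv ℂ f p ≠ 0 := by
  intro hp0
  have : Nontrivial E := Module.nontrivial_of_finrank_pos (R := ℂ) (by omega)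
  let A : F ≃L[ℂ] E := ContinuousLinearEquiv.ofFinrankEq hEF
  let b := Module.finBasis ℂ E
  set T : E → E →ₗ[ℂ] E := fun z => (A.toContinuousLinearMap.comp (fderiv ℂ f z)).toLinearMap with hT
  set J : E → ℂ := fun z => (LinearMap.toMatrix b b (T z)).det with hJ
  have hJdet : ∀ z, J z = LinearMap.det (T z) := fun z => LinearMap.det_toMatrix b (T z)
  have hJd : DifferentiableOn ℂ J U := by
    have hent : ∀ i j, DifferentiableOn ℂ (fun z => LinearMap.toMatrix b b (T z) i j) U := by
      intro i j
      have h1 : (fun z => LinearMap.toMatrix b b (T z) i j) =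
          fun z => (LinearMap.toContinuousLinearMap (b.coord i)) (A (fderiv ℂ f z (b j))) := by
        ext z; simp [LinearMap.toMatrix_apply, hT]
      rw [h1]
      apply (LinearMap.toContinuousLinearMap (b.coord i)).differentiable.comp_differentiableOn
      exact A.toContinuousLinearMap.differentiable.comp_differentiableOn
        (differentiableOn_dir hU hf (b j))
    simp only [hJ, Matrix.det_apply]
    apply DifferentiableOn.fun_sum
    intro σ _
    apply DifferentiableOn.const_smul
    exact diff_prod _ _ fun i => hent _ _
  have hJ0 : ∀ z ∈ U, J z = 0 → fderiv ℂ f z = 0 := by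
    intro z hz hJz
    by_contra hcon
    have hinj := hdich z hz hcon
    have hk : LinearMap.ker (T z) = ⊥ := by
      rw [LinearMap.ker_eq_bot']
      intro v hv
      apply hinj
      simpa [hT] using hv
    have h1 : IsUnit (T z) := (LinearMap.isUnit_iff_ker_eq_bot (T z)).2 hk
    have h2 := h1.map (LinearMap.det : (E →ₗ[ℂ] E) →* ℂ)
    rw [← hJdet, hJz] at h2
    simp at h2
  have hJp : J p = 0 := by
    have : T p = 0 := by ext; simp [hT, hp0]
    rw [hJdet, this]
    have : Nonempty (Fin (Module.finrank ℂ E)) := ⟨⟨0, by omega⟩⟩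
    exact LinearMap.det_zero' b
  have hconst : ∀ (z : E) (r : ℝ), 0 < r → ball z r ⊆ U →
      (∀ w ∈ ball z r, fderiv ℂ f w = 0) → False := by
    intro z r hr hrU h0
    obtain ⟨e, he⟩ := exists_ne (0 : E)
    have hepos : 0 < ‖e‖ := norm_pos_iff.2 he
    set w := z + ((r / (2 * ‖e‖) : ℝ) : ℂ) • e with hw
    have hwb : w ∈ ball z r := by
      rw [mem_ball, dist_eq_norm, hw]
      simp only [add_sub_cancel_left, norm_smul, Complex.norm_real, Real.norm_eq_abs]
      rw [abs_of_pos (by positivity)]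
      field_simp
      linarith
    have hfw : f w = f z := by
      refine (convex_ball z r).is_const_of_fderivWithin_eq_zero (𝕜 := ℂ)
        (hf.mono hrU) (fun w hw => ?_) hwb (mem_ball_self hr)
      rw [fderivWithin_of_isOpen isOpen_ball hw, h0 w hw]
    have h1 := hi (hrU hwb) (hrU (mem_ball_self hr)) hfw
    rw [hw] at h1
    simp [he, hr.ne'] at h1
  have hJne : ¬ ∀ᶠ z in 𝓝 p, J z = 0 := by
    intro hcon
    obtain ⟨r, hr, hb⟩ := Metric.eventually_nhds_iff_ball.1
      (Filter.Eventually.and hcon (hU.mem_nhds hp))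
    exact hconst p r hr (fun z hz => (hb z hz).2) fun w hw => hJ0 w (hb w hw).2 (hb w hw).1
  obtain ⟨Ψ, ε, l, hε, hΨd, hΨi, hΨ⟩ := zero_set_param hU hJd hp hJp hJne
  obtain ⟨k, hk0, hlk⟩ : ∃ k : E, k ≠ 0 ∧ l k = 0 := by
    by_contra! hcon
    have hinj : Function.Injective l.toLinearMap := by
      rw [← LinearMap.ker_eq_bot, LinearMap.ker_eq_bot']
      intro m hm
      by_contra h0
      exact hcon m h0 hm
    have := LinearMap.finrank_le_finrank_of_injective hinj
    rw [Module.finrank_self] at this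
    omega
  have hkpos : 0 < ‖k‖ := norm_pos_iff.2 hk0
  set c : ℂ → F := fun τ => f (Ψ (τ • k)) with hc
  set R := ε / ‖k‖ with hR
  have hR0 : 0 < R := by positivity
  have hin : ∀ τ ∈ ball (0 : ℂ) R, τ • k ∈ ball (0 : E) ε := by
    intro τ hτ
    rw [mem_ball_zero_iff, hR, lt_div_iff₀ hkpos] at hτ
    simpa [norm_smul] using hτ
  have hcd : ∀ τ ∈ ball (0 : ℂ) R, HasFDerivAt c (0 : ℂ →L[ℂ] F) τ := by
    intro τ hτ
    have h1 := hΨ _ (hin τ hτ)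
    have h2 : HasFDerivAt f (0 : E →L[ℂ] F) (Ψ (τ • k)) := by
      have := (hf.differentiableAt (hU.mem_nhds h1.1)).hasFDerivAt
      rwa [hJ0 _ h1.1 (h1.2 (by simp [hlk]))] at this
    have h3 : DifferentiableAt ℂ (fun τ : ℂ => Ψ (τ • k)) τ :=
      DifferentiableAt.comp (g := Ψ) τ (hΨd.differentiableAt (isOpen_ball.mem_nhds (hin τ hτ)))
        (by fun_prop)
    simpa using! HasFDerivAt.comp (g := f) τ h2 h3.hasFDerivAt
  have hmem : ((R / 2 : ℝ) : ℂ) ∈ ball (0 : ℂ) R := by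
    rw [mem_ball_zero_iff, Complex.norm_real, Real.norm_eq_abs, abs_of_pos (by positivity)]
    linarith
  have h0 : (0 : ℂ) ∈ ball (0 : ℂ) R := mem_ball_self hR0
  have hcc : c ((R / 2 : ℝ) : ℂ) = c 0 := by
    refine (convex_ball (0 : ℂ) R).is_const_of_fderivWithin_eq_zero (𝕜 := ℂ)
      (fun τ hτ => (hcd τ hτ).differentiableAt.differentiableWithinAt) (fun τ hτ => ?_) hmem h0
    rw [fderivWithin_of_isOpen isOpen_ball hτ, (hcd τ hτ).fderiv]
  have h1 := hi (hΨ _ (hin _ hmem)).1 (hΨ _ (hin _ h0)).1 hcc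
  have h2 := hΨi (hin _ hmem) (hin _ h0) h1
  simp [hk0, hR0.ne'] at h2

theorem osgood (d : ℕ) : OsgP d := by
  induction d with
  | zero =>
    intro E F _ _ _ _ _ _ hE hF f U hU hf hi p hp v hv
    have := Module.finrank_zero_iff.1 hE
    exact Subsingleton.elim _ _
  | succ d ih =>
    intro E F _ _ _ _ _ _ hE hF f U hU hf hi p hp v hv
    have hdich : ∀ z ∈ U, fderiv ℂ f z ≠ 0 → ∀ v, fderiv ℂ f z v = 0 → v = 0 :=
      fun z hz hne v hv => stepA ih hE hF hU hf hi hz hne hv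
    refine hdich p hp ?_ v hv
    rcases Nat.eq_zero_or_pos d with hd | hd
    · subst hd
      intro h0
      have : Nontrivial E := Module.nontrivial_of_finrank_pos (R := ℂ) (by omega)
      obtain ⟨e, he⟩ := exists_ne (0 : E)
      let A : F ≃L[ℂ] ℂ := ContinuousLinearEquiv.ofFinrankEq (by rw [hF, Module.finrank_self])
      have hV : IsOpen ((fun ζ : ℂ => p + ζ • e) ⁻¹' U) := hU.preimage (by fun_prop)
      have hp' : (0 : ℂ) ∈ (fun ζ : ℂ => p + ζ • e) ⁻¹' U := by simpa using hp
      refine one_var (h := fun ζ : ℂ => A (f (p + ζ • e))) hV ?_ ?_ hp' ?_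
      · apply A.toContinuousLinearMap.differentiable.comp_differentiableOn
        exact hf.comp (f := fun ζ : ℂ => p + ζ • e) (by fun_prop) fun ζ hζ => hζ
      · intro ζ hζ ζ' hζ' hh
        have h1 := hi hζ hζ' (A.injective hh)
        simp only [add_right_inj] at h1
        exact smul_left_injective ℂ he h1
      · have h3 : HasDerivAt (fun ζ : ℂ => p + ζ • e) e 0 := by
          simpa using ((hasDerivAt_id (0:ℂ)).smul_const e).const_add p
        have h4 : HasFDerivAt f (0 : E →L[ℂ] F) (p + (0:ℂ) • e) := by
          have := (hf.differentiableAt (hU.mem_nhds hp)).hasFDerivAt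
          rw [h0] at this
          simpa using this
        have h5 := A.toContinuousLinearMap.hasFDerivAt.comp_hasDerivAt (0:ℂ) (h4.comp_hasDerivAt (0:ℂ) h3)
        simpa [Function.comp_def] using h5.deriv
    · exact stepB (by omega) (by omega) hU hf hi hdich hp

end Osg

namespace Chain
open scoped Topology

lemma isOpen_Ball (n : ℕ) : IsOpen (Ball n) := Metric.isOpen_ball

lemma zero_mem (n : ℕ) : (0 : En n) ∈ Ball n := by simp [Ball]

/-- A univalent map has invertible derivative. -/
lemma exists_equiv {n : ℕ} {G : En n → En n} (hG : UnivalentOn n G) {w : En n} (hw : w ∈ Ball n) :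
    ∃ e : En n ≃L[ℂ] En n, HasStrictFDerivAt G (e : En n →L[ℂ] En n) w := by
  have hinj : Function.Injective (fderiv ℂ G w : En n →ₗ[ℂ] En n) := by
    rw [← LinearMap.ker_eq_bot, LinearMap.ker_eq_bot']
    intro v hv
    exact Osg.osgood n (En n) (En n) (by simp) (by simp) G (Ball n) (isOpen_Ball n) hG.1 hG.2 w hw v hv
  refine ⟨(LinearEquiv.ofInjectiveEndo _ hinj).toContinuousLinearEquiv, ?_⟩
  have h := Osg.hasStrict (isOpen_Ball n) hG.1 hw
  have he : ((LinearEquiv.ofInjectiveEndo _ hinj).toContinuousLinearEquiv : En n →L[ℂ] En n) =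
      fderiv ℂ G w := by
    ext1 v
    rfl
  rw [he]
  exact h

/-- Comparison on compacta. -/
lemma exists_lip {n : ℕ} {G a : En n → En n} (hG : UnivalentOn n G)
    (ha : DifferentiableOn ℂ a (Ball n)) {C : Set (En n)} (hC : IsCompact C) (hCB : C ⊆ Ball n) :
    ∃ L : ℝ, 0 ≤ L ∧ ∀ x ∈ C, ∀ y ∈ C, ‖a x - a y‖ ≤ L * ‖G x - G y‖ := by
  have key : ∃ L : ℝ, 0 ≤ L ∧ ∀ p ∈ C ×ˢ C, ‖a p.1 - a p.2‖ ≤ L * ‖G p.1 - G p.2‖ := by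
    refine IsCompact.induction_on (hC.prod hC)
      (p := fun S => ∃ L : ℝ, 0 ≤ L ∧ ∀ p ∈ S, ‖a p.1 - a p.2‖ ≤ L * ‖G p.1 - G p.2‖) ?_ ?_ ?_ ?_
    · exact ⟨0, le_rfl, by simp⟩
    · rintro s t hst ⟨L, hL, h⟩
      exact ⟨L, hL, fun p hp => h p (hst hp)⟩
    · rintro s t ⟨L, hL, h⟩ ⟨L', hL', h'⟩
      refine ⟨max L L', le_max_of_le_left hL, ?_⟩
      rintro p (hp | hp)
      · exact (h p hp).trans (by gcongr; exact le_max_left _ _)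
      · exact (h' p hp).trans (by gcongr; exact le_max_right _ _)
    · rintro ⟨x, y⟩ ⟨hx', hy'⟩
      have hx : x ∈ Ball n := hCB hx'
      have hy : y ∈ Ball n := hCB hy'
      clear hx' hy'
      suffices hs : ∃ L : ℝ, 0 ≤ L ∧ ∀ᶠ p in 𝓝 (x, y), ‖a p.1 - a p.2‖ ≤ L * ‖G p.1 - G p.2‖ by
        obtain ⟨L, hL, h⟩ := hs
        exact ⟨_, mem_nhdsWithin_of_mem_nhds h, L, hL, fun p hp => hp⟩
      by_cases hxy : x = y
      · subst hxy
        obtain ⟨e, he⟩ := exists_equiv hG hx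
        have h1 := (Osg.hasStrict (isOpen_Ball n) ha hx).isBigO_sub.trans
          (he.isTheta_sub e.toHomeomorph.isInducing).isBigO_symm
        obtain ⟨L, hL, h⟩ := h1.exists_nonneg
        exact ⟨L, hL, h.bound⟩
      · have hne : 0 < ‖G x - G y‖ := by
          rw [norm_pos_iff, sub_ne_zero]
          exact fun h => hxy (hG.2 hx hy h)
        refine ⟨(‖a x - a y‖ + 1) / ‖G x - G y‖, by positivity, ?_⟩
        have hcx : ∀ {g : En n → En n}, DifferentiableOn ℂ g (Ball n) →
            ContinuousAt (fun p : En n × En n => g p.1 - g p.2) (x, y) := by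
          intro g hg
          have h1 : ContinuousAt g x := (hg.differentiableAt ((isOpen_Ball n).mem_nhds hx)).continuousAt
          have h2 : ContinuousAt g y := (hg.differentiableAt ((isOpen_Ball n).mem_nhds hy)).continuousAt
          exact (ContinuousAt.comp (f := Prod.fst) (x := (x, y)) h1 continuousAt_fst).sub
            (ContinuousAt.comp (f := Prod.snd) (x := (x, y)) h2 continuousAt_snd)
        have h3 := (hcx ha).norm
        have h4 := (hcx hG.1).norm.const_mul ((‖a x - a y‖ + 1) / ‖G x - G y‖)
        have h5 := h3.eventually_lt h4 (by
          simp only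
          rw [div_mul_cancel₀ _ hne.ne']
          linarith)
        exact h5.mono fun p hp => hp.le
  obtain ⟨L, hL, h⟩ := key
  exact ⟨L, hL, fun x hx y hy => h (x, y) ⟨hx, hy⟩⟩

section evo
variable {n : ℕ} {F : ℝ → En n → En n}

lemma evo_mem (hF : IsNormalizedLoewnerChain n F) {s t : ℝ} (hs : 0 ≤ s) (hst : s ≤ t) {z : En n}
    (hz : z ∈ Ball n) : evolution n F s t z ∈ Ball n :=
  Function.invFunOn_mem (hF.1.2.1 s t hs hst ⟨z, hz, rfl⟩)

lemma evo_eq (hF : IsNormalizedLoewnerChain n F) {s t : ℝ} (hs : 0 ≤ s) (hst : s ≤ t) {z : En n}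
    (hz : z ∈ Ball n) : F t (evolution n F s t z) = F s z :=
  Function.invFunOn_eq (hF.1.2.1 s t hs hst ⟨z, hz, rfl⟩)

lemma evo_inj (hF : IsNormalizedLoewnerChain n F) {s t : ℝ} (hs : 0 ≤ s) (hst : s ≤ t) :
    InjOn (evolution n F s t) (Ball n) := by
  intro x hx y hy h
  apply (hF.1.1 s hs).2 hx hy
  rw [← evo_eq hF hs hst hx, ← evo_eq hF hs hst hy, h]

lemma evo_self (hF : IsNormalizedLoewnerChain n F) {t : ℝ} (ht : 0 ≤ t) {z : En n}
    (hz : z ∈ Ball n) : evolution n F t t z = z :=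
  (hF.1.1 t ht).2 (evo_mem hF ht le_rfl hz) hz (evo_eq hF ht le_rfl hz)

lemma evo_zero (hF : IsNormalizedLoewnerChain n F) {s t : ℝ} (hs : 0 ≤ s) (hst : s ≤ t) :
    evolution n F s t 0 = 0 := by
  apply (hF.1.1 t (hs.trans hst)).2 (evo_mem hF hs hst (zero_mem n)) (zero_mem n)
  rw [evo_eq hF hs hst (zero_mem n), (hF.2 s hs).1, (hF.2 t (hs.trans hst)).1]

lemma evo_image (hF : IsNormalizedLoewnerChain n F) {s s' t : ℝ} (hs : 0 ≤ s) (hss : s ≤ s')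
    (hst : s' ≤ t) {z : En n} (hz : z ∈ Ball n) :
    evolution n F s' t (evolution n F s s' z) = evolution n F s t z := by
  have h1 := evo_mem hF hs hss hz
  apply (hF.1.1 t (by linarith)).2 (evo_mem hF (by linarith) hst h1) (evo_mem hF hs (by linarith) hz)
  rw [evo_eq hF (by linarith) hst h1, evo_eq hF hs hss hz, evo_eq hF hs (by linarith) hz]

lemma evo_diff (hF : IsNormalizedLoewnerChain n F) {s t : ℝ} (hs : 0 ≤ s) (hst : s ≤ t) :
    DifferentiableOn ℂ (evolution n F s t) (Ball n) := by
  intro z hz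
  apply DifferentiableAt.differentiableWithinAt
  have hw := evo_mem hF hs hst hz
  have hU := hF.1.1 t (hs.trans hst)
  obtain ⟨e, he⟩ := exists_equiv hU hw
  have hl : ∀ᶠ x in 𝓝 (evolution n F s t z), Function.invFunOn (F t) (Ball n) (F t x) = x := by
    filter_upwards [(isOpen_Ball n).mem_nhds hw] with x hx
    exact hU.2.leftInvOn_invFunOn hx
  have h1 := (he.to_local_left_inverse hl).hasFDerivAt.differentiableAt
  rw [evo_eq hF hs hst hz] at h1
  exact h1.comp z ((hF.1.1 s hs).1.differentiableAt ((isOpen_Ball n).mem_nhds hz))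

lemma evo_fderiv (hF : IsNormalizedLoewnerChain n F) {s t : ℝ} (hs : 0 ≤ s) (hst : s ≤ t) :
    fderiv ℂ (evolution n F s t) 0 = (Real.exp (s - t) : ℂ) • ContinuousLinearMap.id ℂ (En n) := by
  have ht : 0 ≤ t := hs.trans hst
  have hB := (isOpen_Ball n).mem_nhds (zero_mem n)
  have h1 : F t ∘ evolution n F s t =ᶠ[𝓝 0] F s := by
    filter_upwards [hB] with x hx using evo_eq hF hs hst hx
  have h2 := h1.fderiv_eq (𝕜 := ℂ)
  have hd1 : DifferentiableAt ℂ (evolution n F s t) 0 := (evo_diff hF hs hst).differentiableAt hB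
  have hd2 : DifferentiableAt ℂ (F t) (evolution n F s t 0) := by
    rw [evo_zero hF hs hst]; exact (hF.1.1 t ht).1.differentiableAt hB
  rw [fderiv_comp _ hd2 hd1, evo_zero hF hs hst, (hF.2 s hs).2, (hF.2 t ht).2] at h2
  ext1 v
  have h3 := congrArg (fun A : En n →L[ℂ] En n => (Real.exp (-t) : ℂ) • A v) h2
  simp only [ContinuousLinearMap.coe_comp, Function.comp_apply, smul_apply,
    ContinuousLinearMap.id_apply, smul_smul, ← Complex.ofReal_mul, ← Real.exp_add] at h3
  simpa [sub_eq_add_neg, add_comm] using h3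

lemma evo_norm (hF : IsNormalizedLoewnerChain n F) {s t : ℝ} (hs : 0 ≤ s) (hst : s ≤ t) {z : En n}
    (hz : z ∈ Ball n) : ‖evolution n F s t z‖ ≤ ‖z‖ := by
  refine Complex.norm_le_norm_of_mapsTo_ball (R := 1) (evo_diff hF hs hst) ?_ (evo_zero hF hs hst) ?_
  · exact fun x hx => ball_subset_closedBall (evo_mem hF hs hst hx)
  · simpa [Ball] using hz

end evo

lemma compact_sub {n : ℕ} {K : Set (En n)} (hK : IsCompact K) (hKB : K ⊆ Ball n) :
    ∃ r : ℝ, r < 1 ∧ K ⊆ closedBall 0 r := by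
  rcases K.eq_empty_or_nonempty with rfl | hne
  · exact ⟨0, by norm_num, by simp⟩
  · obtain ⟨x, hx, hm⟩ := hK.exists_isMaxOn hne continuous_norm.continuousOn
    refine ⟨‖x‖, by simpa [Ball] using hKB hx, fun y hy => by simpa using hm hy⟩

lemma identity {n : ℕ} {a b : En n → En n} (ha : DifferentiableOn ℂ a (Ball n))
    (hb : DifferentiableOn ℂ b (Ball n)) (h : a =ᶠ[𝓝 0] b) : EqOn a b (Ball n) := by
  intro z hz
  set V : Set ℂ := {ζ | ‖ζ‖ * ‖z‖ < 1} with hV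
  have hVo : IsOpen V := isOpen_lt (by fun_prop) (by fun_prop)
  have hVs : StarConvex ℝ (0 : ℂ) V := by
    rw [starConvex_zero_iff]
    intro x hx c hc0 hc1
    simp only [hV, mem_ofPred_eq, norm_smul, Real.norm_eq_abs, abs_of_nonneg hc0] at hx ⊢
    nlinarith [mul_nonneg (norm_nonneg x) (norm_nonneg z)]
  have hm : ∀ ζ ∈ V, ζ • z ∈ Ball n := fun ζ hζ => by
    have hζ : ‖ζ‖ * ‖z‖ < 1 := hζ
    simpa [Ball, norm_smul] using hζ
  have han : ∀ {g : En n → En n}, DifferentiableOn ℂ g (Ball n) →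
      AnalyticOnNhd ℂ (fun ζ : ℂ => g (ζ • z)) V := fun {g} hg =>
    (hg.comp (f := fun ζ : ℂ => ζ • z) (by fun_prop) hm).analyticOnNhd hVo
  have h0 : (0 : ℂ) ∈ V := by simp [hV]
  have hev : (fun ζ : ℂ => a (ζ • z)) =ᶠ[𝓝 0] fun ζ : ℂ => b (ζ • z) := by
    have ht : Tendsto (fun ζ : ℂ => ζ • z) (𝓝 0) (𝓝 0) := by
      have : ContinuousAt (fun ζ : ℂ => ζ • z) 0 := by fun_prop
      simpa [ContinuousAt] using this
    exact ht.eventually h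
  have h1 : (1 : ℂ) ∈ V := by simpa [hV, Ball] using hz
  have := (han ha).eqOn_of_preconnected_of_eventuallyEq (han hb)
    (StarConvex.isPathConnected hVs h0).isConnected.isPreconnected h0 hev h1
  simpa using this

/-- The chain obtained by gluing `e^t a ∘ φ_{s,t}` with `e^t A_{s-t}`. -/
def glue (n : ℕ) (F A : ℝ → En n → En n) (t s : ℝ) : En n → En n :=
  if s ≤ t then fun z => (Real.exp t : ℂ) • A 0 (evolution n F s t z)
  else fun z => (Real.exp t : ℂ) • A (s - t) z

lemma exp_ne (t : ℝ) : (Real.exp t : ℂ) ≠ 0 := by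
  exact_mod_cast (Real.exp_pos t).ne'

lemma norm_exp (t : ℝ) : ‖(Real.exp t : ℂ)‖ = Real.exp t := by
  rw [Complex.norm_real, Real.norm_eq_abs, abs_of_pos (Real.exp_pos t)]

lemma univ_smul {n : ℕ} {g : En n → En n} (hg : UnivalentOn n g) (t : ℝ) :
    UnivalentOn n (fun z => (Real.exp t : ℂ) • g z) :=
  ⟨hg.1.fun_const_smul _, fun _ hx _ hy h => hg.2 hx hy (smul_right_injective _ (exp_ne t) h)⟩

lemma fderiv_scaled {n : ℕ} {g : En n → En n} (hg : DifferentiableOn ℂ g (Ball n)) (t u : ℝ)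
    (h : fderiv ℂ g 0 = (Real.exp u : ℂ) • ContinuousLinearMap.id ℂ (En n)) :
    fderiv ℂ (fun z => (Real.exp t : ℂ) • g z) 0 =
      (Real.exp (t + u) : ℂ) • ContinuousLinearMap.id ℂ (En n) := by
  have hd := hg.differentiableAt ((isOpen_Ball n).mem_nhds (zero_mem n))
  rw [fderiv_fun_const_smul hd, h, smul_smul, ← Complex.ofReal_mul, ← Real.exp_add]

section glue
variable {n : ℕ} {F A : ℝ → En n → En n} {t : ℝ}

lemma glue_le {s : ℝ} (h : s ≤ t) :
    glue n F A t s = fun z => (Real.exp t : ℂ) • A 0 (evolution n F s t z) := if_pos h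

lemma glue_gt {s : ℝ} (h : t < s) :
    glue n F A t s = fun z => (Real.exp t : ℂ) • A (s - t) z := if_neg (not_le.2 h)

lemma glue_ge (hF : IsNormalizedLoewnerChain n F) (ht : 0 ≤ t) {s : ℝ} (h : t ≤ s) {z : En n}
    (hz : z ∈ Ball n) : glue n F A t s z = (Real.exp t : ℂ) • A (s - t) z := by
  rcases h.lt_or_eq with h | rfl
  · rw [glue_gt h]
  · rw [glue_le le_rfl]
    simp [evo_self hF ht hz]

lemma comp_univ (hF : IsNormalizedLoewnerChain n F) (hA : IsNormalizedLoewnerChain n A)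
    {s : ℝ} (hs : 0 ≤ s) (h : s ≤ t) : UnivalentOn n (fun z => A 0 (evolution n F s t z)) :=
  ⟨(hA.1.1 0 le_rfl).1.comp (evo_diff hF hs h) fun _ hz => evo_mem hF hs h hz,
    fun _ hx _ hy e => evo_inj hF hs h hx hy
      ((hA.1.1 0 le_rfl).2 (evo_mem hF hs h hx) (evo_mem hF hs h hy) e)⟩

lemma glue_univ (hF : IsNormalizedLoewnerChain n F) (hA : IsNormalizedLoewnerChain n A)
    {s : ℝ} (hs : 0 ≤ s) : UnivalentOn n (glue n F A t s) := by
  rcases le_or_gt s t with h | h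
  · rw [glue_le h]
    exact univ_smul (comp_univ hF hA hs h) t
  · rw [glue_gt h]
    exact univ_smul (hA.1.1 _ (by linarith)) t

lemma glue_image (hF : IsNormalizedLoewnerChain n F) (hA : IsNormalizedLoewnerChain n A)
    (ht : 0 ≤ t) {s s' : ℝ} (hs : 0 ≤ s) (hss : s ≤ s') :
    glue n F A t s '' Ball n ⊆ glue n F A t s' '' Ball n := by
  rintro _ ⟨z, hz, rfl⟩
  rcases le_or_gt s' t with h | h
  · refine ⟨evolution n F s s' z, evo_mem hF hs hss hz, ?_⟩
    rw [glue_le h, glue_le (hss.trans h)]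
    simp only [evo_image hF hs hss h hz]
  · have key : ∀ u w, 0 ≤ u → u ≤ s' - t → w ∈ Ball n →
        (Real.exp t : ℂ) • A u w ∈ glue n F A t s' '' Ball n := by
      intro u w hu hu' hw
      obtain ⟨y, hy, e⟩ := hA.1.2.1 u (s' - t) hu hu' ⟨w, hw, rfl⟩
      refine ⟨y, hy, ?_⟩
      rw [glue_gt h]
      simp only [e]
    rcases le_or_gt s t with h' | h'
    · rw [glue_le h']
      exact key 0 _ le_rfl (by linarith) (evo_mem hF hs h' hz)
    · rw [glue_gt h']
      exact key _ _ (by linarith) (by linarith) hz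

lemma shift_integral (c : ℝ → ℝ) (s s' : ℝ) :
    ∫ τ in Icc (s - t) (s' - t), c τ = ∫ τ in Icc s s', c (τ - t) := by
  have h := (measurePreserving_sub_right (volume : Measure ℝ) t).setIntegral_preimage_emb
    (measurableEmbedding_subRight t) c (Icc (s - t) (s' - t))
  rw [← h]
  congr 2
  simp

lemma shift_integrable {c : ℝ → ℝ} {T : ℝ} (hc : IntegrableOn c (Icc 0 T)) :
    IntegrableOn (fun τ => c (τ - t)) (Icc t (T + t)) := by
  have h := ((measurePreserving_sub_right (volume : Measure ℝ) t).integrableOn_comp_preimage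
    (measurableEmbedding_subRight t) (f := c) (s := Icc 0 T)).2 hc
  simpa [Function.comp_def] using h

lemma glue_ac (hF : IsNormalizedLoewnerChain n F) (hA : IsNormalizedLoewnerChain n A)
    (ht : 0 ≤ t) (K : Set (En n)) (hKB : K ⊆ Ball n) (hK : IsCompact K) (T : ℝ) (hT : 0 < T) :
    ∃ c : ℝ → ℝ, (∀ τ, 0 ≤ c τ) ∧ IntegrableOn c (Set.Icc 0 T) ∧
      ∀ z ∈ K, ∀ s s' : ℝ, 0 ≤ s → s ≤ s' → s' ≤ T →
        ‖glue n F A t s z - glue n F A t s' z‖ ≤ ∫ τ in Set.Icc s s', c τ := by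
  obtain ⟨r, hr, hKr⟩ := compact_sub hK hKB
  have hCB : closedBall (0 : En n) r ⊆ Ball n := closedBall_subset_ball hr
  obtain ⟨L, hL, hLip⟩ := exists_lip (hF.1.1 t ht) (hA.1.1 0 le_rfl).1
    (isCompact_closedBall (0 : En n) r) hCB
  obtain ⟨cF, hcF0, hcFi, hcF⟩ := hF.1.2.2 K hKB hK T hT
  obtain ⟨cA, hcA0, hcAi, hcA⟩ := hA.1.2.2 K hKB hK T hT
  set cB : ℝ → ℝ := (Icc t (T + t)).indicator (fun τ => cA (τ - t)) with hcB
  have hcB0 : ∀ τ, 0 ≤ cB τ := fun τ => indicator_nonneg (fun x _ => hcA0 _) τ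
  have hcBi : Integrable cB :=
    (integrable_indicator_iff measurableSet_Icc).2 (shift_integrable hcAi)
  have het := Real.exp_pos t
  have hFi : ∀ {p q : ℝ}, 0 ≤ p → q ≤ T → IntegrableOn cF (Icc p q) := fun hp hq =>
    hcFi.mono_set (Icc_subset_Icc hp hq)
  have hB : ∀ {p q : ℝ}, t ≤ p → q ≤ T → ∫ τ in Icc (p - t) (q - t), cA τ = ∫ τ in Icc p q, cB τ := by
    intro p q hp hq
    rw [shift_integral]
    refine setIntegral_congr_fun measurableSet_Icc fun x hx => ?_
    simp only [hcB]
    rw [indicator_of_mem]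
    exact ⟨hp.trans hx.1, by linarith [hx.2]⟩
  have hsum : ∀ {p q : ℝ}, 0 ≤ p → q ≤ T →
      ∫ τ in Icc p q, (Real.exp t * L * cF τ + Real.exp t * cB τ) =
        Real.exp t * L * (∫ τ in Icc p q, cF τ) + Real.exp t * ∫ τ in Icc p q, cB τ := by
    intro p q hp hq
    rw [integral_add ((hFi hp hq).const_mul _) (hcBi.integrableOn.const_mul _),
      integral_const_mul, integral_const_mul]
  have hF0 : ∀ p q : ℝ, 0 ≤ ∫ τ in Icc p q, cF τ := fun p q => integral_nonneg hcF0
  have hB0 : ∀ p q : ℝ, 0 ≤ ∫ τ in Icc p q, cB τ := fun p q => integral_nonneg hcB0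
  have hlow : ∀ z ∈ K, ∀ s s' : ℝ, 0 ≤ s → s ≤ s' → s' ≤ T → s' ≤ t →
      ‖glue n F A t s z - glue n F A t s' z‖ ≤ Real.exp t * L * ∫ τ in Icc s s', cF τ := by
    intro z hz s s' hs hss hsT hst
    have hzB := hKB hz
    have hs' := hs.trans hss
    have hmem : ∀ {u}, 0 ≤ u → u ≤ t → evolution n F u t z ∈ closedBall (0 : En n) r := by
      intro u hu hut
      rw [mem_closedBall_zero_iff]
      exact (evo_norm hF hu hut hzB).trans (by simpa using hKr hz)
    rw [glue_le hst, glue_le (hss.trans hst)]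
    simp only
    rw [← smul_sub, norm_smul, norm_exp, mul_assoc]
    have h1 := hLip _ (hmem hs (hss.trans hst)) _ (hmem hs' hst)
    rw [evo_eq hF hs (hss.trans hst) hzB, evo_eq hF hs' hst hzB] at h1
    have h2 := hcF z hz s s' hs hss hsT
    gcongr
    exact h1.trans (by gcongr)
  have hhigh : ∀ z ∈ K, ∀ s s' : ℝ, t ≤ s → s ≤ s' → s' ≤ T →
      ‖glue n F A t s z - glue n F A t s' z‖ ≤ Real.exp t * ∫ τ in Icc s s', cB τ := by
    intro z hz s s' hs hss hsT
    have hzB := hKB hz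
    rw [glue_ge hF ht hs hzB, glue_ge hF ht (hs.trans hss) hzB, ← smul_sub, norm_smul, norm_exp,
      ← hB hs hsT]
    gcongr
    exact hcA z hz _ _ (by linarith) (by linarith) (by linarith)
  refine ⟨fun τ => Real.exp t * L * cF τ + Real.exp t * cB τ, ?_, ?_, ?_⟩
  · intro τ
    have := hcF0 τ
    have := hcB0 τ
    positivity
  · exact (hcFi.const_mul _).add (hcBi.integrableOn.const_mul _)
  · intro z hz s s' hs hss hsT
    rw [hsum hs hsT]
    have q1 : 0 ≤ Real.exp t * L * ∫ τ in Icc s s', cF τ := mul_nonneg (by positivity) (hF0 _ _)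
    have q2 : 0 ≤ Real.exp t * ∫ τ in Icc s s', cB τ := mul_nonneg (by positivity) (hB0 _ _)
    rcases le_total s' t with h | h
    · linarith [hlow z hz s s' hs hss hsT h]
    · rcases le_total s t with h' | h'
      · have e1 := hlow z hz s t hs h' (h.trans hsT) le_rfl
        have e2 := hhigh z hz t s' le_rfl h hsT
        have m1 : ∫ τ in Icc s t, cF τ ≤ ∫ τ in Icc s s', cF τ :=
          setIntegral_mono_set (hFi hs hsT) (Eventually.of_forall hcF0)
            (Icc_subset_Icc le_rfl h).eventuallyLE
        have m2 : ∫ τ in Icc t s', cB τ ≤ ∫ τ in Icc s s', cB τ :=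
          setIntegral_mono_set hcBi.integrableOn (Eventually.of_forall hcB0)
            (Icc_subset_Icc h' le_rfl).eventuallyLE
        have m3 : Real.exp t * L * ∫ τ in Icc s t, cF τ ≤ Real.exp t * L * ∫ τ in Icc s s', cF τ := by
          gcongr
        have m4 : Real.exp t * ∫ τ in Icc t s', cB τ ≤ Real.exp t * ∫ τ in Icc s s', cB τ := by
          gcongr
        have tri := norm_sub_le_norm_sub_add_norm_sub (glue n F A t s z) (glue n F A t t z)
          (glue n F A t s' z)
        linarith
      · linarith [hhigh z hz s s' h' hss hsT]

lemma glue_norm (hF : IsNormalizedLoewnerChain n F) (hA : IsNormalizedLoewnerChain n A)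
    (hA0 : fderiv ℂ (A 0) 0 = ContinuousLinearMap.id ℂ (En n)) {s : ℝ} (hs : 0 ≤ s) :
    glue n F A t s 0 = 0 ∧
      fderiv ℂ (glue n F A t s) 0 = (Real.exp s : ℂ) • ContinuousLinearMap.id ℂ (En n) := by
  rcases le_or_gt s t with h | h
  · rw [glue_le h]
    refine ⟨by simp [evo_zero hF hs h, (hA.2 0 le_rfl).1], ?_⟩
    have hB := (isOpen_Ball n).mem_nhds (zero_mem n)
    have hd2 : DifferentiableAt ℂ (A 0) (evolution n F s t 0) := by
      rw [evo_zero hF hs h]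
      exact (hA.1.1 0 le_rfl).1.differentiableAt hB
    have h1 := fderiv_comp (𝕜 := ℂ) (0 : En n) hd2 ((evo_diff hF hs h).differentiableAt hB)
    rw [evo_fderiv hF hs h, evo_zero hF hs h, hA0, ContinuousLinearMap.id_comp] at h1
    have := fderiv_scaled (comp_univ hF hA hs h).1 t (s - t) h1
    simpa using this
  · rw [glue_gt h]
    refine ⟨by simp [(hA.2 (s - t) (by linarith)).1], ?_⟩
    have := fderiv_scaled (hA.1.1 (s - t) (by linarith)).1 t (s - t) (hA.2 (s - t) (by linarith)).2
    simpa using this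

lemma glue_normal (hF : IsNormalizedLoewnerChain n F) (hA : IsNormalizedLoewnerChain n A)
    (hAN : IsNormalFamilyChain n A) : IsNormalFamilyChain n (glue n F A t) := by
  intro K hKB hK
  obtain ⟨r, hr, hKr⟩ := compact_sub hK hKB
  have hCB : closedBall (0 : En n) r ⊆ Ball n := closedBall_subset_ball hr
  obtain ⟨M1, hM1⟩ := (isCompact_closedBall (0 : En n) r).exists_bound_of_continuousOn
    ((hA.1.1 0 le_rfl).1.continuousOn.mono hCB)
  obtain ⟨M2, hM2⟩ := hAN K hKB hK
  refine ⟨max (Real.exp t * M1) M2, fun s hs z hz => ?_⟩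
  rcases le_or_gt s t with h | h
  · apply le_max_of_le_left
    rw [glue_le h]
    simp only
    rw [norm_smul, norm_exp]
    have h1 : ‖A 0 (evolution n F s t z)‖ ≤ M1 := by
      apply hM1
      rw [mem_closedBall_zero_iff]
      exact (evo_norm hF hs h (hKB hz)).trans (by simpa using hKr hz)
    have h2 : Real.exp (-s) ≤ 1 := Real.exp_le_one_iff.2 (by linarith)
    have h3 : Real.exp t * ‖A 0 (evolution n F s t z)‖ ≤ Real.exp t * M1 := by gcongr
    exact (mul_le_of_le_one_left (by positivity) h2).trans h3
  · apply le_max_of_le_right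
    rw [glue_gt h]
    simp only
    rw [norm_smul, norm_exp, ← mul_assoc, ← Real.exp_add]
    have := hM2 (s - t) (by linarith) z hz
    rwa [neg_sub, sub_eq_neg_add] at this

lemma memS0_of_chain {G : ℝ → En n → En n} (h : IsNormalizedLoewnerChain n G)
    (hN : IsNormalFamilyChain n G) : MemS0 n (G 0) :=
  ⟨⟨h.1.1 0 le_rfl, (h.2 0 le_rfl).1, by simpa using (h.2 0 le_rfl).2⟩, G, h, hN, rfl⟩

lemma glue_mem (hF : IsNormalizedLoewnerChain n F) (hA : IsNormalizedLoewnerChain n A)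
    (hAN : IsNormalFamilyChain n A) (ht : 0 ≤ t) :
    MemS0 n (fun z => (Real.exp t : ℂ) • A 0 (evolution n F 0 t z)) := by
  rw [← glue_le ht]
  refine memS0_of_chain ⟨⟨fun s hs => glue_univ hF hA hs, fun s s' hs hss => glue_image hF hA ht hs hss,
    glue_ac hF hA ht⟩, fun s hs => glue_norm hF hA ?_ hs⟩ (glue_normal hF hA hAN)
  simpa using (hA.2 0 le_rfl).2

lemma shift_mem (hF : IsNormalizedLoewnerChain n F) (hN : IsNormalFamilyChain n F) (ht : 0 ≤ t) :
    MemS0 n (fun z => (Real.exp (-t) : ℂ) • F t z) := by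
  have e : (fun z => (Real.exp (-t) : ℂ) • F t z) =
      (fun s z => (Real.exp (-t) : ℂ) • F (s + t) z) 0 := by simp
  rw [e]
  refine memS0_of_chain (G := fun s z => (Real.exp (-t) : ℂ) • F (s + t) z)
    ⟨⟨fun s hs => univ_smul (hF.1.1 _ (by linarith)) _, ?_, ?_⟩, ?_⟩ ?_
  · rintro s s' hs hss _ ⟨z, hz, rfl⟩
    obtain ⟨y, hy, e⟩ := hF.1.2.1 (s + t) (s' + t) (by linarith) (by linarith) ⟨z, hz, rfl⟩
    exact ⟨y, hy, by simp only [e]⟩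
  · intro K hKB hK T hT
    obtain ⟨c, hc0, hci, hc⟩ := hF.1.2.2 K hKB hK (T + t) (by linarith)
    refine ⟨fun τ => Real.exp (-t) * c (τ + t), fun τ => mul_nonneg (Real.exp_pos _).le (hc0 _), ?_, ?_⟩
    · have h1 : IntegrableOn c (Icc t (T + t)) := hci.mono_set (Icc_subset_Icc ht le_rfl)
      have h := ((measurePreserving_add_right (volume : Measure ℝ) t).integrableOn_comp_preimage
        (measurableEmbedding_addRight t) (f := c) (s := Icc t (T + t))).2 h1
      have h2 : IntegrableOn (fun τ => c (τ + t)) (Icc 0 T) := by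
        simpa [Function.comp_def] using h
      exact h2.const_mul _
    · intro z hz s s' hs hss hsT
      rw [← smul_sub, norm_smul, norm_exp, integral_const_mul]
      have h1 := hc z hz (s + t) (s' + t) (by linarith) (by linarith) (by linarith)
      have h2 := shift_integral (t := -t) c s s'
      simp only [sub_neg_eq_add] at h2
      rw [h2] at h1
      gcongr
  · intro s hs
    obtain ⟨h1, h2⟩ := hF.2 (s + t) (by linarith)
    refine ⟨by simp [h1], ?_⟩
    have := fderiv_scaled (hF.1.1 (s + t) (by linarith)).1 (-t) (s + t) h2
    simpa using this
  · intro K hKB hK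
    obtain ⟨M, hM⟩ := hN K hKB hK
    refine ⟨M, fun s hs z hz => ?_⟩
    have := hM (s + t) (by linarith) z hz
    simp only
    rw [norm_smul, norm_exp, ← mul_assoc, ← Real.exp_add]
    rwa [neg_add] at this

end glue

end Chain

/-- If f is an extreme point of S⁰(𝔹ₙ) and (f_t) is a normalized Loewner chain
with f₀ = f such that {e^{−t} f_t} is a normal family, then e^{−t}·f_t is an
extreme point of S⁰(𝔹ₙ) for every t ≥ 0. -/
theorem isExtremePoint_along_chain (n : ℕ) (f : En n → En n)
    (F : ℝ → En n → En n) (hF : IsNormalizedLoewnerChain n F)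
    (hN : IsNormalFamilyChain n F) (h0 : F 0 = f)
    (hf : IsExtremePointOf n {g | MemS0 n g} f) :
    ∀ t : ℝ, 0 ≤ t →
      IsExtremePointOf n {g | MemS0 n g} (fun z => (Real.exp (-t) : ℂ) • F t z) := by
  intro t ht
  refine ⟨Chain.shift_mem hF hN ht, ?_⟩
  rintro a ha b hb σ hσ0 hσ1 heq
  obtain ⟨ha1, A, hA, hAN, rfl⟩ : MemS0 n a := ha
  obtain ⟨hb1, B, hB, hBN, rfl⟩ : MemS0 n b := hb
  have hφ := hf.2 _ (Chain.glue_mem hF hA hAN ht) _ (Chain.glue_mem hF hB hBN ht) σ hσ0 hσ1 (by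
    intro z hz
    have hw := Chain.evo_mem hF le_rfl ht hz
    have h1 := heq hw
    simp only [Chain.evo_eq hF le_rfl ht hz, h0] at h1
    simp only
    rw [smul_comm σ, smul_comm (1 - σ), ← smul_add, ← h1, smul_smul, ← Complex.ofReal_mul,
      ← Real.exp_add]
    simp)
  apply Chain.identity ha1.1.1 hb1.1.1
  have hev : ∀ᶠ z in nhds (0 : En n), A 0 (evolution n F 0 t z) = B 0 (evolution n F 0 t z) := by
    filter_upwards [(Chain.isOpen_Ball n).mem_nhds (Chain.zero_mem n)] with z hz
    exact smul_right_injective _ (Chain.exp_ne t) (hφ hz)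
  obtain ⟨e, he⟩ := Chain.exists_equiv
    ⟨Chain.evo_diff hF le_rfl ht, Chain.evo_inj hF le_rfl ht⟩ (Chain.zero_mem n)
  have hmap := he.map_nhds_eq_of_equiv
  rw [Chain.evo_zero hF le_rfl ht] at hmap
  change ∀ᶠ w in nhds (0 : En n), A 0 w = B 0 w
  rw [← hmap]
  exact hev

end
end
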